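/- arXiv:1904.06911 — 2 statements merged into one kernel-verified Lean document; each statement's English description precedes it below -/
import Mathlib

section
/- Every centrally symmetric convex decagon P centered at the origin whose set of edge midpoints is D₁ satisfies: P + ℤ² is a six-fold lattice tiling of ℝ², and P admits no k-fold lattice tiling of ℝ² for any positive integer k < 6 (so τ*(P) = 6). -/
open Set Pointwise

noncomputable section

/-- A point of the plane `ℝ²`. -/
abbrev Pt : Type := ℝ × ℝ

/-- The standard integer lattice `ℤ² ⊆ ℝ²`. -/
def IntLattice : Set Pt := {p : Pt | ∃ a b : ℤ, p = ((a : ℝ), (b : ℝ))}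

/-- A lattice in `ℝ²` is the image of `ℤ²` under an invertible linear map. -/
def IsLattice (L : Set Pt) : Prop :=
  ∃ B : Pt ≃ₗ[ℝ] Pt, L = B '' IntLattice

/-- `K + L` is a `k`-fold lattice tiling of the plane: `L` is a lattice, every point lies in
at least `k` translates `K + l` (`l ∈ L`), and every point lies in at most `k` translates
`interior K + l`. -/
def IsKFoldLatticeTiling (K L : Set Pt) (k : ℕ) : Prop :=
  IsLattice L ∧
  (∀ p : Pt, (k : ℕ∞) ≤ {l ∈ L | p - l ∈ K}.encard) ∧
  (∀ p : Pt, {l ∈ L | p - l ∈ interior K}.encard ≤ (k : ℕ∞))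

/-- A discrete multiset of points of the plane, given as a family `x : I → ℝ²`:
every bounded set contains `x i` for only finitely many indices. -/
def IsDiscreteFamily {I : Type} (x : I → Pt) : Prop :=
  ∀ B : Set Pt, Bornology.IsBounded B → {i : I | x i ∈ B}.Finite

/-- `K + X` is a `k`-fold translative tiling of the plane, for the discrete multiset
`X = (x i)_{i ∈ I}`: every point lies in `K + x i` for at least `k` indices, and in
`interior K + x i` for at most `k` indices. -/
def IsKFoldTranslativeTiling {I : Type} (K : Set Pt) (x : I → Pt) (k : ℕ) : Prop :=
  IsDiscreteFamily x ∧
  (∀ p : Pt, (k : ℕ∞) ≤ {i : I | p - x i ∈ K}.encard) ∧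
  (∀ p : Pt, {i : I | p - x i ∈ interior K}.encard ≤ (k : ℕ∞))

/-- A convex polygon with exactly `n` vertices: a compact convex set with nonempty interior
which is the convex hull of its finitely many (`n`) extreme points. -/
def IsConvexPolygon (P : Set Pt) (n : ℕ) : Prop :=
  Convex ℝ P ∧ IsCompact P ∧ (interior P).Nonempty ∧
  (Set.extremePoints ℝ P).Finite ∧ (Set.extremePoints ℝ P).ncard = n ∧
  P = convexHull ℝ (Set.extremePoints ℝ P)

/-- `[a, b]` is an edge of the polygon `P`: a nondegenerate segment which is an extreme
(face) subset of `P`. -/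
def IsEdgeOf (P : Set Pt) (a b : Pt) : Prop :=
  a ≠ b ∧ IsExtreme ℝ P (segment ℝ a b)

/-- The set of midpoints of the edges of `P`. -/
def edgeMidpoints (P : Set Pt) : Set Pt :=
  {u : Pt | ∃ a b : Pt, IsEdgeOf P a b ∧ u = midpoint ℝ a b}

/-- `P` is centrally symmetric (about some center `c`). -/
def CentrallySymmetric (P : Set Pt) : Prop :=
  ∃ c : Pt, ∀ x : Pt, x ∈ P ↔ c + c - x ∈ P

/-- `D` is a parallelogram. -/
def IsParallelogram (D : Set Pt) : Prop :=
  ∃ v a b : Pt, LinearIndependent ℝ ![a, b] ∧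
    D = convexHull ℝ ({v, v + a, v + b, v + a + b} : Set Pt)

/-- The octagon `P₈(α)`, with vertices `±(α−1, 2), ±(α, −2), ±(1−α, 0), ±(1+α, −1)`. -/
def P8 (α : ℝ) : Set Pt :=
  convexHull ℝ ({(α - 1, 2), (α, -2), (1 - α, 0), (1 + α, -1),
                 (1 - α, -2), (-α, 2), (α - 1, 0), (-(1 + α), 1)} : Set Pt)

/-- The ten points `D₁`. -/
def D1 : Set Pt :=
  {(-1, 1/2), (1/2, 1), (3/2, 1), (2, 1/2), (2, 0),
   (1, -1/2), (-1/2, -1), (-3/2, -1), (-2, -1/2), (-2, 0)}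

/-- The ten points `D₂`. -/
def D2 : Set Pt :=
  {(1/2, -1), (3/2, -1/2), (2, 0), (3/2, 1/2), (1/2, 1),
   (-1/2, 1), (-3/2, 1/2), (-2, 0), (-3/2, -1/2), (-1/2, -1)}

/-- The set `(1/2)Λ = {λ/2 : λ ∈ Λ}`. -/
def halfSet (L : Set Pt) : Set Pt := (fun l : Pt => (2⁻¹ : ℝ) • l) '' L

/-- A cyclic enumeration `v : ZMod n → ℝ²` of the vertices of a convex polygon `P` with `n`
vertices: `v` is injective, its range is the vertex set of `P`, and consecutive vertices are
joined by edges of `P`. -/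
def IsCyclicVertexEnum (P : Set Pt) (n : ℕ) (v : ZMod n → Pt) : Prop :=
  Function.Injective v ∧ Set.range v = Set.extremePoints ℝ P ∧
  ∀ i : ZMod n, IsEdgeOf P (v i) (v (i + 1))

/-- The planar cross product. -/
def crs (p q : Pt) : ℝ := p.1 * q.2 - p.2 * q.1

theorem edge_endpoints_extreme {P : Set Pt} {a b : Pt} (h : IsEdgeOf P a b) :
    a ∈ Set.extremePoints ℝ P ∧ b ∈ Set.extremePoints ℝ P := by
  have key : ∀ a b : Pt, a ∈ Set.extremePoints ℝ (segment ℝ a b) := by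
    intro a b
    refine ⟨left_mem_segment ℝ a b, ?_⟩
    intro x hx y hy hxy
    rw [segment_eq_image'] at hx hy
    rw [openSegment_eq_image'] at hxy
    obtain ⟨s, hs, rfl⟩ := hx
    obtain ⟨t, ht, rfl⟩ := hy
    obtain ⟨r, hr, hr'⟩ := hxy
    have h1 : ((1 - r) * s + r * t) • (b - a) = 0 := by
      have := hr'
      simp only at this
      have h2 : a + s • (b - a) + r • (a + t • (b - a) - (a + s • (b - a))) - a
        = ((1 - r) * s + r * t) • (b - a) := by module
      rw [← h2, this, sub_self]
    rcases smul_eq_zero.1 h1 with h2 | h2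
    · have hs0 : s = 0 := by
        have := mul_nonneg hr.1.le ht.1
        have h3 := mul_nonneg (sub_pos.2 hr.2).le hs.1
        have h4 : (1 - r) * s = 0 := by linarith
        rcases mul_eq_zero.1 h4 with h5 | h5
        · linarith [hr.2]
        · exact h5
      simp [hs0]
    · simp [h2]
  have h2 := h.2
  refine ⟨h2.extremePoints_subset_extremePoints (key a b), ?_⟩
  have := key b a
  rw [segment_symm] at this
  exact h2.extremePoints_subset_extremePoints this

theorem extreme_mem_segment {P : Set Pt} {a b e : Pt} (ha : a ∈ P) (hb : b ∈ P)
    (he : e ∈ Set.extremePoints ℝ P) (h : e ∈ segment ℝ a b) : e = a ∨ e = b := by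
  rcases (mem_extremePoints_iff_forall_segment.1 he).2 a ha b hb h with h | h
  · exact Or.inl h.symm
  · exact Or.inr h.symm

theorem zero_mem_interior {P : Set Pt} (hc : Convex ℝ P) (hi : (interior P).Nonempty)
    (hsym : P = -P) : (0 : Pt) ∈ interior P := by
  obtain ⟨x, hx⟩ := hi
  have hx' : -x ∈ interior P := by
    have h1 := (Homeomorph.neg Pt).preimage_interior P
    have h2 : (Homeomorph.neg Pt) ⁻¹' P = P := by
      conv_rhs => rw [hsym]
      rfl
    rw [h2] at h1
    have h3 : -x ∈ (Homeomorph.neg Pt) ⁻¹' interior P := by simpa using hx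
    rwa [h1] at h3
  have := hc.interior hx hx' (a := 1/2) (b := 1/2) (by norm_num) (by norm_num) (by norm_num)
  simpa using this

theorem edge_functional {P : Set Pt} (hc : Convex ℝ P) (h0 : (0 : Pt) ∈ interior P)
    {a b u : Pt} (h : IsEdgeOf P a b) (hu : u = midpoint ℝ a b) :
    ∃ f : Pt →ₗ[ℝ] ℝ, f a = 1 ∧ f b = 1 ∧ f u = 1 ∧ (∀ p ∈ P, f p ≤ 1) ∧
      ∀ p ∈ P, f p = 1 → p ∈ segment ℝ a b := by
  have hum : u ∈ segment ℝ a b := by rw [hu]; exact midpoint_mem_segment a b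
  have hab : b - a ≠ 0 := sub_ne_zero.2 h.1.symm
  have hu2 : u = a + (1/2 : ℝ) • (b - a) := by
    rw [hu, midpoint_eq_smul_add]; simp only [one_div, invOf_eq_inv]; module
  have hui : u ∉ interior P := by
    intro hui
    set n : Pt := (-(b - a).2, (b - a).1) with hn
    have hcont : Continuous fun t : ℝ => u + t • n := by fun_prop
    have hev : ∀ᶠ t in nhds (0 : ℝ), u + t • n ∈ P := by
      have : Filter.Tendsto (fun t : ℝ => u + t • n) (nhds 0) (nhds u) := by
        have := hcont.tendsto 0
        simpa using this
      exact this.eventually (mem_interior_iff_mem_nhds.1 hui)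
    obtain ⟨ε, hε, hball⟩ := Metric.eventually_nhds_iff.1 hev
    have h1 : u + (ε/2) • n ∈ P := hball (by simp [abs_of_pos hε, hε])
    have h2 : u + (-(ε/2)) • n ∈ P := hball (by simp [abs_of_pos hε, hε])
    have h3 : u ∈ openSegment ℝ (u + (ε/2) • n) (u + (-(ε/2)) • n) :=
      ⟨1/2, 1/2, by norm_num, by norm_num, by norm_num, by module⟩
    have h4 := h.2.left_mem_of_mem_openSegment h1 h2 hum h3
    rw [segment_eq_image'] at h4
    obtain ⟨t, -, ht⟩ := h4
    simp only at ht
    have h5 : (t - 1/2) • (b - a) = (ε/2) • n := by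
      have : a + t • (b - a) - u = (ε/2) • n := by rw [ht]; simp
      rw [← this, hu2]; module
    have e1 := congrArg Prod.fst h5
    have e2 := congrArg Prod.snd h5
    simp only [hn, Prod.smul_fst, Prod.smul_snd, smul_eq_mul] at e1 e2
    have h6 : (ε/2) * ((b-a).1^2 + (b-a).2^2) = 0 := by
      linear_combination (b-a).2 * e1 - (b-a).1 * e2
    have h7 : (b-a).1^2 + (b-a).2^2 = 0 := by
      rcases mul_eq_zero.1 h6 with h | h
      · linarith
      · exact h
    apply hab
    ext
    · simp only [Prod.fst_zero]; nlinarith [sq_nonneg (b-a).1, sq_nonneg (b-a).2]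
    · simp only [Prod.snd_zero]; nlinarith [sq_nonneg (b-a).1, sq_nonneg (b-a).2]
  obtain ⟨f, hf⟩ := geometric_hahn_banach_open_point hc.interior isOpen_interior hui
  have hfu : 0 < f u := by simpa using hf 0 h0
  have hle : ∀ p ∈ P, f p ≤ f u := by
    intro p hp
    have hpc : p ∈ closure (interior P) := by
      rw [hc.closure_interior_eq_closure_of_nonempty_interior ⟨0, h0⟩]
      exact subset_closure hp
    have : closure (interior P) ⊆ {p | f p ≤ f u} :=
      closure_minimal (fun x hx => (hf x hx).le) (isClosed_le f.continuous continuous_const)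
    exact this hpc
  have haP : a ∈ P := h.2.subset (left_mem_segment ℝ a b)
  have hbP : b ∈ P := h.2.subset (right_mem_segment ℝ a b)
  have hfu2 : f u = (f a + f b) / 2 := by
    rw [hu2]; simp; ring
  have ha := hle a haP
  have hb := hle b hbP
  have hfa : f a = f u := by linarith
  have hfb : f b = f u := by linarith
  refine ⟨(f u)⁻¹ • (f : Pt →ₗ[ℝ] ℝ), ?_, ?_, ?_, ?_, ?_⟩
  · simp [hfa, hfu.ne']
  · simp [hfb, hfu.ne']
  · simp [hfu.ne']
  · intro p hp
    have := hle p hp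
    simp only [LinearMap.smul_apply, ContinuousLinearMap.coe_coe, smul_eq_mul]
    rw [inv_mul_le_iff₀ hfu]; linarith
  · intro p hp hp1
    have hfp : f p = f u := by
      simp only [LinearMap.smul_apply, ContinuousLinearMap.coe_coe, smul_eq_mul] at hp1
      field_simp at hp1; exact hp1
    have hpar : ∃ t : ℝ, p = u + t • (b - a) := by
      have hf1 : ∀ q : Pt, f q = q.1 * f (1, 0) + q.2 * f (0, 1) := by
        intro q
        have : q = q.1 • ((1, 0) : Pt) + q.2 • ((0, 1) : Pt) := by ext <;> simp
        conv_lhs => rw [this]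
        rw [map_add, map_smul, map_smul, smul_eq_mul, smul_eq_mul]
      have e1 : f (p - u) = 0 := by simp [hfp]
      have e2 : f (b - a) = 0 := by simp [hfa, hfb]
      rw [hf1] at e1 e2
      set A := f (1, 0)
      set C := f (0, 1)
      have hAC : A ^ 2 + C ^ 2 ≠ 0 := by
        intro h0
        have hA : A = 0 := by nlinarith [sq_nonneg A, sq_nonneg C]
        have hC : C = 0 := by nlinarith [sq_nonneg A, sq_nonneg C]
        have := hf1 u
        rw [hA, hC] at this
        linarith
      have hN : (b-a).1^2 + (b-a).2^2 ≠ 0 := by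
        intro h0
        apply hab
        ext
        · simp only [Prod.fst_zero]; nlinarith [sq_nonneg (b-a).1, sq_nonneg (b-a).2]
        · simp only [Prod.snd_zero]; nlinarith [sq_nonneg (b-a).1, sq_nonneg (b-a).2]
      have hcr : (p-u).1 * (b-a).2 - (p-u).2 * (b-a).1 = 0 := by
        have : (A^2 + C^2) * ((p-u).1 * (b-a).2 - (p-u).2 * (b-a).1) = 0 := by
          linear_combination (A * (b-a).2 - C * (b-a).1) * e1 + (C * (p-u).1 - A * (p-u).2) * e2
        exact (mul_eq_zero.1 this).resolve_left hAC
      refine ⟨((p-u).1 * (b-a).1 + (p-u).2 * (b-a).2) / ((b-a).1^2 + (b-a).2^2), ?_⟩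
      have : p - u = (((p-u).1 * (b-a).1 + (p-u).2 * (b-a).2) / ((b-a).1^2 + (b-a).2^2)) • (b - a) := by
        ext
        · simp only [Prod.smul_fst, smul_eq_mul]
          rw [div_mul_eq_mul_div, eq_div_iff hN]
          linear_combination (b-a).2 * hcr
        · simp only [Prod.smul_snd, smul_eq_mul]
          rw [div_mul_eq_mul_div, eq_div_iff hN]
          linear_combination -(b-a).1 * hcr
      rw [← this]; simp
    obtain ⟨t, ht⟩ := hpar
    by_cases h1 : 1/2 < t
    · -- b is in the open segment u p
      refine h.2.right_mem_of_mem_openSegment (h.2.subset hum) hp (right_mem_segment ℝ a b) ?_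
      rw [openSegment_eq_image']
      refine ⟨1 / (2 * t), ⟨by positivity, by rw [div_lt_one (by linarith)]; linarith⟩, ?_⟩
      simp only
      rw [ht, hu2]
      have : (1 / (2 * t)) * t = 1/2 := by field_simp
      rw [add_sub_cancel_left, smul_smul, this]
      module
    by_cases h2 : t < -(1/2)
    · refine h.2.right_mem_of_mem_openSegment (h.2.subset hum) hp (left_mem_segment ℝ a b) ?_
      rw [openSegment_eq_image']
      refine ⟨1 / (2 * (-t)), ⟨by have : 0 < -t := by linarith
                                  positivity, by rw [div_lt_one (by linarith)]; linarith⟩, ?_⟩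
      simp only
      rw [ht, hu2]
      have ht0 : t ≠ 0 := by linarith
      have : (1 / (2 * (-t))) * t = -(1/2) := by field_simp
      rw [add_sub_cancel_left, smul_smul, this]
      module
    · rw [segment_eq_image']
      refine ⟨t + 1/2, ⟨by linarith, by linarith⟩, ?_⟩
      simp only
      rw [ht, hu2]; module

theorem lin_expand (f : Pt →ₗ[ℝ] ℝ) (a b p : Pt) :
    crs a b * f p = crs p b * f a + crs a p * f b := by
  have : crs a b • p = crs p b • a + crs a p • b := by
    ext <;> simp [crs] <;> ring
  have h := congrArg f this
  simpa using h

/-- Going around from the midpoint `u` of an edge towards another edge midpoint `u'`, one meets the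
endpoint of the edge first. -/
theorem cone_lemma {P : Set Pt} (hc : Convex ℝ P) (h0 : (0 : Pt) ∈ interior P)
    {a b u a' b' u' : Pt} (h : IsEdgeOf P a b) (hu : u = midpoint ℝ a b)
    (h' : IsEdgeOf P a' b') (hu' : u' = midpoint ℝ a' b') (hne : u ≠ u')
    (σ : ℝ) (hσ : 0 < σ * crs u u') (hb : 0 < σ * crs u b) : 0 < σ * crs b u' := by
  by_contra hcon
  push Not at hcon
  obtain ⟨f, fa, fb, fu, hf, hf1⟩ := edge_functional hc h0 h hu
  obtain ⟨f', fa', fb', fu', hf', hf1'⟩ := edge_functional hc h0 h' hu'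
  have haP : a ∈ P := h.2.subset (left_mem_segment ℝ a b)
  have hbP : b ∈ P := h.2.subset (right_mem_segment ℝ a b)
  have haP' : a' ∈ P := h'.2.subset (left_mem_segment ℝ a' b')
  have hbP' : b' ∈ P := h'.2.subset (right_mem_segment ℝ a' b')
  have huP : u ∈ P := h.2.subset (by rw [hu]; exact midpoint_mem_segment a b)
  have huP' : u' ∈ P := h'.2.subset (by rw [hu']; exact midpoint_mem_segment a' b')
  have e1 := lin_expand f u b u'
  have e2 := lin_expand f' u b u'
  rw [fu, fb] at e1
  rw [fu'] at e2
  have hu'b : crs u' b = - crs b u' := by simp [crs]; ring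
  have hA : 0 ≤ σ * crs u' b := by rw [hu'b]; linarith
  have hk : f u' = 1 := by
    have i1 := hf u' huP'
    have i2 := hf' u huP
    have i3 := hf' b hbP
    have : σ * crs u b * 1 ≤ σ * crs u b * f u' := by
      have e1' : σ * crs u b * f u' = σ * crs u' b + σ * crs u u' := by
        linear_combination σ * e1
      have e2' : σ * crs u b * 1 = σ * crs u' b * f' u + σ * crs u u' * f' b := by
        linear_combination σ * e2
      rw [e1', e2']
      nlinarith
    have := le_of_mul_le_mul_left this hb
    linarith
  have hmid' : f u' = (f a' + f b') / 2 := by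
    rw [hu', midpoint_eq_smul_add]; simp; ring
  have j1 := hf a' haP'
  have j2 := hf b' hbP'
  have sa := hf1 a' haP' (by linarith)
  have sb := hf1 b' hbP' (by linarith)
  obtain ⟨ea, eb⟩ := edge_endpoints_extreme h'
  apply hne
  rcases extreme_mem_segment haP hbP ea sa with p | p <;>
    rcases extreme_mem_segment haP hbP eb sb with q | q
  · exact absurd (p.trans q.symm) h'.1
  · rw [hu, hu', p, q]
  · rw [hu, hu', p, q, midpoint_comm]
  · exact absurd (p.trans q.symm) h'.1

theorem edge_strict {P : Set Pt} (hc : Convex ℝ P) (h0 : (0 : Pt) ∈ interior P)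
    {a b u : Pt} (h : IsEdgeOf P a b) (hu : u = midpoint ℝ a b) (hab : 0 < crs a b)
    {p : Pt} (hp : p ∈ Set.extremePoints ℝ P) (hpa : p ≠ a) (hpb : p ≠ b) :
    crs p b + crs a p < crs a b := by
  obtain ⟨f, fa, fb, fu, hf, hf1⟩ := edge_functional hc h0 h hu
  have haP : a ∈ P := h.2.subset (left_mem_segment ℝ a b)
  have hbP : b ∈ P := h.2.subset (right_mem_segment ℝ a b)
  have e1 := lin_expand f a b p
  rw [fa, fb] at e1
  have hlt : f p < 1 := by
    refine lt_of_le_of_ne (hf p hp.1) ?_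
    intro h1
    rcases extreme_mem_segment haP hbP hp (hf1 p hp.1 h1) with q | q
    · exact hpa q
    · exact hpb q
  nlinarith

/-- The midpoints in counterclockwise order. -/
def cc : Fin 10 → Pt := ![(2,0),(2,1/2),(3/2,1),(1/2,1),(-1,1/2),
  (-2,0),(-2,-1/2),(-3/2,-1),(-1/2,-1),(1,-1/2)]

theorem cc_mem (i : Fin 10) : cc i ∈ D1 := by
  fin_cases i <;> simp [cc, D1]

/-- The open cone between two consecutive midpoints. -/
def InCone (i : Fin 10) (p : Pt) : Prop := 0 < crs (cc i) p ∧ 0 < crs p (cc (i + 1))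

set_option maxHeartbeats 2000000 in
theorem cone_disjoint (i j : Fin 10) (p : Pt) (hi : InCone i p) (hj : InCone j p) : i = j := by
  obtain ⟨x, y⟩ := p
  fin_cases i <;> fin_cases j <;> first
    | rfl
    | (exfalso
       simp [InCone, cc, crs] at hi hj
       obtain ⟨h1, h2⟩ := hi
       obtain ⟨h3, h4⟩ := hj
       linarith)

theorem cc_step (i : Fin 10) : 0 < crs (cc i) (cc (i + 1)) ∧ cc i ≠ cc (i + 1) := by
  fin_cases i <;> simp [crs, cc] <;> norm_num

theorem oriented_edge {P : Set Pt} (hc : Convex ℝ P) (h0 : (0 : Pt) ∈ interior P)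
    (hmid : edgeMidpoints P = D1) (i : Fin 10) :
    ∃ a b : Pt, IsEdgeOf P a b ∧ cc i = midpoint ℝ a b ∧ 0 < crs (cc i) b ∧ 0 < crs a (cc i)
      ∧ 0 < crs a b ∧ a + b = (2 : ℝ) • cc i := by
  have : cc i ∈ edgeMidpoints P := by rw [hmid]; exact cc_mem i
  obtain ⟨a, b, hab, hm⟩ := this
  obtain ⟨f, fa, fb, fu, hf, hf1⟩ := edge_functional hc h0 hab hm
  have hsum : a + b = (2 : ℝ) • cc i := by
    rw [hm, midpoint_eq_smul_add]; simp
  have hs1 := congrArg Prod.fst hsum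
  have hs2 := congrArg Prod.snd hsum
  simp only [Prod.fst_add, Prod.snd_add, Prod.smul_fst, Prod.smul_snd, smul_eq_mul] at hs1 hs2
  have c1 : crs a b = 2 * crs (cc i) b := by
    simp only [crs]; linear_combination b.2 * hs1 - b.1 * hs2
  have c2 : crs a b = 2 * crs a (cc i) := by
    simp only [crs]; linear_combination a.1 * hs2 - a.2 * hs1
  have hne : crs a b ≠ 0 := by
    intro h
    apply hab.1
    have key : ∀ g : Pt →ₗ[ℝ] ℝ, g a = g b := by
      intro g
      have h3 : f a • b = f b • a := by
        have hx : f a * b.1 = f b * a.1 ∧ f a * b.2 = f b * a.2 := by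
          have fe : ∀ q : Pt, f q = q.1 * f (1, 0) + q.2 * f (0, 1) := by
            intro q
            have : q = q.1 • ((1, 0) : Pt) + q.2 • ((0, 1) : Pt) := by ext <;> simp
            conv_lhs => rw [this]
            rw [map_add, map_smul, map_smul, smul_eq_mul, smul_eq_mul]
          simp only [crs] at h
          constructor
          · rw [fe a, fe b]; linear_combination -f (0, 1) * h
          · rw [fe a, fe b]; linear_combination f (1, 0) * h
        ext
        · simpa using hx.1
        · simpa using hx.2
      rw [fa, fb, one_smul, one_smul] at h3
      rw [h3]
    ext
    · exact key (LinearMap.fst ℝ ℝ ℝ)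
    · exact key (LinearMap.snd ℝ ℝ ℝ)
  rcases lt_or_gt_of_ne hne with h | h
  · have anti : ∀ p q : Pt, crs p q = - crs q p := by intro p q; simp only [crs]; ring
    refine ⟨b, a, ⟨hab.1.symm, by rw [segment_symm]; exact hab.2⟩, by rw [midpoint_comm]; exact hm,
      ?_, ?_, ?_, by rw [add_comm]; exact hsum⟩
    · rw [anti]; linarith
    · rw [anti]; linarith
    · rw [anti]; linarith
  · exact ⟨a, b, hab, hm, by linarith, by linarith, h, hsum⟩

/-- The vertices in counterclockwise order. -/
def zv (α β : ℝ) : Fin 10 → Pt := ![(2+α,β),(2-α,1-β),(1+α,1+β),(-α,1-β),(-2+α,β),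
  (-2-α,-β),(-2+α,-1+β),(-1-α,-1-β),(α,-1+β),(2-α,-β)]

theorem structure_thm {P : Set Pt} (hP : IsConvexPolygon P 10)
    (hsym : P = -P) (hmid : edgeMidpoints P = D1) :
    ∃ α β : ℝ, 0 < α ∧ 0 < β ∧ α + β < 1/2 ∧ 6 * β < 1 + 2 * α ∧ α < 2 * β ∧
      P = convexHull ℝ (Set.range (zv α β)) := by
  obtain ⟨hc, hcomp, hne, hfin, hcard, hhull⟩ := hP
  have h0 := zero_mem_interior hc hne hsym
  choose a b hab hm hcb hca hcab hsum using oriented_edge hc h0 hmid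
  have anti : ∀ p q : Pt, crs p q = - crs q p := by intro p q; simp only [crs]; ring
  have hbc : ∀ i, InCone i (b i) := by
    intro i
    refine ⟨hcb i, ?_⟩
    have := cone_lemma hc h0 (hab i) (hm i) (hab (i+1)) (hm (i+1)) (cc_step i).2 1
      (by rw [one_mul]; exact (cc_step i).1) (by rw [one_mul]; exact hcb i)
    linarith
  have hac : ∀ i, InCone i (a (i+1)) := by
    intro i
    refine ⟨?_, hca _⟩
    have he : IsEdgeOf P (b (i+1)) (a (i+1)) :=
      ⟨(hab _).1.symm, by rw [segment_symm]; exact (hab _).2⟩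
    have := cone_lemma hc h0 he (by rw [midpoint_comm]; exact hm (i+1)) (hab i) (hm i)
      (cc_step i).2.symm (-1)
      (by rw [anti]; linarith [(cc_step i).1]) (by rw [anti]; linarith [hca (i+1)])
    rw [anti]; linarith
  have hinj : Function.Injective b := fun i j hij => cone_disjoint i j (b i) (hbc i) (hij ▸ hbc j)
  have hrange : Set.range b = Set.extremePoints ℝ P := by
    apply Set.eq_of_subset_of_ncard_le
    · rintro _ ⟨i, rfl⟩; exact (edge_endpoints_extreme (hab i)).2
    · rw [hcard, ← Set.image_univ, Set.ncard_image_of_injective _ hinj]; simp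
    · exact hfin
  have hadj : ∀ i, a (i+1) = b i := by
    intro i
    have : a (i+1) ∈ Set.range b := by
      rw [hrange]; exact (edge_endpoints_extreme (hab (i+1))).1
    obtain ⟨j, hj⟩ := this
    have := cone_disjoint i j _ (hac i) (hj ▸ hbc j)
    rw [← hj, this]
  have hrec : ∀ i, b (i+1) = (2 : ℝ) • cc (i+1) - b i := by
    intro i; rw [← hsum, hadj]; simp
  have hz : b = zv ((b 0).1 - 2) (b 0).2 := by
    have b1 := hrec 0
    have b2 := hrec 1
    have b3 := hrec 2
    have b4 := hrec 3
    have b5 := hrec 4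
    have b6 := hrec 5
    have b7 := hrec 6
    have b8 := hrec 7
    have b9 := hrec 8
    simp only [Fin.isValue, Fin.reduceAdd, zero_add] at b1 b2 b3 b4 b5 b6 b7 b8 b9
    rw [b1] at b2
    rw [b2] at b3
    rw [b3] at b4
    rw [b4] at b5
    rw [b5] at b6
    rw [b6] at b7
    rw [b7] at b8
    rw [b8] at b9
    funext i
    fin_cases i
    all_goals simp only [Fin.isValue, Fin.zero_eta, Fin.mk_one, Fin.reduceFinMk]
    all_goals first | rw [b1] | rw [b2] | rw [b3] | rw [b4] | rw [b5] | rw [b6] | rw [b7] | rw [b8] | rw [b9] | skip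
    all_goals ext <;> simp [zv, cc] <;> ring
  set α := (b 0).1 - 2
  set β := (b 0).2
  have ne1 : ∀ i : Fin 10, i + 2 ≠ i := by decide
  have ne2 : ∀ i : Fin 10, i + 2 ≠ i + 1 := by decide
  have hstr : ∀ i, crs (b (i+2)) (b (i+1)) + crs (b i) (b (i+2)) < crs (b i) (b (i+1)) := by
    intro i
    have := edge_strict hc h0 (hab (i+1)) (hm (i+1)) (hcab (i+1))
      (p := b (i+2)) (edge_endpoints_extreme (hab _)).2
      (by rw [hadj]; intro h; exact absurd (hinj h) (ne1 i))
      (by intro h; exact absurd (hinj h) (ne2 i))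
    rwa [hadj] at this
  have s0 := hstr 0
  have s1 := hstr 1
  have s2 := hstr 2
  have s3 := hstr 3
  have s4 := hstr 4
  rw [hz] at s0 s1 s2 s3 s4
  simp [zv, crs] at s0 s1 s2 s3 s4
  refine ⟨α, β, ?_, ?_, ?_, ?_, ?_, ?_⟩
  rotate_left 5
  · rw [← hz, hrange]; exact hhull
  all_goals nlinarith

/-- The admissible parameters. -/
def Adm (α β : ℝ) : Prop :=
  0 < α ∧ 0 < β ∧ α + β < 1/2 ∧ 6 * β < 1 + 2 * α ∧ α < 2 * β

/-- Edge vectors. -/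
def gW (α β : ℝ) : Fin 5 → Pt :=
  ![(2*α,2*β), (-2*α,1-2*β), (-1+2*α,2*β), (-1-2*α,-2*β), (-2+2*α,-1+2*β)]

/-- Support values. -/
def hW (α β : ℝ) : Fin 5 → ℝ :=
  ![4*β, 2+α-4*β, 3*β+1-2*α, 1+2*α-β, 2-α-2*β]

/-- The half-plane description. -/
def HP (α β : ℝ) : Set Pt := {p | ∀ j, |crs p (gW α β j)| ≤ hW α β j}

def upx : Fin 5 → ℝ := ![-2, -1, 1/2, 3/2, 2]
def upy : Fin 5 → ℝ := ![0, 1/2, 1, 1, 1/2]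
def upm (α β : ℝ) : Fin 5 → ℝ :=
  ![β/α, (1-2*β)/(2-2*α), 2*β/(1+2*α), -(2*β)/(1-2*α), -(1-2*β)/(2*α)]
def uplo (α : ℝ) : Fin 5 → ℝ := ![-2-α, -2+α, -α, 1+α, 2-α]
def uphi (α : ℝ) : Fin 5 → ℝ := ![-2+α, -α, 1+α, 2-α, 2+α]

theorem seg_mem {P : Set Pt} (hc : Convex ℝ P) {A B : Pt} (hA : A ∈ P) (hB : B ∈ P)
    (hAB : A.1 < B.1) {x y : ℝ} (h1 : A.1 ≤ x) (h2 : x ≤ B.1)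
    (hy : (y - A.2) * (B.1 - A.1) = (x - A.1) * (B.2 - A.2)) : (x, y) ∈ P := by
  have hd : 0 < B.1 - A.1 := by linarith
  have : (x, y) ∈ segment ℝ A B := by
    rw [segment_eq_image']
    refine ⟨(x - A.1) / (B.1 - A.1), ⟨div_nonneg (by linarith) hd.le, ?_⟩, ?_⟩
    · rw [div_le_one hd]; linarith
    · ext
      · simp; field_simp; ring
      · simp only [Prod.snd_add, Prod.smul_snd, Prod.snd_sub, smul_eq_mul]
        rw [div_mul_eq_mul_div, ← hy]; field_simp; ring
  exact hc.segment_subset hA hB this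

theorem hull_sub_HP {α β : ℝ} (h : Adm α β) :
    convexHull ℝ (Set.range (zv α β)) ⊆ HP α β := by
  obtain ⟨h1, h2, h3, h4, h5⟩ := h
  apply convexHull_min
  · rintro _ ⟨i, rfl⟩ j
    rw [abs_le]
    fin_cases i <;> fin_cases j <;> simp [zv, gW, hW, crs] <;> constructor <;> nlinarith
  · intro p hp q hq s t hs ht hst j
    have hp := abs_le.1 (hp j)
    have hq := abs_le.1 (hq j)
    have : crs (s • p + t • q) (gW α β j) = s * crs p (gW α β j) + t * crs q (gW α β j) := by
      simp [crs]; ring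
    rw [this, abs_le]
    have ht' : t = 1 - s := by linarith
    subst ht'
    constructor <;> nlinarith

theorem zv_mem (α β : ℝ) (i : Fin 10) : zv α β i ∈ convexHull ℝ (Set.range (zv α β)) :=
  subset_convexHull ℝ _ ⟨i, rfl⟩

theorem up_mem {α β : ℝ} (h : Adm α β) (j : Fin 5) {x : ℝ} (hl : uplo α j ≤ x)
    (hh : x ≤ uphi α j) :
    (x, upy j + upm α β j * (x - upx j)) ∈ convexHull ℝ (Set.range (zv α β)) := by
  obtain ⟨h1, h2, h3, h4, h5⟩ := h
  have hc := convex_convexHull ℝ (Set.range (zv α β))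
  have hz := zv_mem α β
  have n1 : (2 - 2 * α) ≠ 0 := by linarith
  have n2 : (1 + 2 * α) ≠ 0 := by linarith
  have n3 : (1 - 2 * α) ≠ 0 := by linarith
  have n4 : (1 - α) ≠ 0 := by linarith
  fin_cases j
  · replace hl : -2-α ≤ x := hl
    replace hh : x ≤ -2+α := hh
    show (x, 0 + β/α*(x - -2)) ∈ _
    have p1 : ((-2-α,-β) : Pt) ∈ convexHull ℝ (Set.range (zv α β)) := hz 5
    have p2 : ((-2+α,β) : Pt) ∈ convexHull ℝ (Set.range (zv α β)) := hz 4
    refine seg_mem hc p1 p2 ?_ hl hh ?_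
    · show -2-α < -2+α
      linarith
    · simp only
      field_simp
      ring
  · replace hl : -2+α ≤ x := hl
    replace hh : x ≤ -α := hh
    show (x, 1/2 + (1-2*β)/(2-2*α)*(x - -1)) ∈ _
    have p1 : ((-2+α,β) : Pt) ∈ convexHull ℝ (Set.range (zv α β)) := hz 4
    have p2 : ((-α,1-β) : Pt) ∈ convexHull ℝ (Set.range (zv α β)) := hz 3
    refine seg_mem hc p1 p2 ?_ hl hh ?_
    · show -2+α < -α
      linarith
    · simp only
      field_simp
      ring
  · replace hl : -α ≤ x := hl
    replace hh : x ≤ 1+α := hh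
    show (x, 1 + 2*β/(1+2*α)*(x - 1/2)) ∈ _
    have p1 : ((-α,1-β) : Pt) ∈ convexHull ℝ (Set.range (zv α β)) := hz 3
    have p2 : ((1+α,1+β) : Pt) ∈ convexHull ℝ (Set.range (zv α β)) := hz 2
    refine seg_mem hc p1 p2 ?_ hl hh ?_
    · show -α < 1+α
      linarith
    · simp only
      field_simp
      ring
  · replace hl : 1+α ≤ x := hl
    replace hh : x ≤ 2-α := hh
    show (x, 1 + -(2*β)/(1-2*α)*(x-3/2)) ∈ _
    have p1 : ((1+α,1+β) : Pt) ∈ convexHull ℝ (Set.range (zv α β)) := hz 2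
    have p2 : ((2-α,1-β) : Pt) ∈ convexHull ℝ (Set.range (zv α β)) := hz 1
    refine seg_mem hc p1 p2 ?_ hl hh ?_
    · show 1+α < 2-α
      linarith
    · simp only
      field_simp
      ring
  · replace hl : 2-α ≤ x := hl
    replace hh : x ≤ 2+α := hh
    show (x, 1/2 + -(1-2*β)/(2*α)*(x-2)) ∈ _
    have p1 : ((2-α,1-β) : Pt) ∈ convexHull ℝ (Set.range (zv α β)) := hz 1
    have p2 : ((2+α,β) : Pt) ∈ convexHull ℝ (Set.range (zv α β)) := hz 0
    refine seg_mem hc p1 p2 ?_ hl hh ?_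
    · show 2-α < 2+α
      linarith
    · simp only
      field_simp
      ring

theorem le_line {y k c n t : ℝ} (hc : 0 < c) (h : (y - k) * c ≤ n * t) : y ≤ k + n / c * t := by
  rw [← sub_le_iff_le_add', div_mul_eq_mul_div, le_div_iff₀ hc]; exact h

theorem lt_line {y k c n t : ℝ} (hc : 0 < c) (h : (y - k) * c < n * t) : y < k + n / c * t := by
  rw [← sub_lt_iff_lt_add', div_mul_eq_mul_div, lt_div_iff₀ hc]; exact h

theorem le_up {α β : ℝ} (h : Adm α β) (j : Fin 5) {x y : ℝ} (hp : (x, y) ∈ HP α β) :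
    y ≤ upy j + upm α β j * (x - upx j) := by
  obtain ⟨h1, h2, h3, h4, h5⟩ := h
  have k0 := abs_le.1 (hp 0)
  have k1 := abs_le.1 (hp 1)
  have k2 := abs_le.1 (hp 2)
  have k3 := abs_le.1 (hp 3)
  have k4 := abs_le.1 (hp 4)
  have n1 : 0 < (2 - 2 * α) := by linarith
  have n2 : 0 < (1 + 2 * α) := by linarith
  have n3 : 0 < (1 - 2 * α) := by linarith
  simp [crs, gW, hW] at k0 k1 k2 k3 k4
  fin_cases j
  · show y ≤ 0 + β/α*(x - -2)
    exact le_line h1 (by linarith [k0.1])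
  · show y ≤ 1/2 + (1-2*β)/(2-2*α)*(x - -1)
    exact le_line n1 (by linarith [k4.2])
  · show y ≤ 1 + 2*β/(1+2*α)*(x - 1/2)
    exact le_line n2 (by linarith [k3.2])
  · show y ≤ 1 + -(2*β)/(1-2*α)*(x-3/2)
    exact le_line n3 (by linarith [k2.2])
  · show y ≤ 1/2 + -(1-2*β)/(2*α)*(x-2)
    exact le_line (by linarith) (by linarith [k1.2])


theorem abs_fst_le {α β : ℝ} {x y : ℝ} (hp : (x, y) ∈ HP α β) : |x| ≤ 2 + α := by
  have k0 := abs_le.1 (hp 0)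
  have k1 := abs_le.1 (hp 1)
  simp [crs, gW, hW] at k0 k1
  rw [abs_le]; constructor <;> linarith [k0.1, k0.2, k1.1, k1.2]

theorem HP_neg {α β : ℝ} {p : Pt} (hp : p ∈ HP α β) : -p ∈ HP α β := by
  intro j
  have : crs (-p) (gW α β j) = - crs p (gW α β j) := by simp [crs]; ring
  rw [this, abs_neg]; exact hp j

theorem hull_neg {α β : ℝ} {p : Pt} (hp : p ∈ convexHull ℝ (Set.range (zv α β))) :
    -p ∈ convexHull ℝ (Set.range (zv α β)) := by
  have h1 : -(Set.range (zv α β)) ⊆ Set.range (zv α β) := by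
    intro q hq
    obtain ⟨i, hi⟩ := hq
    have hq : q = -(zv α β i) := by rw [hi]; simp
    refine ⟨i + 5, ?_⟩
    rw [hq]
    fin_cases i <;> ext <;> simp [zv] <;> ring
  have h2 : -p ∈ -(convexHull ℝ (Set.range (zv α β))) := by simpa using hp
  rw [← convexHull_neg] at h2
  exact convexHull_mono h1 h2

theorem exists_up {α : ℝ} {x : ℝ} (hx : |x| ≤ 2 + α) :
    ∃ j, uplo α j ≤ x ∧ x ≤ uphi α j := by
  obtain ⟨h1, h2⟩ := abs_le.1 hx
  by_cases a1 : x ≤ -2 + α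
  · exact ⟨0, by simp [uplo]; linarith, by simpa [uphi] using a1⟩
  by_cases a2 : x ≤ -α
  · exact ⟨1, by simp [uplo]; linarith, by simpa [uphi] using a2⟩
  by_cases a3 : x ≤ 1 + α
  · exact ⟨2, by simp [uplo]; linarith, by simpa [uphi] using a3⟩
  by_cases a4 : x ≤ 2 - α
  · exact ⟨3, by simp [uplo]; linarith, by simpa [uphi] using a4⟩
  · exact ⟨4, by simp [uplo]; linarith, by simpa [uphi] using h2⟩

theorem vert_mem {P : Set Pt} (hc : Convex ℝ P) {x l u y : ℝ} (hl : (x, l) ∈ P) (hu : (x, u) ∈ P)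
    (h1 : l ≤ y) (h2 : y ≤ u) : (x, y) ∈ P := by
  have : (x, y) ∈ segment ℝ ((x, l) : Pt) (x, u) := by
    rw [← Prod.image_mk_segment_right, segment_eq_Icc (h1.trans h2)]
    exact ⟨y, ⟨h1, h2⟩, rfl⟩
  exact hc.segment_subset hl hu this

theorem hull_eq_HP {α β : ℝ} (h : Adm α β) :
    convexHull ℝ (Set.range (zv α β)) = HP α β := by
  apply Set.Subset.antisymm (hull_sub_HP h)
  rintro ⟨x, y⟩ hp
  have hx := abs_fst_le hp
  have hp' := HP_neg hp
  obtain ⟨j, j1, j2⟩ := exists_up hx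
  obtain ⟨i, i1, i2⟩ := exists_up (α := α) (x := -x) (by rwa [abs_neg])
  have u1 := up_mem h j j1 j2
  have u2 := hull_neg (up_mem h i i1 i2)
  have b1 := le_up h j hp
  have b2 := le_up h i (x := -x) (y := -y) hp'
  simp only [Prod.neg_mk, neg_neg] at u2
  exact vert_mem (convex_convexHull ℝ _) u2 u1 (by linarith) b1

/-- A linear functional bounded on a set is strictly bounded on the interior. -/
theorem lt_of_interior {P : Set Pt} {w : Pt} (hw : w ≠ 0) {c : ℝ} (h : ∀ p ∈ P, crs p w ≤ c)
    {p : Pt} (hp : p ∈ interior P) : crs p w < c := by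
  set n : Pt := (w.2, -w.1) with hn
  have hev : ∀ᶠ t in nhds (0 : ℝ), p + t • n ∈ P := by
    have hcont : Continuous fun t : ℝ => p + t • n := by fun_prop
    have : Filter.Tendsto (fun t : ℝ => p + t • n) (nhds 0) (nhds p) := by
      have := hcont.tendsto 0
      simpa using this
    exact this.eventually (mem_interior_iff_mem_nhds.1 hp)
  obtain ⟨ε, hε, hball⟩ := Metric.eventually_nhds_iff.1 hev
  have h1 := h _ (hball (y := ε/2) (by simp [abs_of_pos hε, hε]))
  have h2 : crs (p + (ε/2) • n) w = crs p w + (ε/2) * (w.1^2 + w.2^2) := by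
    simp [crs, hn]; ring
  have h3 : 0 < w.1^2 + w.2^2 := by
    by_contra hcon
    apply hw
    ext
    · simp only [Prod.fst_zero]; nlinarith [sq_nonneg w.1, sq_nonneg w.2]
    · simp only [Prod.snd_zero]; nlinarith [sq_nonneg w.1, sq_nonneg w.2]
  have : 0 < (ε/2) * (w.1^2 + w.2^2) := by positivity
  linarith

theorem gW_ne {α β : ℝ} (h : Adm α β) (j : Fin 5) : gW α β j ≠ 0 := by
  obtain ⟨h1, h2, h3, h4, h5⟩ := h
  intro h0
  have := congrArg Prod.fst h0
  fin_cases j <;> simp [gW] at this <;> linarith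

theorem strict_of_interior {α β : ℝ} (h : Adm α β) {p : Pt} (hp : p ∈ interior (HP α β))
    (j : Fin 5) : |crs p (gW α β j)| < hW α β j := by
  rw [abs_lt]
  constructor
  · have := lt_of_interior (P := HP α β) (w := -gW α β j) (neg_ne_zero.2 (gW_ne h j))
      (c := hW α β j) (fun q (hq : q ∈ HP α β) => ?_) hp
    · have e : crs p (-gW α β j) = - crs p (gW α β j) := by simp [crs]; ring
      linarith
    · have e : crs q (-gW α β j) = - crs q (gW α β j) := by simp [crs]; ring
      linarith [(abs_le.1 (hq j)).1]
  · exact lt_of_interior (P := HP α β) (gW_ne h j) (fun q hq => (abs_le.1 (hq j)).2) hp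

theorem lt_up {α β : ℝ} (h : Adm α β) (j : Fin 5) {x y : ℝ} (hp : (x, y) ∈ interior (HP α β)) :
    y < upy j + upm α β j * (x - upx j) := by
  have k0 := abs_lt.1 (strict_of_interior h hp 0)
  have k1 := abs_lt.1 (strict_of_interior h hp 1)
  have k2 := abs_lt.1 (strict_of_interior h hp 2)
  have k3 := abs_lt.1 (strict_of_interior h hp 3)
  have k4 := abs_lt.1 (strict_of_interior h hp 4)
  obtain ⟨h1, h2, h3, h4, h5⟩ := h
  have n1 : 0 < (2 - 2 * α) := by linarith
  have n2 : 0 < (1 + 2 * α) := by linarith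
  have n3 : 0 < (1 - 2 * α) := by linarith
  simp [crs, gW, hW] at k0 k1 k2 k3 k4
  fin_cases j
  · show y < 0 + β/α*(x - -2)
    exact lt_line h1 (by linarith [k0.1])
  · show y < 1/2 + (1-2*β)/(2-2*α)*(x - -1)
    exact lt_line n1 (by linarith [k4.2])
  · show y < 1 + 2*β/(1+2*α)*(x - 1/2)
    exact lt_line n2 (by linarith [k3.2])
  · show y < 1 + -(2*β)/(1-2*α)*(x-3/2)
    exact lt_line n3 (by linarith [k2.2])
  · show y < 1/2 + -(1-2*β)/(2*α)*(x-2)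
    exact lt_line (by linarith) (by linarith [k1.2])


theorem abs_fst_lt {α β : ℝ} (h : Adm α β) {x y : ℝ} (hp : (x, y) ∈ interior (HP α β)) :
    |x| < 2 + α := by
  have k0 := abs_lt.1 (strict_of_interior h hp 0)
  have k1 := abs_lt.1 (strict_of_interior h hp 1)
  simp [crs, gW, hW] at k0 k1
  rw [abs_lt]; constructor <;> linarith [k0.1, k0.2, k1.1, k1.2]

theorem interior_neg_mem {α β : ℝ} {p : Pt} (hp : p ∈ interior (HP α β)) :
    -p ∈ interior (HP α β) := by
  have h1 := (Homeomorph.neg Pt).preimage_interior (HP α β)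
  have h2 : (Homeomorph.neg Pt) ⁻¹' (HP α β) = HP α β := by
    ext q
    constructor
    · intro hq
      have : - -q ∈ HP α β := HP_neg hq
      simpa using this
    · exact fun hq => HP_neg hq
  rw [h2] at h1
  have h3 : -p ∈ (Homeomorph.neg Pt) ⁻¹' interior (HP α β) := by simpa using hp
  rwa [h1] at h3

theorem convex_HP {α β : ℝ} (h : Adm α β) : Convex ℝ (HP α β) := by
  rw [← hull_eq_HP h]; exact convex_convexHull ℝ _

theorem column_count {K : Set Pt} {N : ℕ} (c : Fin N → ℤ) (hc : Function.Injective c)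
    (U : Fin N → ℝ) (s : Fin N → ℤ) (σ : Fin N → Fin N) (hσ : Function.Bijective σ)
    (k : ℕ) (hs : ∑ i, s i = k) (px py : ℝ) (m : ℤ)
    (hlt : ∀ i, U (σ i) - s i < U i)
    (hmem : ∀ i y, U (σ i) - s i ≤ y → y ≤ U i → (px - m + c i, y) ∈ K)
    (hIn : ∀ (z : ℤ) y, (px - m + z, y) ∈ interior K →
      ∃ i, c i = z ∧ U (σ i) - s i < y ∧ y < U i) :
    (k : ℕ∞) ≤ {l ∈ IntLattice | ((px, py) : Pt) - l ∈ K}.encard ∧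
    {l ∈ IntLattice | ((px, py) : Pt) - l ∈ interior K}.encard ≤ (k : ℕ∞) := by
  classical
  set f : (Σ _ : Fin N, ℤ) → Pt := fun q => (((m - c q.1 : ℤ) : ℝ), (q.2 : ℝ)) with hf
  have hfinj : Function.Injective f := by
    rintro ⟨i, n⟩ ⟨j, n'⟩ h
    simp only [hf, Prod.mk.injEq, Int.cast_inj] at h
    have : i = j := hc (by omega)
    subst this
    simp [h.2]
  have hperm : ∀ g : Fin N → ℤ, ∑ i, g (σ i) = ∑ i, g i := fun g => hσ.sum_comp g
  constructor
  · set F : Finset (Σ _ : Fin N, ℤ) :=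
      Finset.univ.sigma (fun i => Finset.Icc ⌈py - U i⌉ ⌊py - (U (σ i) - s i)⌋) with hF
    have hsub : f '' (F : Set _) ⊆ {l ∈ IntLattice | ((px, py) : Pt) - l ∈ K} := by
      rintro _ ⟨⟨i, n⟩, hq, rfl⟩
      simp only [hF, Finset.coe_sigma, Set.mem_sigma_iff, Finset.mem_coe, Finset.mem_Icc,
        Int.ceil_le, Int.le_floor] at hq
      refine ⟨⟨_, _, rfl⟩, ?_⟩
      have := hmem i (py - n) (by linarith [hq.2.2]) (by linarith [hq.2.1])
      convert this using 1
      simp only [hf]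
      ext
      · simp; ring
      · simp
    refine le_trans ?_ (Set.encard_le_encard hsub)
    rw [hfinj.encard_image, Set.encard_coe_eq_coe_finsetCard]
    have hcard : (k : ℤ) ≤ F.card := by
      rw [hF, Finset.card_sigma]
      push_cast
      calc (k : ℤ) = ∑ i, s i := hs.symm
        _ ≤ ∑ i, (s i + (⌊py - U i⌋ + 1 - ⌈py - U i⌉)) := by
            apply Finset.sum_le_sum
            intro i _
            have := Int.ceil_le_floor_add_one (py - U i)
            linarith
        _ = ∑ i, (⌊py - U (σ i)⌋ + s i + 1 - ⌈py - U i⌉) := by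
            have := hperm (fun i => ⌊py - U i⌋)
            simp only [Finset.sum_add_distrib, Finset.sum_sub_distrib] at this ⊢
            linarith
        _ ≤ _ := by
            apply Finset.sum_le_sum
            intro i _
            rw [Int.card_Icc]
            have : ⌊py - (U (σ i) - s i)⌋ = ⌊py - U (σ i)⌋ + s i := by
              rw [← Int.floor_add_intCast]; congr 1; ring
            rw [this]
            have := Int.self_le_toNat (⌊py - U (σ i)⌋ + s i + 1 - ⌈py - U i⌉)
            linarith
    exact_mod_cast hcard
  · set F : Finset (Σ _ : Fin N, ℤ) :=
      Finset.univ.sigma (fun i => Finset.Icc (⌊py - U i⌋ + 1) (⌈py - (U (σ i) - s i)⌉ - 1)) with hF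
    have hsub : {l ∈ IntLattice | ((px, py) : Pt) - l ∈ interior K} ⊆ f '' (F : Set _) := by
      rintro _ ⟨⟨a, b, rfl⟩, hl⟩
      have : ((px - m + (m - a : ℤ), py - b) : Pt) ∈ interior K := by
        convert hl using 1
        ext
        · simp
        · simp
      obtain ⟨i, hi, h1, h2⟩ := hIn _ _ this
      refine ⟨⟨i, b⟩, ?_, ?_⟩
      · simp only [hF, Finset.coe_sigma, Set.mem_sigma_iff, Finset.mem_coe, Finset.mem_Icc,
          Finset.mem_univ, true_and, Int.add_one_le_iff, Int.le_sub_one_iff, Int.floor_lt,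
          Int.lt_ceil]
        constructor <;> linarith
      · simp only [hf]
        ext
        · simp [hi]
        · simp
    refine le_trans (Set.encard_le_encard hsub) ?_
    rw [hfinj.encard_image, Set.encard_coe_eq_coe_finsetCard]
    have hcard : (F.card : ℤ) ≤ k := by
      rw [hF, Finset.card_sigma]
      push_cast
      calc _ ≤ ∑ i, (⌈py - U (σ i)⌉ + s i - ⌊py - U i⌋ - 1) := by
            apply Finset.sum_le_sum
            intro i _
            rw [Int.card_Icc]
            have e : ⌈py - (U (σ i) - s i)⌉ = ⌈py - U (σ i)⌉ + s i := by
              rw [← Int.ceil_add_intCast]; congr 1; ring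
            have h3 : ⌊py - U i⌋ < ⌈py - (U (σ i) - s i)⌉ := by
              rw [Int.lt_ceil]
              have := Int.floor_le (py - U i)
              linarith [hlt i]
            rw [Int.toNat_of_nonneg (by omega)]
            omega
        _ = ∑ i, (s i + (⌈py - U i⌉ - ⌊py - U i⌋ - 1)) := by
            have := hperm (fun i => ⌈py - U i⌉)
            simp only [Finset.sum_add_distrib, Finset.sum_sub_distrib] at this ⊢
            linarith
        _ ≤ ∑ i, s i := by
            apply Finset.sum_le_sum
            intro i _
            have := Int.ceil_le_floor_add_one (py - U i)
            linarith
        _ = k := hs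
    exact_mod_cast hcard

theorem isLattice_int : IsLattice IntLattice := ⟨LinearEquiv.refl ℝ Pt, (Set.image_id _).symm⟩

set_option maxHeartbeats 4000000 in
theorem tiling_six {α β : ℝ} (h : Adm α β) : IsKFoldLatticeTiling (HP α β) IntLattice 6 := by
  have hcv := convex_HP h
  have hmem0 : ∀ (j i : Fin 5) (x y : ℝ), uplo α j ≤ x → x ≤ uphi α j → uplo α i ≤ -x →
      -x ≤ uphi α i → -(upy i + upm α β i * (-x - upx i)) ≤ y →
      y ≤ upy j + upm α β j * (x - upx j) → (x, y) ∈ HP α β := by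
    intro j i x y a1 a2 a3 a4 a5 a6
    have u1 := up_mem h j a1 a2
    have u2 := hull_neg (up_mem h i a3 a4)
    simp only [Prod.neg_mk, neg_neg] at u2
    rw [hull_eq_HP h] at u1 u2
    exact vert_mem hcv u2 u1 a5 a6
  have hint0 : ∀ (j i : Fin 5) (x y : ℝ), (x, y) ∈ interior (HP α β) →
      -(upy i + upm α β i * (-x - upx i)) < y ∧ y < upy j + upm α β j * (x - upx j) := by
    intro j i x y hp
    have h1 := lt_up h j hp
    have h2 := lt_up h i (x := -x) (y := -y) (interior_neg_mem hp)
    exact ⟨by linarith, h1⟩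
  suffices H : ∀ p : Pt, ((6 : ℕ) : ℕ∞) ≤ {l ∈ IntLattice | p - l ∈ HP α β}.encard ∧
      {l ∈ IntLattice | p - l ∈ interior (HP α β)}.encard ≤ ((6 : ℕ) : ℕ∞) from
    ⟨isLattice_int, fun p => (H p).1, fun p => (H p).2⟩
  rintro ⟨px, py⟩
  have habs := @abs_fst_lt α β h
  obtain ⟨h1, h2, h3, h4, h5⟩ := h
  obtain ⟨m, hm1, hm2⟩ : ∃ m : ℤ, -α < px - m ∧ px - m ≤ 1 - α := by
    refine ⟨⌈px + α⌉ - 1, ?_, ?_⟩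
    · have := Int.ceil_lt_add_one (px + α); push_cast; linarith
    · have := Int.le_ceil (px + α); push_cast; linarith
  set x0 := px - m with hx0
  set m0 := β / α with hm0
  set m4 := (1-2*β)/(2-2*α) with hm4
  set m3 := 2*β/(1+2*α) with hm3
  set m2 := -(2*β)/(1-2*α) with hm2'
  set m1 := -(1-2*β)/(2*α) with hm1'
  have um : upm α β = ![m0, m4, m3, m2, m1] := rfl
  have b4 : 0 < m4 ∧ m4 < 1 := by
    constructor
    · apply div_pos <;> linarith
    · rw [div_lt_one] <;> linarith
  have b3 : 0 < m3 ∧ m3 < 1 := by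
    constructor
    · apply div_pos <;> linarith
    · rw [div_lt_one] <;> linarith
  have b2 : -1 < m2 ∧ m2 < 0 := by
    constructor
    · rw [lt_div_iff₀] <;> linarith
    · apply div_neg_of_neg_of_pos <;> linarith
  by_cases hcase : x0 < α
  · apply column_count (N := 5) ![-2, -1, 0, 1, 2] (by decide)
      ![m0*x0, 1/2+m4*x0, 1+m3*(x0-1/2), 1+m3*(x0+1/2), 1/2+m1*x0]
      ![1, 2, 2, 1, 0] ![4, 2, 3, 1, 0] (by decide) 6 (by decide) px py m
    · have e01 : (m0 - m1) * x0 > -1/2 := by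
        have : m0 - m1 = 1 / (2*α) := by rw [hm0, hm1']; field_simp; ring
        rw [this, div_mul_eq_mul_div, gt_iff_lt, lt_div_iff₀] <;> linarith
      have e01' : (m0 - m1) * x0 < 1/2 := by
        have : m0 - m1 = 1 / (2*α) := by rw [hm0, hm1']; field_simp; ring
        rw [this, div_mul_eq_mul_div, div_lt_iff₀] <;> linarith
      intro i
      fin_cases i <;> simp <;> nlinarith
    · intro i y
      rw [← hx0]
      fin_cases i
      · intro ha hb
        simp at ha hb ⊢
        apply hmem0 0 4 <;> simp [um, uplo, uphi, upx, upy] <;> linarith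
      · intro ha hb
        simp at ha hb ⊢
        apply hmem0 1 2 <;> simp [um, uplo, uphi, upx, upy] <;> linarith
      · intro ha hb
        simp at ha hb ⊢
        apply hmem0 2 2 <;> simp [um, uplo, uphi, upx, upy] <;> linarith
      · intro ha hb
        simp at ha hb ⊢
        apply hmem0 2 1 <;> simp [um, uplo, uphi, upx, upy] <;> linarith
      · intro ha hb
        simp at ha hb ⊢
        apply hmem0 4 0 <;> simp [um, uplo, uphi, upx, upy] <;> linarith
    · intro z y hz
      have hab := abs_lt.1 (habs hz)
      have z1 : -3 < z := by
        have : (-3 : ℝ) < z := by linarith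
        exact_mod_cast this
      have z2 : z < 3 := by
        have : (z : ℝ) < 3 := by linarith
        exact_mod_cast this
      interval_cases z
      · refine ⟨0, rfl, ?_⟩
        have := hint0 0 4 _ _ hz
        simp [um, upx, upy] at this ⊢
        constructor <;> linarith
      · refine ⟨1, rfl, ?_⟩
        have := hint0 1 2 _ _ hz
        simp [um, upx, upy] at this ⊢
        constructor <;> linarith
      · refine ⟨2, rfl, ?_⟩
        have := hint0 2 2 _ _ hz
        simp [um, upx, upy] at this ⊢
        constructor <;> linarith
      · refine ⟨3, rfl, ?_⟩
        have := hint0 2 1 _ _ hz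
        simp [um, upx, upy] at this ⊢
        constructor <;> linarith
      · refine ⟨4, rfl, ?_⟩
        have := hint0 4 0 _ _ hz
        simp [um, upx, upy] at this ⊢
        constructor <;> linarith
  · push Not at hcase
    apply column_count (N := 4) ![-2, -1, 0, 1] (by decide)
      ![1/2+m4*(x0-1), 1/2+m4*x0, 1+m3*(x0-1/2), 1+m2*(x0-1/2)]
      ![2, 2, 1, 1] ![3, 2, 0, 1] (by decide) 6 (by decide) px py m
    · intro i
      fin_cases i <;> simp <;> nlinarith
    · intro i y
      rw [← hx0]
      fin_cases i
      · intro ha hb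
        simp at ha hb ⊢
        apply hmem0 1 3 <;> simp [um, uplo, uphi, upx, upy] <;> linarith
      · intro ha hb
        simp at ha hb ⊢
        apply hmem0 1 2 <;> simp [um, uplo, uphi, upx, upy] <;> linarith
      · intro ha hb
        simp at ha hb ⊢
        apply hmem0 2 1 <;> simp [um, uplo, uphi, upx, upy] <;> linarith
      · intro ha hb
        simp at ha hb ⊢
        apply hmem0 3 1 <;> simp [um, uplo, uphi, upx, upy] <;> linarith
    · intro z y hz
      have hab := abs_lt.1 (habs hz)
      have z1 : -3 < z := by
        have : (-3 : ℝ) < z := by linarith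
        exact_mod_cast this
      have z2 : z < 2 := by
        have : (z : ℝ) < 2 := by linarith
        exact_mod_cast this
      interval_cases z
      · refine ⟨0, rfl, ?_⟩
        have := hint0 1 3 _ _ hz
        simp [um, upx, upy] at this ⊢
        constructor <;> linarith
      · refine ⟨1, rfl, ?_⟩
        have := hint0 1 2 _ _ hz
        simp [um, upx, upy] at this ⊢
        constructor <;> linarith
      · refine ⟨2, rfl, ?_⟩
        have := hint0 2 1 _ _ hz
        simp [um, upx, upy] at this ⊢
        constructor <;> linarith
      · refine ⟨3, rfl, ?_⟩
        have := hint0 3 1 _ _ hz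
        simp [um, upx, upy] at this ⊢
        constructor <;> linarith

theorem int_zero : (0 : Pt) ∈ IntLattice := ⟨0, 0, by simp; rfl⟩
theorem int_add {p q : Pt} (hp : p ∈ IntLattice) (hq : q ∈ IntLattice) : p + q ∈ IntLattice := by
  obtain ⟨a, b, rfl⟩ := hp
  obtain ⟨c, d, rfl⟩ := hq
  exact ⟨a + c, b + d, by simp⟩
theorem int_neg {p : Pt} (hp : p ∈ IntLattice) : -p ∈ IntLattice := by
  obtain ⟨a, b, rfl⟩ := hp
  exact ⟨-a, -b, by simp⟩
theorem int_sub {p q : Pt} (hp : p ∈ IntLattice) (hq : q ∈ IntLattice) : p - q ∈ IntLattice := by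
  rw [sub_eq_add_neg]; exact int_add hp (int_neg hq)

theorem int_range : IntLattice = Set.range (fun q : ℤ × ℤ => (((q.1 : ℝ), (q.2 : ℝ)) : Pt)) := by
  ext p
  constructor
  · rintro ⟨a, b, rfl⟩; exact ⟨(a, b), rfl⟩
  · rintro ⟨⟨a, b⟩, rfl⟩; exact ⟨a, b, rfl⟩

theorem int_countable : IntLattice.Countable := by
  rw [int_range]; exact Set.countable_range _

theorem int_finite (R : ℝ) : {l ∈ IntLattice | ‖l‖ ≤ R}.Finite := by
  apply (((Set.finite_Icc (-⌊R⌋) ⌊R⌋).prod (Set.finite_Icc (-⌊R⌋) ⌊R⌋)).image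
    (fun q : ℤ × ℤ => (((q.1 : ℝ), (q.2 : ℝ)) : Pt))).subset
  rintro _ ⟨⟨a, b, rfl⟩, hl⟩
  refine ⟨(a, b), ?_, rfl⟩
  rw [Prod.norm_mk, max_le_iff, Real.norm_eq_abs, Real.norm_eq_abs] at hl
  have h1 : |a| ≤ ⌊R⌋ := by rw [Int.le_floor]; push_cast; exact hl.1
  have h2 : |b| ≤ ⌊R⌋ := by rw [Int.le_floor]; push_cast; exact hl.2
  exact ⟨⟨(abs_le.1 h1).1, (abs_le.1 h1).2⟩, ⟨(abs_le.1 h2).1, (abs_le.1 h2).2⟩⟩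

def slab (g : Fin 5 → Pt →ₗ[ℝ] ℝ) (h : Fin 5 → ℝ) : Set Pt := {p | ∀ j, |g j p| ≤ h j}

theorem edge_count {g : Fin 5 → Pt →ₗ[ℝ] ℝ} {h : Fin 5 → ℝ} {k : ℕ}
    (hb : Bornology.IsBounded (slab g h))
    (hlow : ∀ p : Pt, (k : ℕ∞) ≤ {l ∈ IntLattice | p - l ∈ slab g h}.encard)
    (hupp : ∀ p : Pt, {l ∈ IntLattice | p - l ∈ interior (slab g h)}.encard ≤ (k : ℕ∞))
    (i : Fin 5) (hi : 0 < h i) (u : Pt) (hu : g i u = h i) (x : Pt)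
    (hgen : ∀ l ∈ IntLattice, ∀ j, j ≠ i → |g j (x - l)| ≠ h j) :
    {l ∈ IntLattice | x - l ∈ slab g h ∧ g i (x - l) = h i}.encard ≤
    {l ∈ IntLattice | x - l ∈ slab g h ∧ g i (x - l) = - h i}.encard := by
  have gc : ∀ j, Continuous (g j) := fun j => (g j).continuous_of_finiteDimensional
  obtain ⟨R, hR⟩ := hb.exists_norm_le
  set A1 : Set Pt := {l ∈ IntLattice | ‖l‖ ≤ R + ‖x‖ + ‖u‖} with hA1
  have hA1f : A1.Finite := int_finite _
  have hA1m : ∀ l ∈ IntLattice, ∀ ε : ℝ, |ε| ≤ 1 → x + ε • u - l ∈ slab g h → l ∈ A1 := by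
    intro l hl ε hε hm
    refine ⟨hl, ?_⟩
    have h1 := hR _ hm
    have h2 : l = x + ε • u - (x + ε • u - l) := by abel
    calc ‖l‖ = ‖x + ε • u - (x + ε • u - l)‖ := by rw [← h2]
      _ ≤ ‖x + ε • u‖ + ‖x + ε • u - l‖ := norm_sub_le _ _
      _ ≤ ‖x‖ + ‖ε • u‖ + R := by linarith [norm_add_le x (ε • u)]
      _ ≤ _ := by
        have : ‖ε • u‖ ≤ ‖u‖ := by
          rw [norm_smul, Real.norm_eq_abs]
          exact mul_le_of_le_one_left (norm_nonneg _) hε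
        linarith
  have hev : ∀ᶠ ε in nhds (0 : ℝ), ∀ l ∈ A1, ∀ j,
      (|g j (x - l)| < h j → |g j (x + ε • u - l)| < h j) ∧
      (h j < |g j (x - l)| → h j < |g j (x + ε • u - l)|) := by
    rw [Filter.eventually_all_finite hA1f]
    intro l _
    rw [Filter.eventually_all]
    intro j
    have hc : Filter.Tendsto (fun ε : ℝ => |g j (x + ε • u - l)|) (nhds 0)
        (nhds |g j (x - l)|) := by
      have hcont : Continuous fun ε : ℝ => |g j (x + ε • u - l)| := by
        have := gc j
        fun_prop
      have := hcont.tendsto 0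
      simpa using this
    apply Filter.Eventually.and
    · by_cases hlt : |g j (x - l)| < h j
      · filter_upwards [hc.eventually_lt_const hlt] with ε he _ using he
      · exact Filter.Eventually.of_forall fun ε he => absurd he hlt
    · by_cases hlt : h j < |g j (x - l)|
      · filter_upwards [hc.eventually_const_lt hlt] with ε he _ using he
      · exact Filter.Eventually.of_forall fun ε he => absurd he hlt
  obtain ⟨δ, hδ, hball⟩ := Metric.eventually_nhds_iff.1 hev
  set ε := min (δ/2) (1/2) with hε
  have e0 : 0 < ε := by positivity
  have e1 : ε ≤ 1/2 := min_le_right _ _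
  have e2 : ε < δ := lt_of_le_of_lt (min_le_left _ _) (by linarith)
  have hp := hball (y := ε) (by simpa [abs_of_pos e0] using e2)
  have hn := hball (y := -ε) (by simpa [abs_of_pos e0] using e2)
  set A : Set Pt := {l ∈ IntLattice | x - l ∈ slab g h} with hA
  have hAA1 : A ⊆ A1 := by
    intro l hl
    exact hA1m l hl.1 0 (by simp) (by simpa using hl.2)
  set E := {l ∈ IntLattice | x - l ∈ slab g h ∧ g i (x - l) = h i} with hE
  set E' := {l ∈ IntLattice | x - l ∈ slab g h ∧ g i (x - l) = - h i} with hE'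
  have hEA : E ⊆ A := fun l hl => ⟨hl.1, hl.2.1⟩
  have hEA' : E' ⊆ A := fun l hl => ⟨hl.1, hl.2.1⟩
  have c1 : (k : ℕ∞) ≤ (A \ E).encard := by
    refine (hlow (x + ε • u)).trans (Set.encard_le_encard ?_)
    rintro l ⟨hl, hm⟩
    have hl1 := hA1m l hl ε (by rw [abs_of_pos e0]; linarith) hm
    have hlA : x - l ∈ slab g h := by
      intro j
      by_contra hcon
      push Not at hcon
      exact absurd (hm j) (not_le.2 ((hp l hl1 j).2 hcon))
    refine ⟨⟨hl, hlA⟩, fun hlE => ?_⟩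
    have h1 := (abs_le.1 (hm i)).2
    have h2 : g i (x + ε • u - l) = g i (x - l) + ε * g i u := by
      simp; ring
    rw [h2, hlE.2.2, hu] at h1
    nlinarith
  have c2 : (A \ E').encard ≤ k := by
    refine le_trans (Set.encard_le_encard ?_) (hupp (x + (-ε) • u))
    rintro l ⟨⟨hl, hm⟩, hlE⟩
    refine ⟨hl, ?_⟩
    have hop : IsOpen {p : Pt | ∀ j, |g j p| < h j} := by
      rw [Set.ofPred_forall]
      exact isOpen_iInter_of_finite fun j => isOpen_lt ((gc j).abs) continuous_const
    have hsub : {p : Pt | ∀ j, |g j p| < h j} ⊆ slab g h := fun p hp j => (hp j).le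
    apply interior_maximal hsub hop
    intro j
    have key := (hn l (hAA1 ⟨hl, hm⟩) j).1
    by_cases hj : j = i
    · subst hj
      by_cases hlt : |g j (x - l)| < h j
      · exact key hlt
      · have heq : |g j (x - l)| = h j := le_antisymm (hm j) (not_lt.1 hlt)
        rcases (abs_eq hi.le).1 heq with h1 | h1
        · have h2 : g j (x + (-ε) • u - l) = g j (x - l) - ε * g j u := by
            simp; ring
          rw [h2, h1, hu, abs_lt]
          constructor <;> nlinarith
        · exact absurd ⟨hl, hm, h1⟩ hlE
    · exact key (lt_of_le_of_ne (hm j) (hgen l hl j hj))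
  have hAf : A.Finite := hA1f.subset hAA1
  have d1 := Set.encard_sdiff_add_encard_of_subset hEA
  have d2 := Set.encard_sdiff_add_encard_of_subset hEA'
  have fE := hAf.subset hEA
  have fE' := hAf.subset hEA'
  have fd : (A \ E').Finite := hAf.subset Set.sdiff_subset
  have h3 : (A \ E').encard + E.encard ≤ (A \ E').encard + E'.encard := by
    rw [d2, ← d1]
    exact add_le_add (c2.trans c1) le_rfl
  exact (ENat.add_le_add_iff_left (Set.encard_ne_top_iff.2 fd)).1 h3

theorem exists_good {S : Set ℝ} (hS : S.Countable) {a b : ℝ} (hab : a < b) :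
    ∃ t, t ∉ S ∧ a < t ∧ t < b := by
  obtain ⟨t, h1, h2⟩ := (hS.dense_compl ℝ).exists_between hab
  exact ⟨t, h1, h2.1, h2.2⟩

theorem line_group {w : Pt} (hw : w ≠ 0) : ∃ γ : ℝ, 0 ≤ γ ∧
    ∀ τ : ℝ, τ • w ∈ IntLattice ↔ ∃ n : ℤ, τ = n * γ := by
  let G : AddSubgroup ℝ :=
    { carrier := {τ | τ • w ∈ IntLattice}
      add_mem' := by
        intro a b ha hb
        show (a + b) • w ∈ IntLattice
        rw [add_smul]; exact int_add ha hb
      zero_mem' := by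
        show (0 : ℝ) • w ∈ IntLattice
        rw [zero_smul]; exact int_zero
      neg_mem' := by
        intro a ha
        show (-a) • w ∈ IntLattice
        rw [neg_smul]; exact int_neg ha }
  have aux : ∀ (c : ℝ), c ≠ 0 → ∀ τ : ℝ, τ ∈ Set.Ioo 0 (1/|c|) → ∀ n : ℤ, τ * c = n → False := by
    intro c hc τ hτ n hn
    have hc' : 0 < |c| := abs_pos.2 hc
    have h1 : |(n : ℝ)| < 1 := by
      rw [← hn, abs_mul, abs_of_pos hτ.1]
      exact (lt_div_iff₀ hc').1 hτ.2
    have h2 : 0 < |(n : ℝ)| := by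
      rw [← hn]; exact abs_pos.2 (mul_ne_zero hτ.1.ne' hc)
    have h3 : |n| < 1 := by exact_mod_cast h1
    have h4 : 0 < |n| := by exact_mod_cast h2
    omega
  have hiso : ∃ r : ℝ, 0 < r ∧ Disjoint (G : Set ℝ) (Set.Ioo 0 r) := by
    by_cases h1 : w.1 = 0
    · have h2 : w.2 ≠ 0 := fun h2 => hw (Prod.ext h1 h2)
      refine ⟨1/|w.2|, by positivity, Set.disjoint_left.2 ?_⟩
      rintro τ ⟨a, b, hab⟩ hτ
      exact aux _ h2 τ hτ b (congrArg Prod.snd hab)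
    · refine ⟨1/|w.1|, by positivity, Set.disjoint_left.2 ?_⟩
      rintro τ ⟨a, b, hab⟩ hτ
      exact aux _ h1 τ hτ a (congrArg Prod.fst hab)
  obtain ⟨r, hr, hd⟩ := hiso
  obtain ⟨b, hb⟩ := AddSubgroup.cyclic_of_isolated_zero hr hd
  have hG : ∀ τ : ℝ, τ • w ∈ IntLattice ↔ ∃ n : ℤ, τ = n * b := by
    intro τ
    have : τ • w ∈ IntLattice ↔ τ ∈ G := Iff.rfl
    rw [this, hb, AddSubgroup.mem_closure_singleton]
    simp [eq_comm]
  rcases le_total 0 b with h | h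
  · exact ⟨b, h, hG⟩
  · refine ⟨-b, by linarith, fun τ => (hG τ).trans ⟨?_, ?_⟩⟩
    · rintro ⟨n, rfl⟩; exact ⟨-n, by push_cast; ring⟩
    · rintro ⟨n, rfl⟩; exact ⟨-n, by push_cast; ring⟩

theorem count_contra {S : Set ℝ} (hS : S.Countable) {γ ρ : ℝ} (hγ : 0 ≤ γ)
    (hcount : ∀ t, t ∉ S → 0 < t → t < 1 →
      {τ : ℝ | (∃ n : ℤ, τ = n * γ) ∧ t - 1 ≤ τ ∧ τ ≤ t}.encard ≤
      {τ : ℝ | (∃ n : ℤ, τ = n * γ) ∧ t - 1 ≤ τ + ρ ∧ τ + ρ ≤ t}.encard) :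
    (∃ n : ℤ, ρ = n * γ) ∨ (∃ n : ℤ, (1:ℝ) = n * γ) := by
  by_contra hcon
  push Not at hcon
  obtain ⟨hρ, h1⟩ := hcon
  rcases hγ.eq_or_lt with h0 | hpos
  · subst h0
    have hne : ∀ t, t ∉ S → 0 < t → t < 1 → t - 1 ≤ ρ ∧ ρ ≤ t := by
      intro t ht ht0 ht1
      have hc := hcount t ht ht0 ht1
      have : {τ : ℝ | (∃ n : ℤ, τ = n * 0) ∧ t - 1 ≤ τ ∧ τ ≤ t}.encard ≠ 0 := by
        rw [Set.encard_ne_zero]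
        exact ⟨0, ⟨0, by simp⟩, by linarith, by linarith⟩
      have h2 : {τ : ℝ | (∃ n : ℤ, τ = n * 0) ∧ t - 1 ≤ τ + ρ ∧ τ + ρ ≤ t}.encard ≠ 0 := by
        intro h
        rw [h] at hc
        exact this (le_antisymm hc bot_le)
      rw [Set.encard_ne_zero] at h2
      obtain ⟨τ, ⟨n, hn⟩, h3, h4⟩ := h2
      rw [mul_zero] at hn
      subst hn
      constructor <;> linarith
    rcases lt_trichotomy ρ 0 with h | h | h
    · obtain ⟨t, ht, ht0, ht1⟩ := exists_good hS (a := max 0 (1 + ρ)) (b := 1)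
        (max_lt one_pos (by linarith))
      have := hne t ht (lt_of_le_of_lt (le_max_left _ _) ht0) ht1
      have := lt_of_le_of_lt (le_max_right _ _) ht0
      linarith
    · exact hρ 0 (by simp [h])
    · obtain ⟨t, ht, ht0, ht1⟩ := exists_good hS (a := 0) (b := min ρ 1)
        (lt_min h one_pos)
      have := hne t ht ht0 (lt_of_lt_of_le ht1 (min_le_right _ _))
      have := lt_of_lt_of_le ht1 (min_le_left _ _)
      linarith
  · set r := 1 / γ with hr
    set f := Int.fract r with hf
    set q := ⌊r⌋ with hq
    set σ := Int.fract (-ρ/γ) with hσ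
    set z := ⌊-ρ/γ⌋ with hz
    have rq : r = q + f := (Int.floor_add_fract r).symm
    have ρz : -ρ/γ = z + σ := (Int.floor_add_fract _).symm
    have rγ : (q + f) * γ = 1 := by rw [← rq, hr]; field_simp
    have ργ : (z + σ) * γ = -ρ := by rw [← ρz]; field_simp
    have f0 : 0 < f := by
      rcases (Int.fract_nonneg r).eq_or_lt with h | h
      · exfalso
        apply h1 q
        rw [← rγ, hf, ← h]; simp
      · exact h
    have f1 : f < 1 := Int.fract_lt_one _
    have s0 : 0 < σ := by
      rcases (Int.fract_nonneg (-ρ/γ)).eq_or_lt with h | h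
      · exfalso
        apply hρ (-z)
        have : σ = 0 := by rw [hσ, ← h]
        rw [this] at ργ
        push_cast
        linarith
      · exact h
    have s1 : σ < 1 := Int.fract_lt_one _
    have q0 : 0 ≤ q := by
      rw [hq]; exact Int.floor_nonneg.2 (by positivity)
    have q0' : (0 : ℝ) ≤ q := by exact_mod_cast q0
    obtain ⟨t, ht, ht0, ht1⟩ := exists_good hS (a := max 0 (f - σ) * γ) (b := min f (1 - σ) * γ)
      (mul_lt_mul_of_pos_right (by
        rw [max_lt_iff, lt_min_iff, lt_min_iff]
        exact ⟨⟨f0, by linarith⟩, by linarith, by linarith⟩) hpos)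
    obtain ⟨t', rfl⟩ : ∃ t', t = t' * γ := ⟨t / γ, by field_simp⟩
    have ht0 := lt_of_mul_lt_mul_right ht0 hγ
    have ht1 := lt_of_mul_lt_mul_right ht1 hγ
    rw [max_lt_iff] at ht0
    rw [lt_min_iff] at ht1
    have hc := hcount _ ht (mul_pos ht0.1 hpos) (by
      rw [← rγ]; exact mul_lt_mul_of_pos_right (by linarith) hpos)
    have hinj : Function.Injective (fun n : ℤ => (n : ℝ) * γ) := by
      intro a b hab
      have := mul_right_cancel₀ hpos.ne' hab
      exact_mod_cast this
    have L1 : ((fun n : ℤ => (n : ℝ) * γ) '' (Finset.Icc (-q) 0 : Finset ℤ)) ⊆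
        {τ : ℝ | (∃ n : ℤ, τ = n * γ) ∧ t' * γ - 1 ≤ τ ∧ τ ≤ t' * γ} := by
      rintro _ ⟨n, hn, rfl⟩
      rw [Finset.mem_coe, Finset.mem_Icc] at hn
      have n1 : (-q : ℝ) ≤ n := by exact_mod_cast hn.1
      have n2 : (n : ℝ) ≤ 0 := by exact_mod_cast hn.2
      refine ⟨⟨n, rfl⟩, ?_, ?_⟩
      · rw [← rγ]
        simp only
        rw [← sub_mul]
        exact mul_le_mul_of_nonneg_right (by linarith) hγ
      · exact mul_le_mul_of_nonneg_right (by linarith) hγ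
    have L2 : {τ : ℝ | (∃ n : ℤ, τ = n * γ) ∧ t' * γ - 1 ≤ τ + ρ ∧ τ + ρ ≤ t' * γ} ⊆
        ((fun n : ℤ => (n : ℝ) * γ) '' (Finset.Icc (z + 1 - q) z : Finset ℤ)) := by
      rintro _ ⟨⟨n, rfl⟩, h3, h4⟩
      refine ⟨n, ?_, rfl⟩
      rw [Finset.mem_coe, Finset.mem_Icc]
      have h5 : (t' - (q + f) + (z + σ)) * γ ≤ n * γ := by
        rw [add_mul, sub_mul, rγ, ργ]; linarith
      have h6 : n * γ ≤ (t' + (z + σ)) * γ := by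
        rw [add_mul, ργ]; linarith
      have h5 := le_of_mul_le_mul_right h5 hpos
      have h6 := le_of_mul_le_mul_right h6 hpos
      constructor
      · have : ((z - q : ℤ) : ℝ) < n := by push_cast; linarith
        have : z - q < n := by exact_mod_cast this
        omega
      · have : (n : ℝ) < (z + 1 : ℤ) := by push_cast; linarith
        have : n < z + 1 := by exact_mod_cast this
        omega
    have := (Set.encard_le_encard L1).trans (hc.trans (Set.encard_le_encard L2))
    rw [hinj.encard_image, hinj.encard_image, Set.encard_coe_eq_coe_finsetCard,
      Set.encard_coe_eq_coe_finsetCard, Int.card_Icc, Int.card_Icc] at this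
    have : (0 + 1 - -q).toNat ≤ (z + 1 - (z + 1 - q)).toNat := by exact_mod_cast this
    omega

theorem edge_lemma {g : Fin 5 → Pt →ₗ[ℝ] ℝ} {h : Fin 5 → ℝ} {k : ℕ}
    (hb : Bornology.IsBounded (slab g h))
    (hlow : ∀ p : Pt, (k : ℕ∞) ≤ {l ∈ IntLattice | p - l ∈ slab g h}.encard)
    (hupp : ∀ p : Pt, {l ∈ IntLattice | p - l ∈ interior (slab g h)}.encard ≤ (k : ℕ∞))
    (i : Fin 5) (hi : 0 < h i) (a w : Pt) (hw : ∀ j, j ≠ i → g j w ≠ 0) (hw0 : w ≠ 0)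
    (hedge : ∀ p, p ∈ slab g h ∧ g i p = h i ↔ ∃ s : ℝ, 0 ≤ s ∧ s ≤ 1 ∧ p = a + s • w) :
    (2 : ℝ) • a + w ∈ IntLattice ∨
      (w ∈ IntLattice ∧ ∃ l ∈ IntLattice, ∃ σ : ℝ, (2 : ℝ) • a + w = l + σ • w) := by
  obtain ⟨γ, hγ, hG⟩ := line_group hw0
  set U := (2 : ℝ) • a + w with hU
  have ha : g i a = h i := ((hedge a).2 ⟨0, le_rfl, zero_le_one, by simp⟩).2
  have hedge' : ∀ p, p ∈ slab g h ∧ g i p = - h i ↔ ∃ s : ℝ, 0 ≤ s ∧ s ≤ 1 ∧ -p = a + s • w := by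
    intro p
    rw [← hedge]
    simp only [slab, Set.mem_ofPred_eq, map_neg, abs_neg]
    constructor
    · rintro ⟨h1, h2⟩; exact ⟨h1, by linarith⟩
    · rintro ⟨h1, h2⟩; exact ⟨h1, by linarith⟩
  set S : Set ℝ := ⋃ l ∈ IntLattice, ⋃ j : Fin 5,
    ({(h j - g j a + g j l) / g j w, (-h j - g j a + g j l) / g j w} : Set ℝ) with hSdef
  have hS : S.Countable := by
    apply int_countable.biUnion
    intro l _
    apply Set.countable_iUnion
    intro j
    exact (Set.toFinite _).countable
  have hgen : ∀ t, t ∉ S → ∀ l ∈ IntLattice, ∀ j, j ≠ i → |g j (a + t • w - l)| ≠ h j := by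
    intro t ht l hl j hj heq
    apply ht
    have hwj := hw j hj
    simp only [hSdef, Set.mem_iUnion]
    refine ⟨l, hl, j, ?_⟩
    have e : g j (a + t • w - l) = g j a + t * g j w - g j l := by simp
    rw [e] at heq
    have hh : 0 ≤ h j := heq ▸ abs_nonneg _
    rcases (abs_eq hh).1 heq with h1 | h1
    · left; rw [eq_div_iff hwj]; linarith
    · right; rw [Set.mem_singleton_iff, eq_div_iff hwj]; linarith
  have hcnt := fun t (ht : t ∉ S) =>
    edge_count hb hlow hupp i hi a ha (a + t • w) (hgen t ht)
  have hE : ∀ t : ℝ, {l ∈ IntLattice | a + t • w - l ∈ slab g h ∧ g i (a + t • w - l) = h i} =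
      (fun τ : ℝ => τ • w) '' {τ : ℝ | (∃ n : ℤ, τ = n * γ) ∧ t - 1 ≤ τ ∧ τ ≤ t} := by
    intro t
    ext l
    constructor
    · rintro ⟨hl, hm⟩
      obtain ⟨s, s0, s1, hs⟩ := (hedge _).1 hm
      have el : l = (t - s) • w := by
        rw [sub_smul]
        have : l = a + t • w - (a + t • w - l) := by abel
        rw [this, hs]; abel
      refine ⟨t - s, ⟨(hG _).1 (el ▸ hl), by linarith, by linarith⟩, el.symm⟩
    · rintro ⟨τ, ⟨hτ, h1, h2⟩, rfl⟩
      refine ⟨(hG _).2 hτ, (hedge _).2 ⟨t - τ, by linarith, by linarith, ?_⟩⟩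
      simp only
      module
  have hE' : ∀ (t ρ : ℝ) (l0 : Pt), l0 ∈ IntLattice → l0 = U + ρ • w →
      {l ∈ IntLattice | a + t • w - l ∈ slab g h ∧ g i (a + t • w - l) = - h i} =
      (fun τ : ℝ => l0 + τ • w) '' {τ : ℝ | (∃ n : ℤ, τ = n * γ) ∧ t - 1 ≤ τ + ρ ∧ τ + ρ ≤ t} := by
    intro t ρ l0 hl0 el0
    ext l
    constructor
    · rintro ⟨hl, hm⟩
      obtain ⟨s, s0, s1, hs⟩ := (hedge' _).1 hm
      have el : l = l0 + (t + s - 1 - ρ) • w := by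
        have : l = a + t • w + -(a + t • w - l) := by abel
        rw [this, hs, el0, hU]; module
      refine ⟨t + s - 1 - ρ, ⟨(hG _).1 ?_, by linarith, by linarith⟩, el.symm⟩
      have : (t + s - 1 - ρ) • w = l - l0 := by rw [el]; abel
      rw [this]; exact int_sub hl hl0
    · rintro ⟨τ, ⟨hτ, h1, h2⟩, rfl⟩
      refine ⟨int_add hl0 ((hG _).2 hτ), (hedge' _).2 ⟨τ + ρ + 1 - t, by linarith, by linarith, ?_⟩⟩
      simp only [el0, hU]
      module
  obtain ⟨ρ, l0, hl0, el0⟩ : ∃ (ρ : ℝ) (l0 : Pt), l0 ∈ IntLattice ∧ l0 = U + ρ • w := by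
    obtain ⟨t, ht, ht0, ht1⟩ := exists_good hS (a := 0) (b := 1) one_pos
    have hc := hcnt t ht
    have h0 : {l ∈ IntLattice | a + t • w - l ∈ slab g h ∧
        g i (a + t • w - l) = h i}.encard ≠ 0 := by
      rw [Set.encard_ne_zero]
      refine ⟨0, int_zero, (hedge _).2 ⟨t, ht0.le, ht1.le, by simp⟩⟩
    have h1 : {l ∈ IntLattice | a + t • w - l ∈ slab g h ∧
        g i (a + t • w - l) = - h i}.encard ≠ 0 := by
      intro h'
      rw [h'] at hc
      exact h0 (le_antisymm hc bot_le)
    rw [Set.encard_ne_zero] at h1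
    obtain ⟨l, hl, hm⟩ := h1
    obtain ⟨s, s0, s1, hs⟩ := (hedge' _).1 hm
    refine ⟨t + s - 1, l, hl, ?_⟩
    have : l = a + t • w + -(a + t • w - l) := by abel
    rw [this, hs, hU]; module
  have hinj1 : Function.Injective (fun τ : ℝ => τ • w) := smul_left_injective ℝ hw0
  have hinj2 : Function.Injective (fun τ : ℝ => l0 + τ • w) :=
    fun x y hxy => hinj1 (add_left_cancel hxy)
  rcases count_contra hS hγ (ρ := ρ) (fun t ht _ _ => by
    have hc := hcnt t ht
    rwa [hE t, hE' t ρ l0 hl0 el0, hinj1.encard_image, hinj2.encard_image] at hc) with hr | hr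
  · left
    have : U = l0 - ρ • w := by rw [el0]; abel
    rw [this]
    exact int_sub hl0 ((hG _).2 hr)
  · right
    have hw1 := (hG 1).2 hr
    rw [one_smul] at hw1
    exact ⟨hw1, l0, hl0, -ρ, by rw [el0]; module⟩

theorem crs_map (f : Pt →ₗ[ℝ] Pt) (p q : Pt) : crs (f p) (f q) = LinearMap.det f * crs p q := by
  have h1 : ∀ p : Pt, f p = p.1 • f (1, 0) + p.2 • f (0, 1) := by
    intro p
    rw [← map_smul, ← map_smul, ← map_add]
    congr 1
    ext <;> simp
  have h2 : LinearMap.det f = crs (f (1, 0)) (f (0, 1)) := by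
    rw [← LinearMap.det_toMatrix (Module.Basis.finTwoProd ℝ), Matrix.det_fin_two]
    simp [LinearMap.toMatrix_apply, crs]
    ring
  rw [h1 p, h1 q, h2]
  simp [crs]
  ring

theorem tiling_preimage {P L : Set Pt} {k : ℕ} (h : IsKFoldLatticeTiling P L k)
    (B : Pt ≃ₗ[ℝ] Pt) (hL : L = B '' IntLattice) :
    IsKFoldLatticeTiling (B ⁻¹' P) IntLattice k := by
  have key : ∀ (Q : Set Pt) (p : Pt), {l ∈ L | B p - l ∈ Q} =
      B '' {l ∈ IntLattice | p - l ∈ B ⁻¹' Q} := by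
    intro Q p
    ext l
    constructor
    · rintro ⟨hl, hm⟩
      rw [hL] at hl
      obtain ⟨m, hm', rfl⟩ := hl
      exact ⟨m, ⟨hm', by simpa using hm⟩, rfl⟩
    · rintro ⟨m, ⟨hm, hm'⟩, rfl⟩
      refine ⟨hL ▸ ⟨m, hm, rfl⟩, ?_⟩
      simpa using hm'
  have hIn : interior (B ⁻¹' P) = B ⁻¹' (interior P) :=
    (B.toContinuousLinearEquiv.toHomeomorph.preimage_interior P).symm
  refine ⟨isLattice_int, fun p => ?_, fun p => ?_⟩
  · have := h.2.1 (B p)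
    rwa [key, B.injective.encard_image] at this
  · have := h.2.2 (B p)
    rwa [key, B.injective.encard_image, ← hIn] at this

open MeasureTheory in
theorem area_lemma {K : Set Pt} {k : ℕ} (hcv : Convex ℝ K) (hcl : IsClosed K)
    (h : IsKFoldLatticeTiling K IntLattice k) :
    volume K = k * volume (ZSpan.fundamentalDomain (Module.Basis.finTwoProd ℝ)) := by
  set b := Module.Basis.finTwoProd ℝ with hb
  set s := ZSpan.fundamentalDomain b with hs
  set G := (Submodule.span ℤ (Set.range b)).toAddSubgroup with hG
  have hGm : ∀ p : Pt, p ∈ G ↔ p ∈ IntLattice := by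
    intro p
    rw [hG, Submodule.mem_toAddSubgroup, Module.Basis.mem_span_iff_repr_mem]
    constructor
    · intro hp
      obtain ⟨m, hm⟩ := hp 0
      obtain ⟨n, hn⟩ := hp 1
      refine ⟨m, n, ?_⟩
      ext
      · simpa [hb] using hm.symm
      · simpa [hb] using hn.symm
    · rintro ⟨m, n, rfl⟩ i
      fin_cases i
      · exact ⟨m, by simp [hb]⟩
      · exact ⟨n, by simp [hb]⟩
  have hfd : IsAddFundamentalDomain G s (volume : Measure Pt) := ZSpan.isAddFundamentalDomain b _
  have hco : Countable G := by
    have : (G : Set Pt).Countable := int_countable.mono fun p hp => (hGm p).1 hp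
    exact this.to_subtype
  have hmK : MeasurableSet K := hcl.measurableSet
  have h1 := hfd.lintegral_eq_tsum' (K.indicator 1)
  rw [lintegral_indicator_one hmK] at h1
  rw [h1, ← lintegral_tsum]
  swap
  · intro g
    apply Measurable.aemeasurable
    apply (measurable_one.indicator hmK).comp
    exact measurable_const_vadd (-g)
  have hae : ∀ᵐ x ∂(volume.restrict s), ∑' g : G, K.indicator (1 : Pt → ENNReal) (-g +ᵥ x) = k := by
    apply ae_restrict_of_ae
    have hfr : ∀ g : G, ∀ᵐ x ∂(volume : Measure Pt), x - (g : Pt) ∉ frontier K := by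
      intro g
      have h0 : volume (frontier K) = 0 := hcv.addHaar_frontier _
      have := (measurePreserving_sub_right (volume : Measure Pt) (g : Pt)).quasiMeasurePreserving.ae
        (measure_eq_zero_iff_ae_notMem.1 h0)
      exact this
    filter_upwards [ae_all_iff.2 hfr] with x hx
    have e1 : {l ∈ IntLattice | x - l ∈ K} = {l ∈ IntLattice | x - l ∈ interior K} := by
      ext l
      constructor
      · rintro ⟨hl, hm⟩
        refine ⟨hl, ?_⟩
        by_contra hcon
        exact hx ⟨l, (hGm l).2 hl⟩ ⟨subset_closure hm, hcon⟩
      · rintro ⟨hl, hm⟩; exact ⟨hl, interior_subset hm⟩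
    have e2 : {l ∈ IntLattice | x - l ∈ K}.encard = k :=
      le_antisymm (e1 ▸ h.2.2 x) (h.2.1 x)
    have e3 : ∑' g : G, K.indicator (1 : Pt → ENNReal) (-g +ᵥ x) =
        ∑' g : G, ({g : G | x - (g : Pt) ∈ K}).indicator 1 g := by
      apply tsum_congr
      intro g
      have : (-g +ᵥ x : Pt) = x - (g : Pt) := by
        show -(g : Pt) + x = _
        abel
      rw [this]
      rfl
    rw [e3, ← tsum_subtype]
    simp only [Pi.one_apply]
    rw [ENNReal.tsum_set_one]
    have e4 : (Subtype.val '' {g : G | x - (g : Pt) ∈ K}) = {l ∈ IntLattice | x - l ∈ K} := by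
      ext l
      constructor
      · rintro ⟨g, hg, rfl⟩; exact ⟨(hGm _).1 g.2, hg⟩
      · rintro ⟨hl, hm⟩; exact ⟨⟨l, (hGm l).2 hl⟩, hm, rfl⟩
    rw [← Subtype.val_injective.encard_image, e4, e2]
    simp
  rw [lintegral_congr_ae hae]
  simp

open MeasureTheory in
theorem det_eq {P L : Set Pt} {k : ℕ} (hcv : Convex ℝ P) (hcl : IsClosed P)
    (h6 : IsKFoldLatticeTiling P IntLattice 6) (h : IsKFoldLatticeTiling P L k)
    (B : Pt ≃ₗ[ℝ] Pt) (hL : L = B '' IntLattice) :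
    |LinearMap.det (B.symm : Pt →ₗ[ℝ] Pt)| * 6 = k := by
  have a1 := area_lemma hcv hcl h6
  have a2 := area_lemma (hcv.linear_preimage (B : Pt →ₗ[ℝ] Pt))
    (hcl.preimage B.toContinuousLinearEquiv.continuous) (tiling_preimage h B hL)
  have a3 : volume (B ⁻¹' P) = ENNReal.ofReal |LinearMap.det (B.symm : Pt →ₗ[ℝ] Pt)| * volume P :=
    Measure.addHaar_preimage_linearEquiv volume B P
  set V := volume (ZSpan.fundamentalDomain (Module.Basis.finTwoProd ℝ)) with hV
  have v0 : V ≠ 0 := ZSpan.measure_fundamentalDomain_ne_zero _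
  have vt : V ≠ ⊤ := (ZSpan.fundamentalDomain_isBounded _).measure_lt_top.ne
  have a4 : volume (B ⁻¹' P) = k * V := a2
  rw [a3, a1, ← mul_assoc] at a4
  have a5 := (ENNReal.mul_left_inj v0 vt).1 a4
  have a6 := congrArg ENNReal.toReal a5
  simpa using a6

/-- Edge midpoints, doubled. -/
def uU : Fin 5 → Pt := ![(4,0), (4,1), (3,2), (1,2), (-2,1)]
/-- Edge start vertices. -/
def aA (α β : ℝ) : Fin 5 → Pt :=
  ![(2-α,-β), (2+α,β), (2-α,1-β), (1+α,1+β), (-α,1-β)]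

theorem uU_eq (α β : ℝ) (i : Fin 5) : (2 : ℝ) • aA α β i + gW α β i = uU i := by
  fin_cases i <;> ext <;> simp [aA, gW, uU] <;> ring

theorem edge_aux {A W N N' p : Pt} {n n' h : ℝ} (h1 : crs A N = n) (h2 : crs W N < 0)
    (h3 : crs (A + W) N' = n') (h4 : 0 < crs W N') (h5 : crs A W = h)
    (p1 : crs p W = h) (p2 : crs p N ≤ n) (p3 : crs p N' ≤ n') :
    ∃ s : ℝ, 0 ≤ s ∧ s ≤ 1 ∧ p = A + s • W := by
  have key : p = A + (crs (p - A) N / crs W N) • W := by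
    have hne := h2.ne
    have e : crs (p - A) W = 0 := by
      have : crs (p - A) W = crs p W - crs A W := by simp [crs]; ring
      rw [this, p1, h5, sub_self]
    have e1 : crs (p - A) N * W.1 = (p.1 - A.1) * crs W N := by
      have : crs (p - A) N * W.1 - (p.1 - A.1) * crs W N = crs (p - A) W * N.1 := by
        simp [crs]; ring
      rw [e] at this; linarith
    have e2 : crs (p - A) N * W.2 = (p.2 - A.2) * crs W N := by
      have : crs (p - A) N * W.2 - (p.2 - A.2) * crs W N = crs (p - A) W * N.2 := by
        simp [crs]; ring
      rw [e] at this; linarith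
    ext
    · simp only [Prod.fst_add, Prod.smul_fst, smul_eq_mul]
      rw [div_mul_eq_mul_div, e1]; field_simp; ring
    · simp only [Prod.snd_add, Prod.smul_snd, smul_eq_mul]
      rw [div_mul_eq_mul_div, e2]; field_simp; ring
  refine ⟨_, ?_, ?_, key⟩
  · apply div_nonneg_of_nonpos _ h2.le
    have : crs (p - A) N = crs p N - crs A N := by simp [crs]; ring
    rw [this, h1]; linarith
  · set s := crs (p - A) N / crs W N with hs
    have e : crs p N' = crs (A + W) N' + (s - 1) * crs W N' := by
      rw [key]; simp [crs]; ring
    rw [e, h3] at p3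
    by_contra hcon
    push Not at hcon
    have : 0 < (s - 1) * crs W N' := mul_pos (by linarith) h4
    linarith

theorem edge_iff {α β : ℝ} (h : Adm α β) (i : Fin 5) (p : Pt) :
    (p ∈ HP α β ∧ crs p (gW α β i) = hW α β i) ↔
    ∃ s : ℝ, 0 ≤ s ∧ s ≤ 1 ∧ p = aA α β i + s • gW α β i := by
  have hcv := convex_HP h
  have hz : ∀ j, zv α β j ∈ HP α β := fun j => hull_eq_HP h ▸ zv_mem α β j
  have q0 : ∀ i, aA α β i ∈ HP α β := by
    intro i
    fin_cases i
    · exact hz 9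
    · exact hz 0
    · exact hz 1
    · exact hz 2
    · exact hz 3
  have q1 : ∀ i, aA α β i + gW α β i ∈ HP α β := by
    intro i
    fin_cases i
    · convert hz 0 using 1; ext <;> simp [aA, gW, zv] <;> ring
    · convert hz 1 using 1; ext <;> simp [aA, gW, zv] <;> ring
    · convert hz 2 using 1; ext <;> simp [aA, gW, zv] <;> ring
    · convert hz 3 using 1; ext <;> simp [aA, gW, zv] <;> ring
    · convert hz 4 using 1; ext <;> simp [aA, gW, zv] <;> ring
  have hcr : crs (aA α β i) (gW α β i) = hW α β i := by
    fin_cases i <;> simp [crs, aA, gW, hW] <;> ring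
  constructor
  · rintro ⟨hp, he⟩
    obtain ⟨h1, h2, h3, h4, h5⟩ := h
    have k0 := abs_le.1 (hp 0)
    have k1 := abs_le.1 (hp 1)
    have k2 := abs_le.1 (hp 2)
    have k3 := abs_le.1 (hp 3)
    have k4 := abs_le.1 (hp 4)
    fin_cases i
    · refine edge_aux (N := -gW α β 4) (N' := gW α β 1) (n := hW α β 4) (n' := hW α β 1)
        ?_ ?_ ?_ ?_ hcr he ?_ k1.2
      · simp [crs, aA, gW, hW]; ring
      · simp [crs, gW]; nlinarith
      · simp [crs, aA, gW, hW]; ring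
      · simp [crs, gW]; nlinarith
      · have : crs p (-gW α β 4) = - crs p (gW α β 4) := by simp [crs]; ring
        rw [this]; linarith
    · refine edge_aux (N := gW α β 0) (N' := gW α β 2) (n := hW α β 0) (n' := hW α β 2)
        ?_ ?_ ?_ ?_ hcr he k0.2 k2.2
      · simp [crs, aA, gW, hW]; ring
      · simp [crs, gW]; nlinarith
      · simp [crs, aA, gW, hW]; ring
      · simp [crs, gW]; nlinarith
    · refine edge_aux (N := gW α β 1) (N' := gW α β 3) (n := hW α β 1) (n' := hW α β 3)
        ?_ ?_ ?_ ?_ hcr he k1.2 k3.2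
      · simp [crs, aA, gW, hW]; ring
      · simp [crs, gW]; nlinarith
      · simp [crs, aA, gW, hW]; ring
      · simp [crs, gW]; nlinarith
    · refine edge_aux (N := gW α β 2) (N' := gW α β 4) (n := hW α β 2) (n' := hW α β 4)
        ?_ ?_ ?_ ?_ hcr he k2.2 k4.2
      · simp [crs, aA, gW, hW]; ring
      · simp [crs, gW]; nlinarith
      · simp [crs, aA, gW, hW]; ring
      · simp [crs, gW]; nlinarith
    · refine edge_aux (N := gW α β 3) (N' := -gW α β 0) (n := hW α β 3) (n' := hW α β 0)
        ?_ ?_ ?_ ?_ hcr he k3.2 ?_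
      · simp [crs, aA, gW, hW]; ring
      · simp [crs, gW]; nlinarith
      · simp [crs, aA, gW, hW]; ring
      · simp [crs, gW]; nlinarith
      · have : crs p (-gW α β 0) = - crs p (gW α β 0) := by simp [crs]; ring
        rw [this]; linarith
  · rintro ⟨s, s0, s1, rfl⟩
    constructor
    · have := hcv (q0 i) (q1 i) (sub_nonneg.2 s1) s0 (by ring)
      convert this using 1
      module
    · rw [← hcr]; simp [crs]; ring

theorem gW_crs_ne {α β : ℝ} (h : Adm α β) (i j : Fin 5) (hij : j ≠ i) :
    crs (gW α β i) (gW α β j) ≠ 0 := by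
  obtain ⟨h1, h2, h3, h4, h5⟩ := h
  intro h0
  fin_cases i <;> fin_cases j <;> simp [crs, gW] at h0 hij <;> nlinarith

theorem crs_int {p q : Pt} (hp : p ∈ IntLattice) (hq : q ∈ IntLattice) :
    ∃ n : ℤ, crs p q = n := by
  obtain ⟨a, b, rfl⟩ := hp
  obtain ⟨c, d, rfl⟩ := hq
  exact ⟨a * d - b * c, by simp [crs]⟩

theorem hW_pos {α β : ℝ} (h : Adm α β) (i : Fin 5) : 0 < hW α β i := by
  obtain ⟨h1, h2, h3, h4, h5⟩ := h
  fin_cases i <;> simp [hW] <;> linarith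

theorem compact_HP {α β : ℝ} (h : Adm α β) : IsCompact (HP α β) := by
  rw [← hull_eq_HP h]
  exact (Set.finite_range (zv α β)).isCompact_convexHull ℝ

theorem edge_cond {α β : ℝ} (h : Adm α β) {L : Set Pt} {k : ℕ}
    (ht : IsKFoldLatticeTiling (HP α β) L k) (B : Pt ≃ₗ[ℝ] Pt) (hL : L = B '' IntLattice)
    (i : Fin 5) :
    B.symm (uU i) ∈ IntLattice ∨
      ∃ n : ℤ, LinearMap.det (B.symm : Pt →ₗ[ℝ] Pt) * (2 * hW α β i) = n := by
  have hK := tiling_preimage ht B hL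
  let g : Fin 5 → Pt →ₗ[ℝ] ℝ := fun j =>
    { toFun := fun p => crs (B p) (gW α β j)
      map_add' := by intro p q; simp [crs]; ring
      map_smul' := by intro c p; simp [crs]; ring }
  have hg : ∀ j p, g j p = crs (B p) (gW α β j) := fun _ _ => rfl
  have hs : B ⁻¹' (HP α β) = slab g (hW α β) := rfl
  rw [hs] at hK
  have hb : Bornology.IsBounded (slab g (hW α β)) := by
    rw [← hs]
    have : B ⁻¹' (HP α β) = B.symm '' (HP α β) := by
      ext p
      constructor
      · intro hp; exact ⟨B p, hp, by simp⟩
      · rintro ⟨q, hq, rfl⟩; simpa using hq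
    rw [this]
    exact ((compact_HP h).image B.symm.toContinuousLinearEquiv.continuous).isBounded
  have := edge_lemma hb hK.2.1 hK.2.2 i (hW_pos h i) (B.symm (aA α β i)) (B.symm (gW α β i))
    (fun j hj => by
      rw [hg]
      simpa using gW_crs_ne h i j hj)
    (by simpa using gW_ne h i)
    (fun p => by
      rw [← hs, hg]
      have := edge_iff h i (B p)
      rw [Set.mem_preimage, this]
      refine exists_congr fun s => and_congr_right fun _ => and_congr_right fun _ => ?_
      rw [← map_smul, ← map_add, LinearEquiv.eq_symm_apply])
  rw [← map_smul, ← map_add, uU_eq] at this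
  rcases this with h1 | ⟨h1, l, hl, σ, h2⟩
  · exact Or.inl h1
  · right
    obtain ⟨n, hn⟩ := crs_int hl h1
    refine ⟨n, ?_⟩
    have e1 : 2 * hW α β i = crs (uU i) (gW α β i) := by
      fin_cases i <;> simp [crs, uU, gW, hW] <;> ring
    rw [e1, ← crs_map]
    show crs (B.symm (uU i)) (B.symm (gW α β i)) = n
    rw [h2, ← hn]
    simp [crs]; ring

theorem int_bound {n a b : ℤ} (h1 : (a : ℝ) < n) (h2 : (n : ℝ) < b) : a < n ∧ n < b :=
  ⟨by exact_mod_cast h1, by exact_mod_cast h2⟩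

theorem arith {α β : ℝ} (h : Adm α β) (k : ℕ) (hk0 : 0 < k) (hk6 : k < 6) (T : Fin 5 → Prop)
    (H : ∀ i, T i ∨ ∃ n : ℤ, (k : ℝ) * (2 * hW α β i) = 6 * n)
    (hT : ∀ i j, T i → T j → ∃ n : ℤ, (k : ℝ) * crs (uU i) (uU j) = 6 * n) : False := by
  obtain ⟨h1, h2, h3, h4, h5⟩ := h
  have H0 := H 0
  have H1 := H 1
  have H2 := H 2
  have H3 := H 3
  have H4 := H 4
  have T01 := hT 0 1
  have T02 := hT 0 2
  have T03 := hT 0 3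
  have T12 := hT 1 2
  have T13 := hT 1 3
  have T23 := hT 2 3
  have T24 := hT 2 4
  have T34 := hT 3 4
  have T04 := hT 0 4
  simp [hW, crs, uU] at H0 H1 H2 H3 H4 T01 T02 T03 T12 T13 T23 T24 T34 T04
  have cast : ∀ (c : ℕ) (x : ℝ) (z : ℤ), x = z → (∃ n : ℤ, (c : ℝ) * x = 6 * n) →
      ∃ n : ℤ, (c : ℤ) * z = 6 * n := by
    rintro c x z rfl ⟨n, hn⟩
    exact ⟨n, by exact_mod_cast hn⟩
  have T01 := fun a b => cast k _ 4 (by norm_num) (T01 a b)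
  have T02 := fun a b => cast k _ 8 (by norm_num) (T02 a b)
  have T03 := fun a b => cast k _ 8 (by norm_num) (T03 a b)
  have T12 := fun a b => cast k _ 5 (by norm_num) (T12 a b)
  have T13 := fun a b => cast k _ 7 (by norm_num) (T13 a b)
  have T23 := fun a b => cast k _ 4 (by norm_num) (T23 a b)
  have T24 := fun a b => cast k _ 7 (by norm_num) (T24 a b)
  have T34 := fun a b => cast k _ 5 (by norm_num) (T34 a b)
  have T04 := fun a b => cast k _ 4 (by norm_num) (T04 a b)
  interval_cases k <;> push_cast at *
  · have t1 : T 1 := by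
      rcases H1 with t | ⟨n, hn⟩
      · exact t
      · have := int_bound (n := n) (a := 0) (b := 1) (by push_cast; linarith) (by push_cast; linarith)
        omega
    have t2 : T 2 := by
      rcases H2 with t | ⟨n, hn⟩
      · exact t
      · have := int_bound (n := n) (a := 0) (b := 1) (by push_cast; linarith) (by push_cast; linarith)
        omega
    obtain ⟨n, hn⟩ := T12 t1 t2
    omega
  · have t3 : T 3 := by
      rcases H3 with t | ⟨n, hn⟩
      · exact t
      · have := int_bound (n := n) (a := 0) (b := 1) (by push_cast; linarith) (by push_cast; linarith)
        omega
    have t2 : T 2 := by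
      rcases H2 with t | ⟨n, hn⟩
      · exact t
      · have := int_bound (n := n) (a := 0) (b := 1) (by push_cast; linarith) (by push_cast; linarith)
        omega
    obtain ⟨n, hn⟩ := T23 t2 t3
    omega
  · have t1 : T 1 := by
      rcases H1 with t | ⟨n, hn⟩
      · exact t
      · have := int_bound (n := n) (a := 1) (b := 2) (by push_cast; linarith) (by push_cast; linarith)
        omega
    have t4 : T 4 := by
      rcases H4 with t | ⟨n, hn⟩
      · exact t
      · have := int_bound (n := n) (a := 1) (b := 2) (by push_cast; linarith) (by push_cast; linarith)
        omega
    rcases H2 with t | ⟨n, hn⟩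
    · obtain ⟨n, hn⟩ := T12 t1 t
      omega
    rcases H3 with t | ⟨m, hm⟩
    · obtain ⟨n, hn⟩ := T34 t t4
      omega
    have b1 := int_bound (n := n) (a := 0) (b := 2) (by push_cast; linarith) (by push_cast; linarith)
    have b2 := int_bound (n := m) (a := 0) (b := 2) (by push_cast; linarith) (by push_cast; linarith)
    have e1 : n = 1 := by omega
    have e2 : m = 1 := by omega
    subst e1 e2
    push_cast at hn hm
    linarith
  · have t3 : T 3 := by
      rcases H3 with t | ⟨n, hn⟩
      · exact t
      · have := int_bound (n := n) (a := 1) (b := 2) (by push_cast; linarith) (by push_cast; linarith)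
        omega
    have t2 : T 2 := by
      rcases H2 with t | ⟨n, hn⟩
      · exact t
      · have := int_bound (n := n) (a := 1) (b := 2) (by push_cast; linarith) (by push_cast; linarith)
        omega
    obtain ⟨n, hn⟩ := T23 t2 t3
    omega
  · have s0 : T 0 ∨ β = 3/20 := by
      rcases H0 with t | ⟨n, hn⟩
      · exact Or.inl t
      · right
        have := int_bound (n := n) (a := 0) (b := 2) (by push_cast; linarith) (by push_cast; linarith)
        have e1 : n = 1 := by omega
        subst e1
        push_cast at hn
        linarith
    have s1 : T 1 ∨ 4 + 2*α - 8*β = 18/5 := by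
      rcases H1 with t | ⟨n, hn⟩
      · exact Or.inl t
      · right
        have := int_bound (n := n) (a := 2) (b := 4) (by push_cast; linarith) (by push_cast; linarith)
        have e1 : n = 3 := by omega
        subst e1
        push_cast at hn
        linarith
    have s2 : T 2 ∨ 6*β + 2 - 4*α = 12/5 := by
      rcases H2 with t | ⟨n, hn⟩
      · exact Or.inl t
      · right
        have := int_bound (n := n) (a := 1) (b := 3) (by push_cast; linarith) (by push_cast; linarith)
        have e1 : n = 2 := by omega
        subst e1
        push_cast at hn
        linarith
    have s3 : T 3 ∨ 2 + 4*α - 2*β = 12/5 := by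
      rcases H3 with t | ⟨n, hn⟩
      · exact Or.inl t
      · right
        have := int_bound (n := n) (a := 1) (b := 3) (by push_cast; linarith) (by push_cast; linarith)
        have e1 : n = 2 := by omega
        subst e1
        push_cast at hn
        linarith
    have s4 : T 4 ∨ 4 - 2*α - 4*β = 18/5 := by
      rcases H4 with t | ⟨n, hn⟩
      · exact Or.inl t
      · right
        have := int_bound (n := n) (a := 2) (b := 4) (by push_cast; linarith) (by push_cast; linarith)
        have e1 : n = 3 := by omega
        subst e1
        push_cast at hn
        linarith
    have no4 : ¬ ∃ n : ℤ, (5 : ℤ) * 4 = 6 * n := by rintro ⟨n, hn⟩; omega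
    have no5 : ¬ ∃ n : ℤ, (5 : ℤ) * 5 = 6 * n := by rintro ⟨n, hn⟩; omega
    have no7 : ¬ ∃ n : ℤ, (5 : ℤ) * 7 = 6 * n := by rintro ⟨n, hn⟩; omega
    have no8 : ¬ ∃ n : ℤ, (5 : ℤ) * 8 = 6 * n := by rintro ⟨n, hn⟩; omega
    rcases s0 with t0 | s0
    · have s1 := s1.resolve_left fun t => no4 (T01 t0 t)
      have s4 := s4.resolve_left fun t => no4 (T04 t0 t)
      have s2 := s2.resolve_left fun t => no8 (T02 t0 t)
      linarith
    rcases s2 with t2 | s2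
    · have s1 := s1.resolve_left fun t => no5 (T12 t t2)
      have s4 := s4.resolve_left fun t => no7 (T24 t2 t)
      have s3 := s3.resolve_left fun t => no4 (T23 t2 t)
      linarith
    rcases s3 with t3 | s3
    · have s1 := s1.resolve_left fun t => no7 (T13 t t3)
      have s4 := s4.resolve_left fun t => no5 (T34 t3 t)
      linarith
    linarith

theorem no_small {α β : ℝ} (h : Adm α β) (k : ℕ) (hk0 : 0 < k) (hk6 : k < 6) :
    ¬∃ L : Set Pt, IsKFoldLatticeTiling (HP α β) L k := by
  rintro ⟨L, ht⟩
  obtain ⟨B, hL⟩ := ht.1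
  have hd := det_eq (convex_HP h) (compact_HP h).isClosed (tiling_six h) ht B hL
  have hE := edge_cond h ht B hL
  set d := LinearMap.det (B.symm : Pt →ₗ[ℝ] Pt) with hdd
  have conv : ∀ x : ℝ, (∃ n : ℤ, d * x = n) → ∃ n : ℤ, (k : ℝ) * x = 6 * n := by
    rintro x ⟨n, hn⟩
    rcases abs_choice d with hc | hc
    · exact ⟨n, by rw [← hd, hc, ← hn]; ring⟩
    · exact ⟨-n, by rw [← hd, hc]; push_cast; rw [← hn]; ring⟩
  apply arith h k hk0 hk6 (fun i => B.symm (uU i) ∈ IntLattice)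
  · intro i
    exact (hE i).imp id (conv _)
  · intro i j hi hj
    apply conv
    obtain ⟨n, hn⟩ := crs_int hi hj
    exact ⟨n, by rw [← hn, hdd, ← crs_map]; rfl⟩

/-- every centrally symmetric convex decagon centered at the origin whose set of
edge midpoints is `D₁` satisfies: `P + ℤ²` is a six-fold lattice tiling, and `P` admits no
`k`-fold lattice tiling for any positive `k < 6`. -/
theorem decagonD1_sixfold_lattice_tile (P : Set Pt) (hP : IsConvexPolygon P 10)
    (hsym : P = -P) (hmid : edgeMidpoints P = D1) :
    IsKFoldLatticeTiling P IntLattice 6 ∧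
    ∀ k : ℕ, 0 < k → k < 6 → ¬∃ L : Set Pt, IsKFoldLatticeTiling P L k := by
  obtain ⟨α, β, h1, h2, h3, h4, h5, hPe⟩ := structure_thm hP hsym hmid
  have h : Adm α β := ⟨h1, h2, h3, h4, h5⟩
  rw [hPe, hull_eq_HP h]
  exact ⟨tiling_six h, fun k hk0 hk6 => no_small h k hk0 hk6⟩
end
end

section
/- Every centrally symmetric convex decagon P centered at the origin whose set of edge midpoints is D₂ satisfies: P + ℤ² is a six-fold lattice tiling of ℝ², and P admits no k-fold lattice tiling of ℝ² for any positive integer k < 6 (so τ*(P) = 6). -/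
open Set Pointwise

noncomputable section

/-- cross product -/
def cr (p q : Pt) : ℝ := p.1 * q.2 - p.2 * q.1

/-- the vertices -/
def V (s t : ℝ) : Fin 10 → Pt :=
  ![(s, -1 - t), (1 - s, -1 + t), (2 + s, -t), (2 - s, t), (1 + s, 1 - t),
    (-s, 1 + t), (-1 + s, 1 - t), (-2 - s, t), (-2 + s, -t), (-1 - s, -1 + t)]

/-- doubled midpoints, integer coordinates -/
def W : Fin 10 → ℤ × ℤ :=
  ![(1, -2), (3, -1), (4, 0), (3, 1), (1, 2), (-1, 2), (-3, 1), (-4, 0), (-3, -1), (-1, -2)]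

/-- the midpoints -/
def U (i : Fin 10) : Pt := (((W i).1 : ℝ) / 2, ((W i).2 : ℝ) / 2)

lemma U_mem_D2 (i : Fin 10) : U i ∈ D2 := by
  fin_cases i <;> simp [U, W, D2] <;> norm_num

lemma W_orient : ∀ i j : Fin 10, j ≠ i → j ≠ i + 1 →
    0 < ((W i).1 - (W j).1) * ((W (i+1)).2 - (W j).2)
      - ((W i).2 - (W j).2) * ((W (i+1)).1 - (W j).1) := by
  decide

lemma U_orient (i j : Fin 10) (h1 : j ≠ i) (h2 : j ≠ i + 1) :
    0 < cr (U i - U j) (U (i+1) - U j) := by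
  have h := W_orient i j h1 h2
  have h' : (0:ℝ) < ((W i).1 - (W j).1) * ((W (i+1)).2 - (W j).2)
      - ((W i).2 - (W j).2) * ((W (i+1)).1 - (W j).1) := by exact_mod_cast h
  simp only [cr, U, Prod.fst_sub, Prod.snd_sub]
  nlinarith

lemma W_inj : Function.Injective W := by decide

lemma U_inj : Function.Injective U := by
  intro i j h
  apply W_inj
  simp only [U, Prod.mk.injEq] at h
  have h1 : ((W i).1 : ℝ) = (W j).1 := by linarith [h.1]
  have h2 : ((W i).2 : ℝ) = (W j).2 := by linarith [h.2]
  ext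
  · exact_mod_cast h1
  · exact_mod_cast h2

lemma exists_par {h d : Pt} (hh : h ≠ 0) (hc : cr d h = 0) : ∃ τ : ℝ, d = τ • h := by
  by_cases h1 : h.1 = 0
  · have h2 : h.2 ≠ 0 := fun h2 => hh (Prod.ext h1 h2)
    refine ⟨d.2 / h.2, Prod.ext ?_ ?_⟩
    · simp only [cr, h1, mul_zero, sub_zero] at hc
      simp [h1, (mul_eq_zero.1 hc).resolve_right h2]
    · simp; field_simp
  · refine ⟨d.1 / h.1, Prod.ext ?_ ?_⟩
    · simp; field_simp
    · simp only [cr] at hc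
      simp; field_simp; linarith

/-- points of `P` on the line of an extreme segment are in the segment -/
lemma online {P : Set Pt} {u h : Pt} 
    (hE : IsExtreme ℝ P (segment ℝ (u - h) (u + h))) {τ : ℝ} (hz : u + τ • h ∈ P) :
    u + τ • h ∈ segment ℝ (u - h) (u + h) := by
  have hu : u ∈ segment ℝ (u - h) (u + h) := ⟨1/2, 1/2, by norm_num, by norm_num, by norm_num, by
    ext <;> simp <;> ring⟩
  have ha := hE.1 (left_mem_segment ℝ (u-h) (u+h))
  have hb := hE.1 (right_mem_segment ℝ (u-h) (u+h))
  rcases lt_trichotomy τ 0 with h0 | h0 | h0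
  · refine hE.left_mem_of_mem_openSegment hz hb hu ?_
    have : 0 < 1 - τ := by linarith
    refine ⟨1/(1-τ), -τ/(1-τ), by positivity, div_pos (by linarith) this, by field_simp; ring, ?_⟩
    ext <;> simp <;> field_simp <;> ring
  · simpa [h0] using hu
  · refine hE.left_mem_of_mem_openSegment hz ha hu ?_
    have : 0 < 1 + τ := by linarith
    refine ⟨1/(1+τ), τ/(1+τ), by positivity, by positivity, by field_simp, ?_⟩
    ext <;> simp <;> field_simp <;> ring

lemma online_le {P : Set Pt} {u h : Pt} (hh : h ≠ 0)
    (hE : IsExtreme ℝ P (segment ℝ (u - h) (u + h))) {τ : ℝ} (hz : u + τ • h ∈ P) :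
    |τ| ≤ 1 := by
  obtain ⟨x, y, hx, hy, hxy, e⟩ := online hE hz
  have e2 : (y - x - τ) • h = 0 := by
    have : x • (u - h) + y • (u + h) - (u + τ • h) = (x + y - 1) • u + (y - x - τ) • h := by
      module
    rw [hxy, e] at this
    simpa using this.symm
  have : y - x - τ = 0 := (smul_eq_zero.1 e2).resolve_right hh
  rw [abs_le]; constructor <;> linarith

lemma support {P : Set Pt} (hP : Convex ℝ P) {u h : Pt} (hh : h ≠ 0)
    (hE : IsExtreme ℝ P (segment ℝ (u - h) (u + h))) :
    (∀ x ∈ P, cr (x - u) h ≤ 0) ∨ (∀ x ∈ P, 0 ≤ cr (x - u) h) := by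
  by_contra! hcon
  obtain ⟨⟨x, hx, hx0⟩, y, hy, hy0⟩ := hcon
  set A := cr (x - u) h with hA
  set B := cr (y - u) h with hB
  have hAB : 0 < A - B := by linarith
  set z : Pt := (-B/(A-B)) • x + (A/(A-B)) • y with hz
  have hzo : z ∈ openSegment ℝ x y :=
    ⟨-B/(A-B), A/(A-B), div_pos (by linarith) hAB, div_pos hx0 hAB, by field_simp; ring, rfl⟩
  have hzP : z ∈ P := hP.segment_subset hx hy (openSegment_subset_segment _ _ _ hzo)
  have hzc : cr (z - u) h = 0 := by
    have : cr (z - u) h = (-B/(A-B)) * A + (A/(A-B)) * B := by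
      have h1 : -B/(A-B) = 1 - A/(A-B) := by field_simp; ring
      rw [hz, h1, hA, hB]
      simp only [cr, Prod.fst_sub, Prod.snd_sub, Prod.fst_add, Prod.snd_add, Prod.smul_fst, Prod.smul_snd, smul_eq_mul]
      ring
    rw [this]; field_simp; ring
  obtain ⟨τ, hτ⟩ := exists_par hh hzc
  have hzeq : z = u + τ • h := by rw [← hτ]; abel
  have hzs : z ∈ segment ℝ (u - h) (u + h) := by
    rw [hzeq] at hzP ⊢; exact online hE hzP
  obtain ⟨p, q, hp, hq, hpq, e⟩ := hE.left_mem_of_mem_openSegment hx hy hzs hzo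
  have : A = 0 := by
    have hp' : p = 1 - q := by linarith
    rw [hA, ← e, hp']
    simp only [cr, Prod.fst_sub, Prod.snd_sub, Prod.fst_add, Prod.snd_add, Prod.smul_fst, Prod.smul_snd, smul_eq_mul]
    ring
  linarith

lemma structureP {P : Set Pt} (hP : IsConvexPolygon P 10) (hmid : edgeMidpoints P = D2) :
    ∃ s t : ℝ, 0 < t + s ∧ 0 < t - s ∧ 4 * t + 2 * s < 1 ∧ 4 * t - 2 * s < 1 ∧
      P = convexHull ℝ (Set.range (V s t)) := by
  obtain ⟨hconv, -, -, hfin, hcard, hhull⟩ := hP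
  have key : ∀ i : Fin 10, ∃ h : Pt, h ≠ 0 ∧
      IsExtreme ℝ P (segment ℝ (U i - h) (U i + h)) ∧ ∀ x ∈ P, cr (x - U i) h ≤ 0 := by
    intro i
    have hu : U i ∈ edgeMidpoints P := hmid ▸ U_mem_D2 i
    obtain ⟨a, b, ⟨hab, hE⟩, hm⟩ := hu
    set h : Pt := (1/2 : ℝ) • (b - a) with hh
    have e1 : U i - h = a := by
      rw [hm, hh, midpoint_eq_smul_add]; ext <;> simp <;> ring
    have e2 : U i + h = b := by
      rw [hm, hh, midpoint_eq_smul_add]; ext <;> simp <;> ring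
    have h0 : h ≠ 0 := by
      intro h0; rw [h0] at e1 e2; exact hab (by rw [← e1, ← e2]; simp)
    have hE' : IsExtreme ℝ P (segment ℝ (U i - h) (U i + h)) := by rwa [e1, e2]
    rcases support hconv h0 hE' with h1 | h1
    · exact ⟨h, h0, hE', h1⟩
    · refine ⟨-h, neg_ne_zero.2 h0, ?_, ?_⟩
      · rw [segment_symm]; simpa [sub_eq_add_neg] using hE'
      · intro x hx
        have := h1 x hx
        simp only [cr, Prod.fst_neg, Prod.snd_neg] at this ⊢
        linarith
  choose h h0 hE hs using key
  have hline : ∀ (i : Fin 10) (τ : ℝ), |τ| ≤ 1 → U i + τ • h i ∈ P := by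
    intro i τ hτ
    rw [abs_le] at hτ
    apply (hE i).1
    refine ⟨(1-τ)/2, (1+τ)/2, by linarith, by linarith, by ring, ?_⟩
    module
  have hUP : ∀ i, U i ∈ P := fun i => by simpa using hline i 0 (by simp)
  have haP : ∀ i, U i - h i ∈ P := fun i => by
    simpa [sub_eq_add_neg] using hline i (-1) (by simp)
  have hbP : ∀ i, U i + h i ∈ P := fun i => by simpa using hline i 1 (by simp)
  have strict : ∀ i k, k ≠ i → cr (U k - U i) (h i) < 0 := by
    intro i k hk
    refine lt_of_le_of_ne (hs i _ (hUP k)) ?_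
    intro hz
    obtain ⟨τ, hτ⟩ := exists_par (h0 i) hz
    have q1 := hs i _ (haP k)
    have q2 := hs i _ (hbP k)
    have q3 : cr (h k) (h i) = 0 := by
      simp only [cr, Prod.fst_sub, Prod.snd_sub, Prod.fst_add, Prod.snd_add] at *
      linarith
    obtain ⟨ρ, hρ⟩ := exists_par (h0 i) q3
    have ρ0 : ρ ≠ 0 := by rintro rfl; exact h0 k (by simpa using hρ)
    have r1 : |τ + ρ| ≤ 1 := online_le (h0 i) (hE i) (by
      convert hbP k using 1; rw [add_smul, ← hτ, ← hρ]; abel)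
    have r2 : |τ - ρ| ≤ 1 := online_le (h0 i) (hE i) (by
      convert haP k using 1; rw [sub_smul, ← hτ, ← hρ]; abel)
    have hUi : U i = U k - τ • h i := by rw [← hτ]; abel
    have r3 : |(1 - τ)/ρ| ≤ 1 := online_le (h0 k) (hE k) (by
      convert hbP i using 1; rw [hρ, hUi, smul_smul, div_mul_cancel₀ _ ρ0]; module)
    have r4 : |(-1 - τ)/ρ| ≤ 1 := online_le (h0 k) (hE k) (by
      convert haP i using 1; rw [hρ, hUi, smul_smul, div_mul_cancel₀ _ ρ0]; module)
    rw [abs_div, div_le_one (abs_pos.2 ρ0)] at r3 r4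
    have τ0 : τ = 0 := by
      rw [abs_le] at r1 r2
      rcases abs_cases ρ with hr | hr <;> rcases abs_cases (1 - τ) with h3 | h3 <;>
        rcases abs_cases (-1 - τ) with h4 | h4 <;> linarith
    apply hk; apply U_inj
    rw [hUi, τ0]; simp
  have haext : ∀ i, U i - h i ∈ Set.extremePoints ℝ P := by
    intro i
    refine ⟨haP i, ?_⟩
    intro x hx y hy hxy
    have hxs := (hE i).left_mem_of_mem_openSegment hx hy (left_mem_segment _ _ _) hxy
    have hys := (hE i).right_mem_of_mem_openSegment hx hy (left_mem_segment _ _ _) hxy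
    obtain ⟨p, q, hp, hq, hpq, e⟩ := hxs
    obtain ⟨p', q', hp', hq', hpq', e'⟩ := hys
    obtain ⟨c, d, hc, hd, hcd, e3⟩ := hxy
    have hpe : p = 1 - q := by linarith
    have hpe' : p' = 1 - q' := by linarith
    have hce : c = 1 - d := by linarith
    have : (c * q + d * q') • ((2:ℝ) • h i) = 0 := by
      rw [← e, ← e'] at e3
      have h5 : c • (p • (U i - h i) + q • (U i + h i)) + d • (p' • (U i - h i) + q' • (U i + h i))
          - (U i - h i) = (c * q + d * q') • ((2:ℝ) • h i) := by
        rw [hpe, hpe', hce]; module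
      rw [← h5, e3, sub_self]
    have h6 : c * q + d * q' = 0 := (smul_eq_zero.1 this).resolve_right
      (smul_ne_zero two_ne_zero (h0 i))
    have h7 : q = 0 := by
      have := mul_nonneg hd.le hq'
      have := mul_nonneg hc.le hq
      have : c * q = 0 := by linarith
      exact (mul_eq_zero.1 this).resolve_left hc.ne'
    rw [← e, hpe, h7]; simp
  have hbext : ∀ i, U i + h i ∈ Set.extremePoints ℝ P := by
    intro i
    refine ⟨hbP i, ?_⟩
    intro x hx y hy hxy
    have hxs := (hE i).left_mem_of_mem_openSegment hx hy (right_mem_segment _ _ _) hxy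
    have hys := (hE i).right_mem_of_mem_openSegment hx hy (right_mem_segment _ _ _) hxy
    obtain ⟨q, p, hq, hp, hpq, e⟩ := hxs
    obtain ⟨q', p', hq', hp', hpq', e'⟩ := hys
    obtain ⟨c, d, hc, hd, hcd, e3⟩ := hxy
    have hpe : p = 1 - q := by linarith
    have hpe' : p' = 1 - q' := by linarith
    have hce : c = 1 - d := by linarith
    have : (c * q + d * q') • ((2:ℝ) • h i) = 0 := by
      rw [← e, ← e'] at e3
      have h5 : (U i + h i) - (c • (q • (U i - h i) + p • (U i + h i)) + d • (q' • (U i - h i) + p' • (U i + h i)))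
          = (c * q + d * q') • ((2:ℝ) • h i) := by
        rw [hpe, hpe', hce]; module
      rw [← h5, e3, sub_self]
    have h6 : c * q + d * q' = 0 := (smul_eq_zero.1 this).resolve_right
      (smul_ne_zero two_ne_zero (h0 i))
    have h7 : q = 0 := by
      have := mul_nonneg hd.le hq'
      have := mul_nonneg hc.le hq
      have : c * q = 0 := by linarith
      exact (mul_eq_zero.1 this).resolve_left hc.ne'
    rw [← e, hpe, h7]; simp
  set a : Fin 10 → Pt := fun i => U i - h i with ha
  have ainj : Function.Injective a := by
    intro i j hij
    by_contra hne
    have q1 := strict i j (Ne.symm hne)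
    have q2 := strict j i hne
    simp only [ha] at hij
    have e1 : U i = U j - h j + h i := by rw [← hij]; abel
    rw [e1] at q1 q2
    simp only [cr, Prod.fst_sub, Prod.snd_sub, Prod.fst_add, Prod.snd_add] at q1 q2
    linarith
  have hrange : Set.range a = Set.extremePoints ℝ P := by
    apply Set.eq_of_subset_of_ncard_le _ _ hfin
    · rintro _ ⟨i, rfl⟩; exact haext i
    · rw [hcard, ← Set.image_univ, Set.ncard_image_of_injective _ ainj, Set.ncard_univ]; simp
  have hnext : ∀ i, U i + h i = a (i+1) := by
    intro i
    have : U i + h i ∈ Set.range a := hrange ▸ hbext i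
    obtain ⟨j, hj⟩ := this
    by_cases hj1 : j = i + 1
    · rw [← hj1, hj]
    exfalso
    have hji : j ≠ i := by
      rintro rfl
      apply h0 j
      have : (2:ℝ) • h j = 0 := by
        have : (2:ℝ) • h j = (U j + h j) - (U j - h j) := by module
        rw [this, ← hj]; simp [ha]
      exact (smul_eq_zero.1 this).resolve_left two_ne_zero
    have hii : i + 1 ≠ i := (by decide : ∀ i : Fin 10, i + 1 ≠ i) i
    have o1 := U_orient i j hji hj1
    have o2 := strict i (i+1) hii
    have o3 := strict j (i+1) (Ne.symm hj1)
    have g1 := strict (i+1) i hii.symm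
    have g2 := hs (i+1) _ (hbP i)
    have g3 := strict (i+1) j hj1
    simp only [ha] at hj
    have hj1 := congrArg Prod.fst hj
    have hj2 := congrArg Prod.snd hj
    simp only [Prod.fst_sub, Prod.snd_sub, Prod.fst_add, Prod.snd_add] at hj1 hj2
    set X := U (i+1)
    set k := h (i+1)
    -- barycentric identity
    have hid : (-cr (X - U j) (h j)) * cr (U i - X) k + cr (U i - U j) (X - U j) * cr (U i + h i - X) k
        + (- cr (X - U i) (h i)) * cr (U j - X) k = 0 := by
      have w1 : (h j).1 = (U j).1 - (U i).1 - (h i).1 := by linarith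
      have w2 : (h j).2 = (U j).2 - (U i).2 - (h i).2 := by linarith
      simp only [cr, Prod.fst_sub, Prod.snd_sub, Prod.fst_add, Prod.snd_add, w1, w2]
      ring
    have t1 := mul_pos (neg_pos.2 o3) (neg_pos.2 g1)
    have t2 := mul_nonneg o1.le (neg_nonneg.2 g2)
    have t3 := mul_pos (neg_pos.2 o2) (neg_pos.2 g3)
    linarith
  have hrec : ∀ i, a (i+1) = (2:ℝ) • U i - a i := by
    intro i; rw [← hnext i]; simp only [ha]; module
  have hh : ∀ i, h i = U i - a i := by intro i; simp [ha]
  have u0 : U 0 = (1/2, -1) := by simp [U, W]; 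
  have u1 : U 1 = (3/2, -1/2) := by simp [U, W]
  have u2 : U 2 = (2, 0) := by simp [U, W]; norm_num
  have u3 : U 3 = (3/2, 1/2) := by simp [U, W]
  have u4 : U 4 = (1/2, 1) := by simp [U, W]
  have u5 : U 5 = (-1/2, 1) := by simp [U, W]
  have u6 : U 6 = (-3/2, 1/2) := by simp [U, W]
  have u7 : U 7 = (-2, 0) := by simp [U, W]; norm_num
  have u8 : U 8 = (-3/2, -1/2) := by simp [U, W]
  obtain ⟨s, y, hxy⟩ : ∃ s y, a 0 = (s, y) := ⟨_, _, rfl⟩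
  obtain ⟨t, rfl⟩ : ∃ t, y = -1 - t := ⟨-1 - y, by ring⟩
  have a1 : a 1 = (1 - s, -1 + t) := by
    have := hrec 0; rw [show (0:Fin 10) + 1 = 1 from rfl, hxy, u0] at this
    rw [this]; ext <;> simp <;> ring
  have a2 : a 2 = (2 + s, - t) := by
    have := hrec 1; rw [show (1:Fin 10) + 1 = 2 from rfl, a1, u1] at this
    rw [this]; ext <;> simp <;> ring
  have a3 : a 3 = (2 - s, t) := by
    have := hrec 2; rw [show (2:Fin 10) + 1 = 3 from rfl, a2, u2] at this
    rw [this]; ext <;> simp <;> ring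
  have a4 : a 4 = (1 + s, 1 - t) := by
    have := hrec 3; rw [show (3:Fin 10) + 1 = 4 from rfl, a3, u3] at this
    rw [this]; ext <;> simp <;> ring
  have a5 : a 5 = (-s, 1 + t) := by
    have := hrec 4; rw [show (4:Fin 10) + 1 = 5 from rfl, a4, u4] at this
    rw [this]; ext <;> simp <;> ring
  have a6 : a 6 = (-1 + s, 1 - t) := by
    have := hrec 5; rw [show (5:Fin 10) + 1 = 6 from rfl, a5, u5] at this
    rw [this]; ext <;> simp <;> ring
  have a7 : a 7 = (-2 - s, t) := by
    have := hrec 6; rw [show (6:Fin 10) + 1 = 7 from rfl, a6, u6] at this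
    rw [this]; ext <;> simp <;> ring
  have a8 : a 8 = (-2 + s, -t) := by
    have := hrec 7; rw [show (7:Fin 10) + 1 = 8 from rfl, a7, u7] at this
    rw [this]; ext <;> simp <;> ring
  have a9 : a 9 = (-1 - s, -1 + t) := by
    have := hrec 8; rw [show (8:Fin 10) + 1 = 9 from rfl, a8, u8] at this
    rw [this]; ext <;> simp <;> ring
  have haV : a = V s t := by
    funext i
    fin_cases i
    exacts [hxy, a1, a2, a3, a4, a5, a6, a7, a8, a9]
  have s0 := strict 0 1 (by decide)
  have s1 := strict 1 2 (by decide)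
  have s2 := strict 2 3 (by decide)
  have s3 := strict 3 4 (by decide)
  rw [hh, hxy, u0, u1] at s0
  rw [hh, a1, u1, u2] at s1
  rw [hh, a2, u2, u3] at s2
  rw [hh, a3, u3, u4] at s3
  simp only [cr, Prod.fst_sub, Prod.snd_sub] at s0 s1 s2 s3
  refine ⟨s, t, by linarith, by linarith, by linarith, by linarith, ?_⟩
  rw [← haV, hrange]; exact hhull


/-- edge vectors -/
def E (s t : ℝ) : Fin 10 → Pt :=
  ![(1 - 2*s, 2*t), (1 + 2*s, 1 - 2*t), (-2*s, 2*t), (-1 + 2*s, 1 - 2*t), (-1 - 2*s, 2*t),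
    (-(1 - 2*s), -(2*t)), (-(1 + 2*s), -(1 - 2*t)), (2*s, -(2*t)), (1 - 2*s, -(1 - 2*t)),
    (1 + 2*s, -(2*t))]

/-- support values -/
def C (s t : ℝ) : Fin 10 → ℝ :=
  ![1 - 2*s + t, 2 + s - 3*t, 4*t, 2 - s - 3*t, 1 + 2*s + t,
    1 - 2*s + t, 2 + s - 3*t, 4*t, 2 - s - 3*t, 1 + 2*s + t]

/-- H-representation of the decagon -/
def Q (s t : ℝ) : Set Pt := {p | ∀ i : Fin 10, cr p (E s t i) ≤ C s t i}

/-- parameter conditions -/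
def Good (s t : ℝ) : Prop := 0 < t + s ∧ 0 < t - s ∧ 4 * t + 2 * s < 1 ∧ 4 * t - 2 * s < 1

def r1 (s t y : ℝ) : ℝ := s + (y + 1 + t) * (1 - 2*s) / (2*t)
def r2 (s t y : ℝ) : ℝ := 1 - s + (y + 1 - t) * (1 + 2*s) / (1 - 2*t)
def r3 (s t y : ℝ) : ℝ := 2 + s + (y + t) * (-2*s) / (2*t)
def r4 (s t y : ℝ) : ℝ := 2 - s + (y - t) * (-1 + 2*s) / (1 - 2*t)
def r5 (s t y : ℝ) : ℝ := 1 + s + (y - 1 + t) * (-1 - 2*s) / (2*t)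

/-- the half-open decagon -/
def H (s t : ℝ) : Set Pt := {p |
  (-1 - t ≤ p.2 ∧ p.2 < -1 + t ∧ -r5 s t (-p.2) ≤ p.1 ∧ p.1 < r1 s t p.2) ∨
  (-1 + t ≤ p.2 ∧ p.2 < -t ∧ -r4 s t (-p.2) ≤ p.1 ∧ p.1 < r2 s t p.2) ∨
  (-t ≤ p.2 ∧ p.2 < t ∧ -r3 s t (-p.2) ≤ p.1 ∧ p.1 < r3 s t p.2) ∨
  (t ≤ p.2 ∧ p.2 < 1 - t ∧ -r2 s t (-p.2) ≤ p.1 ∧ p.1 < r4 s t p.2) ∨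
  (1 - t ≤ p.2 ∧ p.2 < 1 + t ∧ -r1 s t (-p.2) ≤ p.1 ∧ p.1 < r5 s t p.2)}

lemma Good.bounds {s t : ℝ} (h : Good s t) : 0 < t ∧ 0 < 1 - 4 * t ∧ 0 < 1 - 2 * s ∧ 0 < 1 + 2 * s := by
  obtain ⟨h1, h2, h3, h4⟩ := h
  refine ⟨by linarith, by linarith, by linarith, by linarith⟩

lemma V_mem_Q {s t : ℝ} (h : Good s t) (i : Fin 10) : V s t i ∈ Q s t := by
  obtain ⟨h1, h2, h3, h4⟩ := h
  intro j
  fin_cases i <;> fin_cases j <;> simp [V, E, C, cr] <;> linarith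

lemma Q_convex (s t : ℝ) : Convex ℝ (Q s t) := by
  intro x hx y hy a b ha hb hab i
  have h1 := mul_le_mul_of_nonneg_left (hx i) ha
  have h2 := mul_le_mul_of_nonneg_left (hy i) hb
  have h3 : a * C s t i + b * C s t i = C s t i := by rw [← add_mul, hab, one_mul]
  simp only [cr, Prod.fst_add, Prod.snd_add, Prod.smul_fst, Prod.smul_snd, smul_eq_mul] at *
  linarith

lemma edgept {K : Set Pt} (hK : Convex ℝ K) {a b c d y : ℝ} (hA : (a, b) ∈ K) (hB : (c, d) ∈ K)
    {D : ℝ} (hD : d - b = D) (hbd : 0 < D) (h1 : b ≤ y) (h2 : y ≤ d)  :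
    (a + (y - b) * (c - a) / D, y) ∈ K := by
  have hh : (a + (y - b) * (c - a) / D, y) = (1 - (y-b)/D) • ((a, b) : Pt) + ((y-b)/D) • ((c,d) : Pt) := by
    ext
    · simp; field_simp; ring
    · have : d = D + b := by linarith
      simp [this]; field_simp; ring
  rw [hh]
  have : (y - b)/D ≤ 1 := by rw [div_le_one hbd]; linarith
  exact hK hA hB (by linarith) (div_nonneg (by linarith) hbd.le) (by ring)

lemma row {K : Set Pt} (hK : Convex ℝ K) {a b x y : ℝ} (hA : (a, y) ∈ K) (hB : (b, y) ∈ K)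
    (h1 : a ≤ x) (h2 : x ≤ b) : (x, y) ∈ K := by
  rcases eq_or_lt_of_le (h1.trans h2) with h | h
  · have : x = a := by linarith
    rwa [this]
  · have hD : 0 < b - a := by linarith
    have hh : ((x, y) : Pt) = ((b - x)/(b-a)) • ((a, y) : Pt) + ((x-a)/(b-a)) • ((b,y) : Pt) := by
      ext
      · simp; field_simp; ring
      · simp; field_simp; ring
    rw [hh]
    exact hK hA hB (div_nonneg (by linarith) hD.le) (div_nonneg (by linarith) hD.le) (by field_simp; ring)

section hull
variable {s t : ℝ} 

lemma V_mem (i : Fin 10) : V s t i ∈ convexHull ℝ (Set.range (V s t)) :=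
  subset_convexHull _ _ ⟨i, rfl⟩

lemma R1 (h : Good s t) {y : ℝ} (h1 : -1 - t ≤ y) (h2 : y ≤ -1 + t) :
    (r1 s t y, y) ∈ convexHull ℝ (Set.range (V s t)) := by
  obtain ⟨b1, b2, b3, b4⟩ := h.bounds
  have := edgept (convex_convexHull ℝ (Set.range (V s t))) (V_mem 0) (V_mem 1) (D := 2*t) (by ring) (by linarith) h1 h2
  convert this using 2
  unfold r1; ring
lemma R2 (h : Good s t) {y : ℝ} (h1 : -1 + t ≤ y) (h2 : y ≤ -t) :
    (r2 s t y, y) ∈ convexHull ℝ (Set.range (V s t)) := by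
  obtain ⟨b1, b2, b3, b4⟩ := h.bounds
  have := edgept (convex_convexHull ℝ (Set.range (V s t))) (V_mem 1) (V_mem 2) (D := 1-2*t) (by ring) (by linarith) h1 h2
  convert this using 2
  unfold r2; ring
lemma R3 (h : Good s t) {y : ℝ} (h1 : -t ≤ y) (h2 : y ≤ t) :
    (r3 s t y, y) ∈ convexHull ℝ (Set.range (V s t)) := by
  obtain ⟨b1, b2, b3, b4⟩ := h.bounds
  have := edgept (convex_convexHull ℝ (Set.range (V s t))) (V_mem 2) (V_mem 3) (D := 2*t) (by ring) (by linarith) h1 h2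
  convert this using 2
  unfold r3; ring
lemma R4 (h : Good s t) {y : ℝ} (h1 : t ≤ y) (h2 : y ≤ 1 - t) :
    (r4 s t y, y) ∈ convexHull ℝ (Set.range (V s t)) := by
  obtain ⟨b1, b2, b3, b4⟩ := h.bounds
  have := edgept (convex_convexHull ℝ (Set.range (V s t))) (V_mem 3) (V_mem 4) (D := 1-2*t) (by ring) (by linarith) h1 h2
  convert this using 2
  unfold r4; ring
lemma R5 (h : Good s t) {y : ℝ} (h1 : 1 - t ≤ y) (h2 : y ≤ 1 + t) :
    (r5 s t y, y) ∈ convexHull ℝ (Set.range (V s t)) := by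
  obtain ⟨b1, b2, b3, b4⟩ := h.bounds
  have := edgept (convex_convexHull ℝ (Set.range (V s t))) (V_mem 4) (V_mem 5) (D := 2*t) (by ring) (by linarith) h1 h2
  convert this using 2
  unfold r5; ring

lemma hull_neg_s3 {x y : ℝ} (h : (x, -y) ∈ convexHull ℝ (Set.range (V s t))) :
    (-x, y) ∈ convexHull ℝ (Set.range (V s t)) := by
  have h2 : Set.range (V s t) = - Set.range (V s t) := by
    have key : ∀ i, -V s t i = V s t (i + 5) := by
      intro i
      fin_cases i <;> simp [V] <;> ring_nf <;> simp
    ext p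
    simp only [Set.mem_neg, Set.mem_range]
    constructor
    · rintro ⟨i, rfl⟩; exact ⟨i + 5, (key i).symm⟩
    · rintro ⟨i, hi⟩; exact ⟨i + 5, by rw [← key, hi, neg_neg]⟩
  rw [h2, convexHull_neg, Set.mem_neg]
  simpa using h

/-- closed rows -/
lemma rows (h : Good s t) {x y : ℝ} (hp :
  (-1 - t ≤ y ∧ y ≤ -1 + t ∧ -r5 s t (-y) ≤ x ∧ x ≤ r1 s t y) ∨
  (-1 + t ≤ y ∧ y ≤ -t ∧ -r4 s t (-y) ≤ x ∧ x ≤ r2 s t y) ∨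
  (-t ≤ y ∧ y ≤ t ∧ -r3 s t (-y) ≤ x ∧ x ≤ r3 s t y) ∨
  (t ≤ y ∧ y ≤ 1 - t ∧ -r2 s t (-y) ≤ x ∧ x ≤ r4 s t y) ∨
  (1 - t ≤ y ∧ y ≤ 1 + t ∧ -r1 s t (-y) ≤ x ∧ x ≤ r5 s t y)) :
  (x, y) ∈ convexHull ℝ (Set.range (V s t)) := by
  have hK := convex_convexHull ℝ (Set.range (V s t))
  rcases hp with ⟨a, b, c, d⟩ | ⟨a, b, c, d⟩ | ⟨a, b, c, d⟩ | ⟨a, b, c, d⟩ | ⟨a, b, c, d⟩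
  · exact row hK (hull_neg_s3 (R5 h (by linarith) (by linarith))) (R1 h a b) c d
  · exact row hK (hull_neg_s3 (R4 h (by linarith) (by linarith))) (R2 h a b) c d
  · exact row hK (hull_neg_s3 (R3 h (by linarith) (by linarith))) (R3 h a b) c d
  · exact row hK (hull_neg_s3 (R2 h (by linarith) (by linarith))) (R4 h a b) c d
  · exact row hK (hull_neg_s3 (R1 h (by linarith) (by linarith))) (R5 h a b) c d

lemma H_sub (h : Good s t) : H s t ⊆ convexHull ℝ (Set.range (V s t)) := by
  rintro ⟨x, y⟩ hp
  apply rows h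
  rcases hp with ⟨a, b, c, d⟩ | ⟨a, b, c, d⟩ | ⟨a, b, c, d⟩ | ⟨a, b, c, d⟩ | ⟨a, b, c, d⟩
  · exact Or.inl ⟨a, b.le, c, d.le⟩
  · exact Or.inr <| Or.inl ⟨a, b.le, c, d.le⟩
  · exact Or.inr <| Or.inr <| Or.inl ⟨a, b.le, c, d.le⟩
  · exact Or.inr <| Or.inr <| Or.inr <| Or.inl ⟨a, b.le, c, d.le⟩
  · exact Or.inr <| Or.inr <| Or.inr <| Or.inr ⟨a, b.le, c, d.le⟩

lemma lin_div {a b c D x : ℝ} (hD : 0 < D) : x ≤ a + b * c / D ↔ x * D ≤ a * D + b * c := by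
  rw [← sub_le_iff_le_add', le_div_iff₀ hD]; constructor <;> intro h <;> linarith

lemma lin_div_lt {a b c D x : ℝ} (hD : 0 < D) : x < a + b * c / D ↔ x * D < a * D + b * c := by
  rw [← sub_lt_iff_lt_add', lt_div_iff₀ hD]; constructor <;> intro h <;> linarith

lemma Q_eq (h : Good s t) : Q s t = convexHull ℝ (Set.range (V s t)) := by
  obtain ⟨b1, b2, b3, b4⟩ := h.bounds
  apply Set.Subset.antisymm
  · rintro ⟨x, y⟩ hp
    have p0 := hp 0
    have p1 := hp 1
    have p2 := hp 2
    have p3 := hp 3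
    have p4 := hp 4
    have p5 := hp 5
    have p6 := hp 6
    have p7 := hp 7
    have p8 := hp 8
    have p9 := hp 9
    simp [cr, E, C] at p0 p1 p2 p3 p4 p5 p6 p7 p8 p9
    apply rows h
    have d1 : 0 < 2 * t := by linarith
    have d2 : 0 < 1 - 2 * t := by linarith
    simp only [r1, r2, r3, r4, r5, neg_le, lin_div d1, lin_div d2]
    rcases le_total y (-1 + t) with y1 | y1
    · exact Or.inl ⟨by linarith, y1, by linarith, by linarith⟩
    rcases le_total y (-t) with y2 | y2
    · exact Or.inr <| Or.inl ⟨y1, y2, by linarith, by linarith⟩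
    rcases le_total y t with y3 | y3
    · exact Or.inr <| Or.inr <| Or.inl ⟨y2, y3, by linarith, by linarith⟩
    rcases le_total y (1 - t) with y4 | y4
    · exact Or.inr <| Or.inr <| Or.inr <| Or.inl ⟨y3, y4, by linarith, by linarith⟩
    · exact Or.inr <| Or.inr <| Or.inr <| Or.inr ⟨y4, by linarith, by linarith, by linarith⟩
  · exact convexHull_min (by rintro _ ⟨i, rfl⟩; exact V_mem_Q h i) (Q_convex s t)

lemma E_ne (h : Good s t) (i : Fin 10) : E s t i ≠ 0 := by
  obtain ⟨b1, b2, b3, b4⟩ := h.bounds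
  intro h0
  have := congrArg Prod.snd h0
  fin_cases i <;> simp [E] at this <;> linarith

lemma interior_strict (h : Good s t) {p : Pt} (hp : p ∈ interior (Q s t)) (i : Fin 10) :
    cr p (E s t i) < C s t i := by
  -- move slightly outward
  set n : Pt := ((E s t i).2, -(E s t i).1) with hn
  have hn0 : 0 < cr n (E s t i) := by
    have : cr n (E s t i) = (E s t i).2^2 + (E s t i).1^2 := by simp [cr, hn]; ring
    rw [this]
    rcases eq_or_ne (E s t i).1 0 with h1 | h1
    · have h2 : (E s t i).2 ≠ 0 := fun h2 => E_ne h i (Prod.ext h1 h2)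
      positivity
    · positivity
  have hcont : Filter.Tendsto (fun δ : ℝ => p + δ • n) (nhdsWithin 0 (Set.Ioi 0)) (nhds p) := by
    have : ContinuousAt (fun δ : ℝ => p + δ • n) 0 := by fun_prop
    have h2 := this.tendsto
    simp only [zero_smul, add_zero] at h2
    exact h2.mono_left nhdsWithin_le_nhds
  have hev := hcont.eventually (mem_interior_iff_mem_nhds.1 hp)
  obtain ⟨δ, hδ, hδ0⟩ := (hev.and self_mem_nhdsWithin).exists
  have h1 := hδ i
  have h2 : cr (p + δ • n) (E s t i) = cr p (E s t i) + δ * cr n (E s t i) := by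
    simp [cr]; ring
  have h3 : 0 < δ * cr n (E s t i) := mul_pos hδ0 hn0
  linarith

lemma int_sub_s3 (h : Good s t) : interior (Q s t) ⊆ H s t := by
  obtain ⟨b1, b2, b3, b4⟩ := h.bounds
  rintro ⟨x, y⟩ hp
  have hp := interior_strict h hp
  have p0 := hp 0
  have p1 := hp 1
  have p2 := hp 2
  have p3 := hp 3
  have p4 := hp 4
  have p5 := hp 5
  have p6 := hp 6
  have p7 := hp 7
  have p8 := hp 8
  have p9 := hp 9
  simp [cr, E, C] at p0 p1 p2 p3 p4 p5 p6 p7 p8 p9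
  have d1 : 0 < 2 * t := by linarith
  have d2 : 0 < 1 - 2 * t := by linarith
  simp only [H, Set.mem_ofPred_eq, r1, r2, r3, r4, r5, neg_le, lin_div d1, lin_div d2, lin_div_lt d1, lin_div_lt d2]
  rcases lt_or_ge y (-1 + t) with y1 | y1
  · exact Or.inl ⟨by linarith, y1, by linarith, by linarith⟩
  rcases lt_or_ge y (-t) with y2 | y2
  · exact Or.inr <| Or.inl ⟨y1, y2, by linarith, by linarith⟩
  rcases lt_or_ge y t with y3 | y3
  · exact Or.inr <| Or.inr <| Or.inl ⟨y2, y3, by linarith, by linarith⟩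
  rcases lt_or_ge y (1 - t) with y4 | y4
  · exact Or.inr <| Or.inr <| Or.inr <| Or.inl ⟨y3, y4, by linarith, by linarith⟩
  · exact Or.inr <| Or.inr <| Or.inr <| Or.inr ⟨y4, by linarith, by linarith, by linarith⟩

/-- embedding of the integer lattice -/
def φ (z : ℤ × ℤ) : Pt := ((z.1 : ℝ), (z.2 : ℝ))

lemma φ_inj : Function.Injective φ := by
  intro a b h
  simp only [φ, Prod.mk.injEq, Int.cast_inj] at h
  exact Prod.ext h.1 h.2

lemma IntLattice_eq : IntLattice = Set.range φ := by
  ext p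
  constructor
  · rintro ⟨a, b, rfl⟩; exact ⟨(a, b), rfl⟩
  · rintro ⟨z, rfl⟩; exact ⟨z.1, z.2, rfl⟩

lemma encard_lattice (S : Set Pt) (p : Pt) (T : Finset (ℤ × ℤ))
    (hT : ∀ z, z ∈ T ↔ p - φ z ∈ S) : {l ∈ IntLattice | p - l ∈ S}.encard = T.card := by
  have : {l ∈ IntLattice | p - l ∈ S} = φ '' (T : Set (ℤ × ℤ)) := by
    ext l
    rw [IntLattice_eq]
    constructor
    · rintro ⟨⟨z, rfl⟩, hz⟩; exact ⟨z, (hT z).2 hz, rfl⟩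
    · rintro ⟨z, hz, rfl⟩; exact ⟨⟨z, rfl⟩, (hT z).1 hz⟩
  rw [this, φ_inj.encard_image, Set.encard_coe_eq_coe_finsetCard]

lemma mem_Ioc_floor {α β x : ℝ} {n : ℤ} : n ∈ Finset.Ioc ⌊x - β⌋ ⌊x - α⌋ ↔ α ≤ x - n ∧ x - n < β := by
  rw [Finset.mem_Ioc, Int.floor_lt, Int.le_floor]
  constructor
  · rintro ⟨a, b⟩; constructor <;> linarith
  · rintro ⟨a, b⟩; constructor <;> linarith

lemma count6 (h : Good s t) (p : Pt) : {l ∈ IntLattice | p - l ∈ H s t}.encard = 6 := by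
  obtain ⟨b1, b2, b3, b4⟩ := h.bounds
  have d1 : 0 < 2 * t := by linarith
  have d2 : 0 < 1 - 2 * t := by linarith
  have d3 : 1 - t * 2 ≠ 0 := by linarith
  have d4 : 0 < 1 - t * 2 := by linarith
  obtain ⟨x, q⟩ := p
  set m0 := ⌊q + t⌋ with hm0
  obtain ⟨y, hy⟩ : ∃ y, y = q - m0 := ⟨_, rfl⟩
  have hy1 : -t ≤ y := by have := Int.floor_le (q + t); linarith
  have hy2 : y < 1 - t := by have := Int.lt_floor_add_one (q + t); linarith
  have hq : q = y + m0 := by linarith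
  rcases lt_or_ge y t with hyt | hyt
  · obtain ⟨A, hA⟩ : ∃ A, A = r1 s t (y - 1) := ⟨_, rfl⟩
    obtain ⟨B, hB⟩ : ∃ B, B = r3 s t y := ⟨_, rfl⟩
    obtain ⟨D, hD⟩ : ∃ D, D = r5 s t (y + 1) := ⟨_, rfl⟩
    have hA' : -r1 s t (-(y + 1)) = A - 1 := by rw [hA]; unfold r1; field_simp; ring
    have hB' : -r3 s t (-y) = B - 4 := by rw [hB]; unfold r3; field_simp; ring
    have hD' : -r5 s t (-(y - 1)) = D - 1 := by rw [hD]; unfold r5; field_simp; ring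
    have hAD : D - 1 ≤ A := by
      rw [hA, r1, lin_div d1, hD, r5]; field_simp; nlinarith
    have hDA : A - 1 ≤ D := by
      rw [hD, r5, lin_div d1, hA, r1]; field_simp; nlinarith
    rw [encard_lattice _ _ ((Finset.Ioc ⌊x - A⌋ ⌊x - (D - 1)⌋) ×ˢ {m0 + 1} ∪
      ((Finset.Ioc ⌊x - B⌋ ⌊x - (B - 4)⌋) ×ˢ {m0} ∪
       (Finset.Ioc ⌊x - D⌋ ⌊x - (A - 1)⌋) ×ˢ {m0 - 1}))]
    · rw [Finset.card_union_of_disjoint, Finset.card_union_of_disjoint]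
      · simp only [Finset.card_product, Int.card_Ioc, Finset.card_singleton, mul_one]
        have f1 : ⌊x - (D - 1)⌋ = ⌊x - D⌋ + 1 := by
          rw [← Int.floor_add_one]; congr 1; ring
        have f2 : ⌊x - (A - 1)⌋ = ⌊x - A⌋ + 1 := by
          rw [← Int.floor_add_one]; congr 1; ring
        have f3 : ⌊x - (B - 4)⌋ = ⌊x - B⌋ + 4 := by
          rw [← Int.floor_add_ofNat]; congr 1; ring
        have f4 : ⌊x - A⌋ ≤ ⌊x - (D - 1)⌋ := Int.floor_le_floor (by linarith)
        have f5 : ⌊x - D⌋ ≤ ⌊x - (A - 1)⌋ := Int.floor_le_floor (by linarith)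
        rw [f3]
        norm_cast
        omega
      · rw [Finset.disjoint_left]; rintro ⟨a, b⟩ h1 h2
        simp only [Finset.mem_product, Finset.mem_singleton] at h1 h2; omega
      · rw [Finset.disjoint_left]; rintro ⟨a, b⟩ h1 h2
        simp only [Finset.mem_union, Finset.mem_product, Finset.mem_singleton] at h1 h2; omega
    · rintro ⟨n, m⟩
      simp only [Finset.mem_union, Finset.mem_product, Finset.mem_singleton, mem_Ioc_floor, φ]
      constructor
      · rintro (⟨⟨a, b⟩, rfl⟩ | ⟨⟨a, b⟩, rfl⟩ | ⟨⟨a, b⟩, rfl⟩)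
        · have e : ((x, q) - ((n : ℝ), ((m0 + 1 : ℤ) : ℝ)) : Pt) = (x - n, y - 1) := by
            ext <;> simp [hq]; ring
          rw [e]
          exact Or.inl ⟨by simp; linarith, by simp; linarith, by simpa only [hD'] using a, by simpa only [← hA] using b⟩
        · have e : ((x, q) - ((n : ℝ), (m0 : ℝ)) : Pt) = (x - n, y) := by
            ext <;> simp [hq]
          rw [e]
          exact Or.inr <| Or.inr <| Or.inl ⟨by simp; linarith, by simp; linarith, by simpa only [hB'] using a, by simpa only [← hB] using b⟩
        · have e : ((x, q) - ((n : ℝ), ((m0 - 1 : ℤ) : ℝ)) : Pt) = (x - n, y + 1) := by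
            ext <;> simp [hq]; ring
          rw [e]
          exact Or.inr <| Or.inr <| Or.inr <| Or.inr ⟨by simp; linarith, by simp; linarith, by simpa only [hA'] using a, by simpa only [← hD] using b⟩
      · intro hH
        obtain ⟨d, rfl⟩ : ∃ d, m = m0 - d := ⟨m0 - m, by ring⟩
        have e : ((x, q) - ((n : ℝ), ((m0 - d : ℤ) : ℝ)) : Pt) = (x - n, y + d) := by
          ext <;> simp [hq]; ring
        rw [e] at hH
        simp only [H, Set.mem_ofPred_eq] at hH
        have l1 : -1 - t ≤ y + d ∧ y + d < 1 + t := by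
          rcases hH with ⟨a, b, -⟩ | ⟨a, b, -⟩ | ⟨a, b, -⟩ | ⟨a, b, -⟩ | ⟨a, b, -⟩ <;> constructor <;> linarith
        have l2 : -2 < d := by have : (-2 : ℝ) < d := by linarith
                               exact_mod_cast this
        have l3 : d < 2 := by have : (d : ℝ) < 2 := by linarith
                              exact_mod_cast this
        have l4 : d = -1 ∨ d = 0 ∨ d = 1 := by omega
        rcases l4 with rfl | rfl | rfl
        · have e1 : y + ((-1 : ℤ) : ℝ) = y - 1 := by push_cast; ring
          rw [e1, hD', ← hA] at hH
          rcases hH with ⟨a, b, c⟩ | ⟨a, b, -⟩ | ⟨a, b, -⟩ | ⟨a, b, -⟩ | ⟨a, b, -⟩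
          · exact Or.inl ⟨c, by ring⟩
          all_goals (exfalso; linarith)
        · have e1 : y + ((0 : ℤ) : ℝ) = y := by push_cast; ring
          rw [e1, hB', ← hB] at hH
          rcases hH with ⟨a, b, -⟩ | ⟨a, b, -⟩ | ⟨a, b, c⟩ | ⟨a, b, -⟩ | ⟨a, b, -⟩
          on_goal 3 => exact Or.inr <| Or.inl ⟨c, by ring⟩
          all_goals (exfalso; linarith)
        · have e1 : y + ((1 : ℤ) : ℝ) = y + 1 := by push_cast; ring
          rw [e1, hA', ← hD] at hH
          rcases hH with ⟨a, b, -⟩ | ⟨a, b, -⟩ | ⟨a, b, -⟩ | ⟨a, b, -⟩ | ⟨a, b, c⟩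
          on_goal 5 => exact Or.inr <| Or.inr ⟨c, by ring⟩
          all_goals (exfalso; linarith)
  · obtain ⟨A, hA⟩ : ∃ A, A = r2 s t (y - 1) := ⟨_, rfl⟩
    obtain ⟨B, hB⟩ : ∃ B, B = r4 s t y := ⟨_, rfl⟩
    have hA' : -r2 s t (-y) = A - 3 := by rw [hA]; unfold r2; field_simp; ring
    have hB' : -r4 s t (-(y-1)) = B - 3 := by rw [hB]; unfold r4; field_simp; ring
    have hAD : B - 3 ≤ A := by
      rw [hA, r2, lin_div d2, hB, r4]; field_simp; nlinarith
    have hDA : A - 3 ≤ B := by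
      rw [hB, r4, lin_div d2, hA, r2]; field_simp; nlinarith
    rw [encard_lattice _ _ ((Finset.Ioc ⌊x - A⌋ ⌊x - (B - 3)⌋) ×ˢ {m0 + 1} ∪
      (Finset.Ioc ⌊x - B⌋ ⌊x - (A - 3)⌋) ×ˢ {m0})]
    · rw [Finset.card_union_of_disjoint]
      · simp only [Finset.card_product, Int.card_Ioc, Finset.card_singleton, mul_one]
        have f1 : ⌊x - (B - 3)⌋ = ⌊x - B⌋ + 3 := by
          rw [← Int.floor_add_ofNat]; congr 1; ring
        have f2 : ⌊x - (A - 3)⌋ = ⌊x - A⌋ + 3 := by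
          rw [← Int.floor_add_ofNat]; congr 1; ring
        have f4 : ⌊x - A⌋ ≤ ⌊x - (B - 3)⌋ := Int.floor_le_floor (by linarith)
        have f5 : ⌊x - B⌋ ≤ ⌊x - (A - 3)⌋ := Int.floor_le_floor (by linarith)
        norm_cast
        omega
      · rw [Finset.disjoint_left]; rintro ⟨a, b⟩ h1 h2
        simp only [Finset.mem_product, Finset.mem_singleton] at h1 h2; omega
    · rintro ⟨n, m⟩
      simp only [Finset.mem_union, Finset.mem_product, Finset.mem_singleton, mem_Ioc_floor, φ]
      constructor
      · rintro (⟨⟨a, b⟩, rfl⟩ | ⟨⟨a, b⟩, rfl⟩)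
        · have e : ((x, q) - ((n : ℝ), ((m0 + 1 : ℤ) : ℝ)) : Pt) = (x - n, y - 1) := by
            ext <;> simp [hq]; ring
          rw [e]
          exact Or.inr <| Or.inl ⟨by simp; linarith, by simp; linarith, by simpa only [hB'] using a, by simpa only [← hA] using b⟩
        · have e : ((x, q) - ((n : ℝ), (m0 : ℝ)) : Pt) = (x - n, y) := by
            ext <;> simp [hq]
          rw [e]
          exact Or.inr <| Or.inr <| Or.inr <| Or.inl ⟨by simp; linarith, by simp; linarith, by simpa only [hA'] using a, by simpa only [← hB] using b⟩
      · intro hH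
        obtain ⟨d, rfl⟩ : ∃ d, m = m0 - d := ⟨m0 - m, by ring⟩
        have e : ((x, q) - ((n : ℝ), ((m0 - d : ℤ) : ℝ)) : Pt) = (x - n, y + d) := by
          ext <;> simp [hq]; ring
        rw [e] at hH
        simp only [H, Set.mem_ofPred_eq] at hH
        have l1 : -1 - t ≤ y + d ∧ y + d < 1 + t := by
          rcases hH with ⟨a, b, -⟩ | ⟨a, b, -⟩ | ⟨a, b, -⟩ | ⟨a, b, -⟩ | ⟨a, b, -⟩ <;> constructor <;> linarith
        have l2 : -2 < d := by have : (-2 : ℝ) < d := by linarith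
                               exact_mod_cast this
        have l3 : d < 1 := by have : (d : ℝ) < 1 := by linarith
                              exact_mod_cast this
        have l4 : d = -1 ∨ d = 0 := by omega
        rcases l4 with rfl | rfl
        · have e1 : y + ((-1 : ℤ) : ℝ) = y - 1 := by push_cast; ring
          rw [e1, hB', ← hA] at hH
          rcases hH with ⟨a, b, -⟩ | ⟨a, b, c⟩ | ⟨a, b, -⟩ | ⟨a, b, -⟩ | ⟨a, b, -⟩
          on_goal 2 => exact Or.inl ⟨c, by ring⟩
          all_goals (exfalso; linarith)
        · have e1 : y + ((0 : ℤ) : ℝ) = y := by push_cast; ring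
          rw [e1, hA', ← hB] at hH
          rcases hH with ⟨a, b, -⟩ | ⟨a, b, -⟩ | ⟨a, b, -⟩ | ⟨a, b, c⟩ | ⟨a, b, -⟩
          on_goal 4 => exact Or.inr ⟨c, by ring⟩
          all_goals (exfalso; linarith)

lemma six_tiling (h : Good s t) : IsKFoldLatticeTiling (Q s t) IntLattice 6 := by
  refine ⟨⟨LinearEquiv.refl ℝ Pt, (Set.image_id' _).symm⟩, ?_, ?_⟩
  · intro p
    have : ((6:ℕ) : ℕ∞) = {l ∈ IntLattice | p - l ∈ H s t}.encard := by rw [count6 h]; rfl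
    rw [this]
    apply Set.encard_le_encard
    rintro l ⟨h1, h2⟩
    refine ⟨h1, ?_⟩
    rw [Q_eq h]; exact H_sub h h2
  · intro p
    have : ((6:ℕ) : ℕ∞) = {l ∈ IntLattice | p - l ∈ H s t}.encard := by rw [count6 h]; rfl
    rw [this]
    apply Set.encard_le_encard
    rintro l ⟨h1, h2⟩
    exact ⟨h1, int_sub_s3 h h2⟩
end hull


section lower
open Filter Topology

/-- lexicographic negativity -/
def LexNeg (A E N : ℝ) : Prop := A < 0 ∨ (A = 0 ∧ (E < 0 ∨ (E = 0 ∧ N < 0)))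

lemma scal {A E N : ℝ} (h : LexNeg A E N) :
    ∀ᶠ δ in 𝓝[>] (0:ℝ), A + δ * E + δ^2 * N < 0 := by
  rcases h with h | ⟨rfl, h | ⟨rfl, h⟩⟩
  · have hc : ContinuousAt (fun δ : ℝ => A + δ * E + δ^2 * N) 0 := by fun_prop
    have := hc.tendsto
    simp only [zero_mul, add_zero, ne_eq, OfNat.ofNat_ne_zero, not_false_eq_true, zero_pow] at this
    exact (this.mono_left nhdsWithin_le_nhds).eventually (gt_mem_nhds h)
  · have hc : ContinuousAt (fun δ : ℝ => E + δ * N) 0 := by fun_prop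
    have := hc.tendsto
    simp only [zero_mul, add_zero] at this
    filter_upwards [(this.mono_left nhdsWithin_le_nhds).eventually (gt_mem_nhds h),
      self_mem_nhdsWithin] with δ h1 h2
    have := mul_neg_of_pos_of_neg (Set.mem_Ioi.1 h2) h1
    nlinarith
  · filter_upwards [self_mem_nhdsWithin] with δ h2
    have := mul_neg_of_pos_of_neg (pow_pos (Set.mem_Ioi.1 h2) 2) h
    linarith

lemma lex_total {A E N : ℝ} (h : E ≠ 0 ∨ N ≠ 0) (hn : ¬ LexNeg A E N) : LexNeg (-A) (-E) (-N) := by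
  unfold LexNeg at *
  rcases lt_trichotomy A 0 with h1 | h1 | h1
  · exact absurd (Or.inl h1) hn
  · rcases lt_trichotomy E 0 with h2 | h2 | h2
    · exact absurd (Or.inr ⟨h1, Or.inl h2⟩) hn
    · rcases lt_trichotomy N 0 with h3 | h3 | h3
      · exact absurd (Or.inr ⟨h1, Or.inr ⟨h2, h3⟩⟩) hn
      · tauto
      · right; exact ⟨by linarith, Or.inr ⟨by linarith, by linarith⟩⟩
    · right; exact ⟨by linarith, Or.inl (by linarith)⟩
  · left; linarith

variable {s t : ℝ}

/-- the infinitesimally displaced point is in the interior -/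
def In (s t : ℝ) (v d m : Pt) : Prop :=
  ∀ i, LexNeg (cr v (E s t i) - C s t i) (cr d (E s t i)) (cr m (E s t i))

lemma cr_expand (v d m w : Pt) (δ : ℝ) :
    cr (v + (δ • d + δ^2 • m)) w = cr v w + δ * cr d w + δ^2 * cr m w := by
  simp [cr]; ring

lemma strict_interior {p : Pt} (h : ∀ i, cr p (E s t i) < C s t i) : p ∈ interior (Q s t) := by
  have ho : IsOpen {p : Pt | ∀ i, cr p (E s t i) < C s t i} := by
    have : {p : Pt | ∀ i, cr p (E s t i) < C s t i} = ⋂ i, {p : Pt | cr p (E s t i) < C s t i} := by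
      ext; simp
    rw [this]
    refine isOpen_iInter_of_finite fun i => ?_
    refine isOpen_lt ?_ continuous_const
    unfold cr; fun_prop
  exact interior_maximal (fun q hq i => (hq i).le) ho h

lemma in_ev {v d m : Pt} (h : In s t v d m) :
    ∀ᶠ δ in 𝓝[>] (0:ℝ), v + (δ • d + δ^2 • m) ∈ interior (Q s t) := by
  have : ∀ᶠ δ in 𝓝[>] (0:ℝ), ∀ i, (cr v (E s t i) - C s t i) + δ * cr d (E s t i) + δ^2 * cr m (E s t i) < 0 :=
    eventually_all.2 fun i => scal (h i)
  filter_upwards [this] with δ hδ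
  apply strict_interior
  intro i
  rw [cr_expand]; linarith [hδ i]

lemma out_ev {v d m : Pt} (hg : ∀ i, cr d (E s t i) ≠ 0 ∨ cr m (E s t i) ≠ 0) (h : ¬ In s t v d m) :
    ∀ᶠ δ in 𝓝[>] (0:ℝ), v + (δ • d + δ^2 • m) ∉ Q s t := by
  unfold In at h
  push Not at h
  obtain ⟨i, hi⟩ := h
  filter_upwards [scal (lex_total (hg i) hi)] with δ hδ hQ
  have := hQ i
  rw [cr_expand] at this
  linarith

/-- data of an edge -/
structure EdgeData (s t : ℝ) (j : Fin 10) (a b : Pt) : Prop where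
  ha : cr a (E s t j) = C s t j
  hb : b = a + E s t j
  haQ : a ∈ Q s t
  hbQ : b ∈ Q s t
  face : ∀ p ∈ Q s t, cr p (E s t j) = C s t j → ∃ τ : ℝ, 0 ≤ τ ∧ τ ≤ 1 ∧ p = a + τ • E s t j
  hne : ∀ i, i ≠ j → i ≠ j + 5 → cr (E s t j) (E s t i) ≠ 0
  hneg : ∀ i, E s t (i + 5) = - E s t i
  hC : ∀ i, C s t (i + 5) = C s t i
  hpos : 0 < C s t j
  he : E s t j ≠ 0

lemma cr_neg_left (p q : Pt) : cr (-p) q = - cr p q := by simp [cr]; ring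
lemma cr_neg_right (p q : Pt) : cr p (-q) = - cr p q := by simp [cr]; ring
lemma cr_self (p : Pt) : cr p p = 0 := by simp [cr]; ring

lemma claim {j : Fin 10} {a b n v : Pt} (D : EdgeData s t j a b) (hn : 0 < cr n (E s t j))
    (hv : cr v (E s t j) = C s t j) (hQ : v ∈ Q s t) (hvb : v ≠ b) :
    In s t v (E s t j) (-n) := by
  intro i
  by_cases hij : i = j
  · subst hij
    right; refine ⟨by linarith, Or.inr ⟨cr_self _, ?_⟩⟩
    rw [cr_neg_left]; linarith
  by_cases hij' : i = j + 5
  · subst hij'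
    left; rw [D.hneg, D.hC, cr_neg_right, hv]; linarith [D.hpos]
  rcases lt_or_eq_of_le (hQ i) with h1 | h1
  · left; linarith
  · right; refine ⟨by linarith, Or.inl ?_⟩
    obtain ⟨τ, h0, h2, rfl⟩ := D.face v hQ hv
    have hτ : τ < 1 := by
      refine lt_of_le_of_ne h2 ?_
      rintro rfl
      exact hvb (by rw [D.hb, one_smul])
    refine lt_of_le_of_ne ?_ (D.hne i hij hij')
    by_contra! hcon
    have h3 := D.hbQ i
    have h4 : cr b (E s t i) = cr (a + τ • E s t j) (E s t i) + (1 - τ) * cr (E s t j) (E s t i) := by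
      rw [D.hb]; simp [cr]; ring
    have := mul_pos (sub_pos.2 hτ) hcon
    linarith

lemma In_memQ {v d m : Pt} (h : In s t v d m) : v ∈ Q s t := by
  intro i
  rcases h i with h1 | h1
  · linarith
  · linarith [h1.1]

lemma In_neg {v d m : Pt} (hneg : ∀ i, E s t (i + 5) = - E s t i) (hC : ∀ i, C s t (i + 5) = C s t i)
    (h : In s t v d m) : In s t (-v) (-d) (-m) := by
  intro i
  have h5 := h (i + 5)
  rw [hneg, hC] at h5
  simp only [cr_neg_left, cr_neg_right] at *
  exact h5

lemma In_flip {j : Fin 10} {a b n v d : Pt} (D : EdgeData s t j a b)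
    (hd : d = E s t j ∨ d = - E s t j) (h1 : cr v (E s t j) < C s t j) (h2 : - C s t j < cr v (E s t j))
    (h : In s t v d n) (m : Pt) : In s t v d m := by
  intro i
  by_cases hij : i = j
  · subst hij; left; linarith
  by_cases hij' : i = j + 5
  · subst hij'
    left; rw [D.hneg, D.hC, cr_neg_right]; linarith
  have hd0 : cr d (E s t i) ≠ 0 := by
    rcases hd with rfl | rfl
    · exact D.hne i hij hij'
    · rw [cr_neg_left]; exact neg_ne_zero.2 (D.hne i hij hij')
  rcases h i with h3 | ⟨h3, h4 | h4⟩
  · exact Or.inl h3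
  · exact Or.inr ⟨h3, Or.inl h4⟩
  · exact absurd h4.1 hd0

lemma not_In_pos {j : Fin 10} {n v d : Pt} (hn : 0 < cr n (E s t j))
    (hd : cr d (E s t j) = 0) (hv : C s t j ≤ cr v (E s t j)) : ¬ In s t v d n := by
  intro h
  rcases h j with h1 | ⟨h1, h2 | h2⟩
  · linarith
  · linarith
  · linarith [h2.2]

lemma cases4 {j : Fin 10} {a b n v : Pt} (D : EdgeData s t j a b) (hn : 0 < cr n (E s t j))
    (hvb : v ≠ b) (hvb' : v ≠ -b) :
    ((In s t v (E s t j) n → In s t v (E s t j) (-n)) ∧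
      (In s t v (-E s t j) (-n) → In s t v (-E s t j) n)) ∨
    (¬ In s t v (E s t j) n ∧ (In s t v (-E s t j) (-n) → In s t v (E s t j) (-n))) ∨
    (¬ In s t v (-E s t j) (-n) ∧ (In s t v (E s t j) n → In s t v (-E s t j) n)) := by
  by_cases h1 : C s t j ≤ cr v (E s t j)
  · right; left
    refine ⟨not_In_pos hn (cr_self _) h1, fun h => ?_⟩
    have hQ := In_memQ h
    exact claim D hn (le_antisymm (hQ j) h1) hQ hvb
  by_cases h2 : C s t j ≤ cr (-v) (E s t j)
  · right; right
    constructor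
    · intro h
      have := In_neg D.hneg D.hC h
      rw [neg_neg, neg_neg] at this
      exact not_In_pos hn (cr_self _) h2 this
    · intro h
      have hQ := In_memQ (In_neg D.hneg D.hC h)
      have := In_neg D.hneg D.hC (claim D hn (le_antisymm (hQ j) h2) hQ (fun h => hvb' (by rw [← h, neg_neg])))
      simpa using this
  · left
    rw [cr_neg_left] at h2
    push Not at h1 h2
    exact ⟨fun h => In_flip D (Or.inl rfl) h1 (by linarith) h _,
      fun h => In_flip D (Or.inr rfl) h1 (by linarith) h _⟩

/-- indicator -/
def ind (p : Prop) : ℕ := by classical exact if p then 1 else 0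

lemma ind_le {p q : Prop} (h : p → q) : ind p ≤ ind q := by
  unfold ind; split_ifs <;> simp_all

lemma ind_false {p : Prop} (h : ¬ p) : ind p = 0 := by unfold ind; simp [h]
lemma ind_true {p : Prop} (h : p) : ind p = 1 := by unfold ind; simp [h]

/-- the displaced point -/
def X (v d m : Pt) (δ : ℝ) : Pt := v + (δ • d + δ^2 • m)

lemma ev_both {v d m : Pt} (hg : ∀ i, cr d (E s t i) ≠ 0 ∨ cr m (E s t i) ≠ 0) :
    ∀ᶠ δ in 𝓝[>] (0:ℝ), (In s t v d m → X v d m δ ∈ interior (Q s t)) ∧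
      (X v d m δ ∈ Q s t → In s t v d m) := by
  by_cases h : In s t v d m
  · filter_upwards [in_ev h] with δ hδ
    exact ⟨fun _ => hδ, fun _ => h⟩
  · filter_upwards [out_ev hg h] with δ hδ
    exact ⟨fun h' => absurd h' h, fun h' => absurd h' hδ⟩

lemma gen_ne {j : Fin 10} {a b n d m : Pt} (D : EdgeData s t j a b) (hn : 0 < cr n (E s t j))
    (hd : d = E s t j ∨ d = - E s t j) (hm : m = n ∨ m = -n) :
    ∀ i, cr d (E s t i) ≠ 0 ∨ cr m (E s t i) ≠ 0 := by
  intro i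
  have hm0 : cr m (E s t j) ≠ 0 := by
    rcases hm with rfl | rfl
    · exact hn.ne'
    · rw [cr_neg_left]; exact neg_ne_zero.2 hn.ne'
  by_cases hij : i = j
  · subst hij; exact Or.inr hm0
  by_cases hij' : i = j + 5
  · subst hij'; right; rw [D.hneg, cr_neg_right]; exact neg_ne_zero.2 hm0
  left
  rcases hd with rfl | rfl
  · exact D.hne i hij hij'
  · rw [cr_neg_left]; exact neg_ne_zero.2 (D.hne i hij hij')

lemma local_le {j : Fin 10} {a b n v : Pt} (D : EdgeData s t j a b) (hn : 0 < cr n (E s t j))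
    (hvb : v ≠ b) (hvb' : v ≠ -b) : ∀ᶠ δ in 𝓝[>] (0:ℝ),
    ind (X v (E s t j) n δ ∈ Q s t) + ind (X v (-E s t j) (-n) δ ∈ Q s t) ≤
    ind (X v (E s t j) (-n) δ ∈ interior (Q s t)) + ind (X v (-E s t j) n δ ∈ interior (Q s t)) := by
  filter_upwards [ev_both (v := v) (gen_ne D hn (Or.inl rfl) (Or.inl rfl)),
    ev_both (v := v) (gen_ne D hn (Or.inl rfl) (Or.inr rfl)),
    ev_both (v := v) (gen_ne D hn (Or.inr rfl) (Or.inl rfl)),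
    ev_both (v := v) (gen_ne D hn (Or.inr rfl) (Or.inr rfl))] with δ h1 h2 h3 h4
  rcases cases4 D hn hvb hvb' with ⟨c1, c2⟩ | ⟨c1, c2⟩ | ⟨c1, c2⟩
  · exact add_le_add (ind_le fun h => h2.1 (c1 (h1.2 h))) (ind_le fun h => h3.1 (c2 (h4.2 h)))
  · rw [ind_false (fun h => c1 (h1.2 h)), zero_add]
    exact le_add_right (ind_le fun h => h2.1 (c2 (h4.2 h)))
  · rw [ind_false (fun h => c1 (h4.2 h)), add_zero]
    exact le_add_left (ind_le fun h => h3.1 (c2 (h1.2 h)))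

lemma local_lt {j : Fin 10} {a b n : Pt} (D : EdgeData s t j a b) (hn : 0 < cr n (E s t j)) :
    ∀ᶠ δ in 𝓝[>] (0:ℝ),
    ind (X a (E s t j) n δ ∈ Q s t) + ind (X a (-E s t j) (-n) δ ∈ Q s t) <
    ind (X a (E s t j) (-n) δ ∈ interior (Q s t)) + ind (X a (-E s t j) n δ ∈ interior (Q s t)) := by
  have hab : a ≠ b := by
    intro h; have := D.hb; rw [← h] at this
    exact D.he (by simpa using this.symm)
  have c1 : ¬ In s t a (E s t j) n := not_In_pos hn (cr_self _) D.ha.ge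
  have c2 : In s t a (E s t j) (-n) := claim D hn D.ha D.haQ hab
  have c3 : ¬ In s t a (-E s t j) (-n) := by
    intro h
    have hev : ∀ᶠ δ in 𝓝[>] (0:ℝ), ∀ i, i ≠ j → i ≠ j + 5 →
        (cr a (E s t i) - C s t i) + δ * cr (-E s t j) (E s t i) + δ^2 * 0 < 0 := by
      refine eventually_all.2 fun i => ?_
      by_cases hij : i = j
      · simp [hij]
      by_cases hij' : i = j + 5
      · simp [hij']
      have : LexNeg (cr a (E s t i) - C s t i) (cr (-E s t j) (E s t i)) 0 := by
        rcases h i with h3 | ⟨h3, h4 | h4⟩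
        · exact Or.inl h3
        · exact Or.inr ⟨h3, Or.inl h4⟩
        · have := D.hne i hij hij'
          rw [cr_neg_left] at h4
          exact absurd (neg_eq_zero.1 h4.1) this
      filter_upwards [scal this] with δ hδ _ _ using hδ
    obtain ⟨δ, hδ, hδ0⟩ := (hev.and self_mem_nhdsWithin).exists
    have hδ0 : 0 < δ := hδ0
    have hc : cr (a + (-δ) • E s t j) (E s t j) = C s t j := by
      rw [← D.ha]; simp [cr]; ring
    have hmem : a + (-δ) • E s t j ∈ Q s t := by
      intro i
      by_cases hij : i = j
      · subst hij; exact hc.le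
      by_cases hij' : i = j + 5
      · subst hij'; rw [D.hneg, D.hC, cr_neg_right, hc]; linarith [D.hpos]
      have h6 := hδ i hij hij'
      have h7 : cr (a + (-δ) • E s t j) (E s t i) = cr a (E s t i) + δ * cr (-E s t j) (E s t i) := by
        simp [cr]; ring
      rw [h7]; linarith
    obtain ⟨τ, h0, h2, he⟩ := D.face _ hmem hc
    have h8 : (-δ - τ) • E s t j = 0 := by
      rw [sub_smul, add_left_cancel he, sub_self]
    rcases smul_eq_zero.1 h8 with h9 | h9
    · linarith
    · exact D.he h9
  filter_upwards [ev_both (v := a) (gen_ne D hn (Or.inl rfl) (Or.inl rfl)),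
    ev_both (v := a) (gen_ne D hn (Or.inl rfl) (Or.inr rfl)),
    ev_both (v := a) (gen_ne D hn (Or.inr rfl) (Or.inr rfl))] with δ h1 h2 h4
  rw [ind_false (fun h => c1 (h1.2 h)), ind_false (fun h => c3 (h4.2 h)), ind_true (h2.1 c2)]
  omega

lemma lattice_finite {L : Set Pt} (hL : IsLattice L) (p : Pt) (R : ℝ) :
    {l ∈ L | p - l ∈ Metric.closedBall (0:Pt) R}.Finite := by
  obtain ⟨B, rfl⟩ := hL
  have hc : Continuous B.symm := LinearMap.continuous_of_finiteDimensional B.symm.toLinearMap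
  have hcomp : IsCompact (B.symm '' (Metric.closedBall p R)) := (isCompact_closedBall _ _).image hc
  obtain ⟨M, hM⟩ := hcomp.isBounded.exists_norm_le
  have hfin : (Set.Icc (-⌈M⌉) ⌈M⌉ ×ˢ Set.Icc (-⌈M⌉) ⌈M⌉ : Set (ℤ × ℤ)).Finite :=
    (Set.finite_Icc _ _).prod (Set.finite_Icc _ _)
  refine (hfin.image (fun z => B (φ z))).subset ?_
  rintro l ⟨⟨q, hq, rfl⟩, hl⟩
  rw [IntLattice_eq] at hq
  obtain ⟨z, rfl⟩ := hq
  refine ⟨z, ?_, rfl⟩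
  have h1 := hM (φ z) ⟨B (φ z), by
    rw [mem_closedBall_zero_iff] at hl
    rw [Metric.mem_closedBall, dist_comm, dist_eq_norm]; exact hl, by simp⟩
  have h2 : |(z.1 : ℝ)| ≤ M := le_trans (norm_fst_le (φ z)) h1
  have h3 : |(z.2 : ℝ)| ≤ M := le_trans (norm_snd_le (φ z)) h1
  have h4 := Int.le_ceil M
  rw [abs_le] at h2 h3
  refine ⟨⟨?_, ?_⟩, ⟨?_, ?_⟩⟩
  · have : ((-⌈M⌉ : ℤ) : ℝ) ≤ z.1 := by push_cast; linarith
    exact_mod_cast this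
  · have : (z.1 : ℝ) ≤ ⌈M⌉ := by linarith
    exact_mod_cast this
  · have : ((-⌈M⌉ : ℤ) : ℝ) ≤ z.2 := by push_cast; linarith
    exact_mod_cast this
  · have : (z.2 : ℝ) ≤ ⌈M⌉ := by linarith
    exact_mod_cast this

lemma Q_compact (h : Good s t) : IsCompact (Q s t) := by
  rw [Q_eq h]; exact (Set.finite_range _).isCompact_convexHull ℝ

lemma sum_ind (T : Finset Pt) (p : Pt → Prop) :
    ∑ l ∈ T, ind (p l) = {l ∈ (T : Set Pt) | p l}.ncard := by
  classical
  have : {l ∈ (T : Set Pt) | p l} = ((T.filter p : Finset Pt) : Set Pt) := by ext; simp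
  rw [this, Set.ncard_coe_finset, Finset.card_filter]
  apply Finset.sum_congr rfl
  intro x _; unfold ind; split_ifs <;> rfl

lemma edge_cond_s3 (h : Good s t) {j : Fin 10} {a b : Pt} (D : EdgeData s t j a b) {L : Set Pt} {k : ℕ}
    (hL : IsKFoldLatticeTiling (Q s t) L k) : a + b ∈ L ∨ E s t j ∈ L := by
  by_contra! hcon
  obtain ⟨hab, he⟩ := hcon
  obtain ⟨hlat, hcov, hpack⟩ := hL
  have hLneg : ∀ l ∈ L, -l ∈ L := by
    obtain ⟨B, rfl⟩ := hlat
    rintro _ ⟨q, ⟨x, y, rfl⟩, rfl⟩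
    exact ⟨-((x:ℝ), (y:ℝ)), ⟨-x, -y, by simp⟩, by rw [map_neg]⟩
  have hL0 : (0:Pt) ∈ L := by
    obtain ⟨B, rfl⟩ := hlat
    exact ⟨0, ⟨0, 0, by ext <;> simp⟩, by simp⟩
  obtain ⟨n, hn⟩ : ∃ n, 0 < cr n (E s t j) := by
    refine ⟨((E s t j).2, -(E s t j).1), ?_⟩
    have : cr ((E s t j).2, -(E s t j).1) (E s t j) = (E s t j).2^2 + (E s t j).1^2 := by simp [cr]; ring
    rw [this]
    rcases eq_or_ne (E s t j).1 0 with h1 | h1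
    · have h2 : (E s t j).2 ≠ 0 := fun h2 => D.he (Prod.ext h1 h2)
      positivity
    · positivity
  obtain ⟨M, hM⟩ := (Q_compact h).isBounded.exists_norm_le
  have hfin := lattice_finite hlat a (M + 1)
  set T := hfin.toFinset with hT
  have hTmem : ∀ l, l ∈ T ↔ l ∈ L ∧ ‖a - l‖ ≤ M + 1 := by
    intro l; rw [hT, Set.Finite.mem_toFinset]; simp
  have hsmall : ∀ d m : Pt, ∀ᶠ δ in 𝓝[>] (0:ℝ), ‖δ • d + δ^2 • m‖ < 1 := by
    intro d m
    have hc : ContinuousAt (fun δ : ℝ => ‖δ • d + δ^2 • m‖) 0 := by fun_prop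
    have := hc.tendsto
    simp only [zero_smul, ne_eq, OfNat.ofNat_ne_zero, not_false_eq_true, zero_pow, add_zero, norm_zero] at this
    exact (this.mono_left nhdsWithin_le_nhds).eventually (gt_mem_nhds one_pos)
  have hle : ∀ᶠ δ in 𝓝[>] (0:ℝ), ∀ l ∈ T,
      ind (X (a - l) (E s t j) n δ ∈ Q s t) + ind (X (a - l) (-E s t j) (-n) δ ∈ Q s t) ≤
      ind (X (a - l) (E s t j) (-n) δ ∈ interior (Q s t)) + ind (X (a - l) (-E s t j) n δ ∈ interior (Q s t)) := by
    rw [Filter.eventually_all_finset]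
    intro l hl
    have hlL := ((hTmem l).1 hl).1
    apply local_le D hn
    · intro hb
      apply he
      have : E s t j = -l := by
        have := D.hb; rw [← hb] at this
        rw [sub_eq_add_neg] at this
        exact (add_left_cancel this).symm
      rw [this]; exact hLneg l hlL
    · intro hb
      apply hab
      have : a + b = l := by
        have : b = -(a - l) := by rw [hb, neg_neg]
        rw [this]; abel
      rwa [this]
  obtain ⟨δ, hδle, hδlt, s1, s2, s3, s4⟩ := (hle.and ((local_lt D hn).and
    ((hsmall (E s t j) n).and ((hsmall (-E s t j) (-n)).and ((hsmall (E s t j) (-n)).and (hsmall (-E s t j) n)))))).exists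
  have hXl : ∀ l d m, X (a - l) d m δ = X a d m δ - l := by intro l d m; unfold X; abel
  have hcount : ∀ d m : Pt, ‖δ • d + δ^2 • m‖ < 1 → k ≤ ∑ l ∈ T, ind (X (a - l) d m δ ∈ Q s t) := by
    intro d m hs
    rw [sum_ind]
    have h1 := hcov (X a d m δ)
    have h2 : {l ∈ L | X a d m δ - l ∈ Q s t} ⊆ {l ∈ (T : Set Pt) | X (a - l) d m δ ∈ Q s t} := by
      rintro l ⟨hl, hl2⟩
      refine ⟨?_, by simpa only [hXl] using hl2⟩
      rw [Finset.mem_coe, hTmem]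
      refine ⟨hl, ?_⟩
      have h3 := hM _ hl2
      have h4 : a - l = (X a d m δ - l) - (δ • d + δ^2 • m) := by unfold X; abel
      rw [h4]
      exact (norm_sub_le _ _).trans (by linarith)
    have hf : {l ∈ (T : Set Pt) | X (a - l) d m δ ∈ Q s t}.Finite := T.finite_toSet.subset (fun _ h => h.1)
    have h5 := h1.trans (Set.encard_le_encard h2)
    rw [← hf.cast_ncard_eq] at h5
    exact_mod_cast h5
  have hcount2 : ∀ d m : Pt, ∑ l ∈ T, ind (X (a - l) d m δ ∈ interior (Q s t)) ≤ k := by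
    intro d m
    rw [sum_ind]
    have h1 := hpack (X a d m δ)
    have h2 : {l ∈ (T : Set Pt) | X (a - l) d m δ ∈ interior (Q s t)} ⊆ {l ∈ L | X a d m δ - l ∈ interior (Q s t)} := by
      rintro l ⟨hl, hl2⟩
      rw [Finset.mem_coe, hTmem] at hl
      exact ⟨hl.1, by simpa only [hXl] using hl2⟩
    have hf : {l ∈ (T : Set Pt) | X (a - l) d m δ ∈ interior (Q s t)}.Finite := T.finite_toSet.subset (fun _ h => h.1)
    have h5 := (Set.encard_le_encard h2).trans h1
    rw [← hf.cast_ncard_eq] at h5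
    exact_mod_cast h5
  have h0T : (0:Pt) ∈ T := by
    rw [hTmem]; refine ⟨hL0, ?_⟩
    have := hM a D.haQ
    rw [sub_zero]; linarith
  have hlt := Finset.sum_lt_sum hδle ⟨0, h0T, by simpa only [sub_zero] using hδlt⟩
  rw [Finset.sum_add_distrib, Finset.sum_add_distrib] at hlt
  have k1 := hcount _ _ s1
  have k2 := hcount _ _ s2
  have k3 := hcount2 (E s t j) (-n)
  have k4 := hcount2 (-E s t j) n
  omega

lemma E_neg (i : Fin 10) : E s t (i + 5) = - E s t i := by
  fin_cases i <;> simp [E] <;> ring_nf <;> simp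
lemma C_per (i : Fin 10) : C s t (i + 5) = C s t i := by
  fin_cases i <;> rfl

lemma V_next (i : Fin 10) : V s t (i + 1) = V s t i + E s t i := by
  fin_cases i <;> simp [V, E] <;> constructor <;> ring

lemma V_E (i : Fin 10) : cr (V s t i) (E s t i) = C s t i := by
  fin_cases i <;> simp [V, E, C, cr] <;> ring

lemma EE_pos (h : Good s t) (i : Fin 10) : 0 < cr (E s t i) (E s t (i+1)) := by
  obtain ⟨h1, h2, h3, h4⟩ := h
  fin_cases i <;> simp [E, cr] <;> nlinarith

lemma E_gen (h : Good s t) (i j : Fin 10) (h1 : i ≠ j) (h2 : i ≠ j + 5) : cr (E s t j) (E s t i) ≠ 0 := by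
  obtain ⟨b1, b2, b3, b4⟩ := h.bounds
  obtain ⟨g1, g2, g3, g4⟩ := h
  intro hz
  fin_cases i <;> fin_cases j <;> first
    | exact absurd rfl h1
    | exact absurd rfl h2
    | (simp [E, cr] at hz; linarith)

lemma C_pos (h : Good s t) (i : Fin 10) : 0 < C s t i := by
  obtain ⟨b1, b2, b3, b4⟩ := h.bounds
  obtain ⟨g1, g2, g3, g4⟩ := h
  fin_cases i <;> simp [C] <;> linarith

lemma edgeData (h : Good s t) (j : Fin 10) : EdgeData s t j (V s t j) (V s t (j + 1)) where
  ha := V_E j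
  hb := V_next j
  haQ := V_mem_Q h _
  hbQ := V_mem_Q h _
  hne := fun i h1 h2 => E_gen h i j h1 h2
  hneg := E_neg
  hC := C_per
  hpos := C_pos h j
  he := E_ne h j
  face := by
    intro p hp hc
    have h1 : cr (p - V s t j) (E s t j) = 0 := by
      have := V_E (s := s) (t := t) j
      simp only [cr, Prod.fst_sub, Prod.snd_sub] at *; linarith
    obtain ⟨τ, hτ⟩ := exists_par (E_ne h j) h1
    have hp' : p = V s t j + τ • E s t j := by rw [← hτ]; abel
    refine ⟨τ, ?_, ?_, hp'⟩
    · obtain ⟨i, rfl⟩ : ∃ i, j = i + 1 := ⟨j - 1, by simp⟩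
      have h2 := hp i
      have h3 := EE_pos h i
      have h4 := V_E (s := s) (t := t) i
      rw [hp', V_next i] at h2
      have h5 : cr (V s t i + E s t i + τ • E s t (i+1)) (E s t i) = cr (V s t i) (E s t i) - τ * cr (E s t i) (E s t (i+1)) := by
        simp [cr]; ring
      rw [h5] at h2
      by_contra! hneg
      have := mul_neg_of_neg_of_pos hneg h3
      linarith
    · have h2 := hp (j+1)
      have h3 := EE_pos h j
      have h4 := V_E (s := s) (t := t) (j+1)
      rw [V_next j] at h4
      rw [hp'] at h2
      have h5 : cr (V s t j + τ • E s t j) (E s t (j+1)) = cr (V s t j + E s t j) (E s t (j+1)) + (τ - 1) * cr (E s t j) (E s t (j+1)) := by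
        simp [cr]; ring
      rw [h5] at h2
      by_contra! hneg
      have := mul_pos (sub_pos.2 hneg) h3
      linarith

end lower

section volumeArgument
open MeasureTheory

lemma volume_eq_lintegral (K : Set Pt) (hK : MeasurableSet K) :
    volume K = ∫⁻ x in (Ico (0 : ℝ) 1 ×ˢ Ico (0 : ℝ) 1 : Set Pt),
      (({l ∈ IntLattice | x - l ∈ K}.encard : ℕ∞) : ENNReal) := by
  have hF : MeasurableSet (Ico (0 : ℝ) 1 ×ˢ Ico (0 : ℝ) 1 : Set Pt) :=
    measurableSet_Ico.prod measurableSet_Ico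
  let G : ℤ × ℤ → Set Pt := fun z => {q | ⌊q.1⌋ = -z.1 ∧ ⌊q.2⌋ = -z.2}
  have hG : ∀ z, MeasurableSet (G z) := fun z =>
    (((Int.measurable_floor.comp measurable_fst) (measurableSet_singleton (-z.1))).inter
      ((Int.measurable_floor.comp measurable_snd) (measurableSet_singleton (-z.2))))
  have h1 : K = ⋃ z, K ∩ G z := by
    ext q
    simp only [mem_iUnion, mem_inter_iff]
    constructor
    · intro hq
      exact ⟨(-⌊q.1⌋, -⌊q.2⌋), hq, by simp [G]⟩
    · rintro ⟨z, hz, _⟩; exact hz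
  have hdisj : Pairwise (Function.onFun Disjoint fun z => K ∩ G z) := by
    intro z w hzw
    refine Set.disjoint_left.2 ?_
    rintro q ⟨_, h1, h2⟩ ⟨_, h3, h4⟩
    exact hzw (Prod.ext (by omega) (by omega))
  have hmeas : ∀ z, MeasurableSet ((fun x : Pt => x - φ z) ⁻¹' K) := fun z =>
    (measurable_id.sub_const (φ z)) hK
  have h2 : ∀ z, volume (K ∩ G z) =
      ∫⁻ x in (Ico (0 : ℝ) 1 ×ˢ Ico (0 : ℝ) 1 : Set Pt),
        ((fun x : Pt => x - φ z) ⁻¹' K).indicator 1 x := by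
    intro z
    rw [lintegral_indicator_one (hmeas z), Measure.restrict_apply (hmeas z)]
    rw [← measure_preimage_add_right volume (-φ z) (K ∩ G z)]
    simp only [← sub_eq_add_neg]
    congr 1
    ext x
    simp only [mem_preimage, mem_inter_iff, G, mem_setOf_eq, mem_prod, mem_Ico, Int.floor_eq_iff, φ,
      Prod.fst_sub, Prod.snd_sub]
    push_cast
    refine and_congr_right fun _ => ?_
    constructor
    · rintro ⟨⟨_, _⟩, _, _⟩; refine ⟨⟨?_, ?_⟩, ?_, ?_⟩ <;> linarith
    · rintro ⟨⟨_, _⟩, _, _⟩; refine ⟨⟨?_, ?_⟩, ?_, ?_⟩ <;> linarith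
  conv_lhs => rw [h1]
  rw [measure_iUnion hdisj (fun z => hK.inter (hG z))]
  simp_rw [h2]
  rw [← lintegral_tsum (fun z => (measurable_one.indicator (hmeas z)).aemeasurable)]
  refine lintegral_congr fun x => ?_
  have h3 : {l ∈ IntLattice | x - l ∈ K} = φ '' {z | x - φ z ∈ K} := by
    ext l
    rw [IntLattice_eq]
    constructor
    · rintro ⟨⟨z, rfl⟩, hz⟩; exact ⟨z, hz, rfl⟩
    · rintro ⟨z, hz, rfl⟩; exact ⟨⟨z, rfl⟩, hz⟩
  rw [h3, φ_inj.encard_image, ← ENNReal.tsum_set_one,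
    tsum_subtype {z | x - φ z ∈ K} (fun _ => (1 : ENNReal))]
  rfl

lemma volume_F : volume (Ico (0 : ℝ) 1 ×ˢ Ico (0 : ℝ) 1 : Set Pt) = 1 := by
  rw [Measure.volume_eq_prod, Measure.prod_prod]; simp

lemma volume_of_tiling {K : Set Pt} (hc : Convex ℝ K) (hK : IsCompact K) {k : ℕ}
    (h1 : ∀ p : Pt, (k : ℕ∞) ≤ {l ∈ IntLattice | p - l ∈ K}.encard)
    (h2 : ∀ p : Pt, {l ∈ IntLattice | p - l ∈ interior K}.encard ≤ (k : ℕ∞)) :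
    volume K = k := by
  have hconst : ∫⁻ _ in (Ico (0 : ℝ) 1 ×ˢ Ico (0 : ℝ) 1 : Set Pt), (k : ENNReal) = k := by
    rw [setLIntegral_const, volume_F, mul_one]
  apply le_antisymm
  · have : volume K ≤ volume (interior K) := by
      have hsub : K ⊆ interior K ∪ frontier K := by
        intro x hx
        by_cases hi : x ∈ interior K
        · exact Or.inl hi
        · exact Or.inr ⟨subset_closure hx, hi⟩
      calc volume K ≤ volume (interior K ∪ frontier K) := measure_mono hsub
        _ ≤ volume (interior K) + volume (frontier K) := measure_union_le _ _
        _ = volume (interior K) := by rw [hc.addHaar_frontier volume, add_zero]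
    refine this.trans ?_
    rw [volume_eq_lintegral _ isOpen_interior.measurableSet, ← hconst]
    refine lintegral_mono fun x => ?_
    have := ENat.toENNReal_le.2 (h2 x)
    simpa using this
  · rw [volume_eq_lintegral _ hK.measurableSet, ← hconst]
    refine lintegral_mono fun x => ?_
    have := ENat.toENNReal_le.2 (h1 x)
    simpa using this

lemma det_cr (B : Pt ≃ₗ[ℝ] Pt) (p q : Pt) :
    cr (B p) (B q) = LinearMap.det (B : Pt →ₗ[ℝ] Pt) * cr p q := by
  have hd : LinearMap.det (B : Pt →ₗ[ℝ] Pt) = cr (B (1, 0)) (B (0, 1)) := by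
    rw [← LinearMap.det_toMatrix (Module.Basis.finTwoProd ℝ), Matrix.det_fin_two]
    simp [LinearMap.toMatrix_apply, cr]
    ring
  have key : ∀ r : Pt, B r = r.1 • B (1, 0) + r.2 • B (0, 1) := by
    intro r
    rw [← map_smul, ← map_smul, ← map_add]
    congr 1
    ext <;> simp
  rw [hd, key p, key q]
  simp only [cr, Prod.fst_add, Prod.snd_add, Prod.smul_fst, Prod.smul_snd, smul_eq_mul]
  ring

lemma lattice_det {s t : ℝ} (h : Good s t) {L : Set Pt} {k : ℕ}
    (hL : IsKFoldLatticeTiling (Q s t) L k) :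
    ∀ x ∈ L, ∀ y ∈ L, ∃ m : ℤ, (k : ℝ) * cr x y = 6 * m := by
  obtain ⟨⟨B, rfl⟩, h1, h2⟩ := hL
  have hd : LinearMap.det (B : Pt →ₗ[ℝ] Pt) ≠ 0 := (LinearEquiv.isUnit_det' B).ne_zero
  set d := LinearMap.det (B : Pt →ₗ[ℝ] Pt) with hdd
  obtain ⟨_, g1, g2⟩ := six_tiling h
  have v6 : volume (Q s t) = (6 : ℕ) := volume_of_tiling (Q_convex ..) (Q_compact h) g1 g2
  have hset : ∀ (S : Set Pt) (p : Pt), {l ∈ B '' IntLattice | B p - l ∈ S} =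
      B '' {l ∈ IntLattice | p - l ∈ B ⁻¹' S} := by
    intro S p
    ext l
    constructor
    · rintro ⟨⟨z, hz, rfl⟩, hl⟩
      exact ⟨z, ⟨hz, by simpa using hl⟩, rfl⟩
    · rintro ⟨z, ⟨hz, hl⟩, rfl⟩
      exact ⟨⟨z, hz, rfl⟩, by simpa using hl⟩
  have hdivs : interior (B ⁻¹' Q s t) = B ⁻¹' interior (Q s t) :=
    (B.toContinuousLinearEquiv.toHomeomorph.preimage_interior (Q s t)).symm
  have hcomp : IsCompact (B ⁻¹' Q s t) :=
    B.toContinuousLinearEquiv.toHomeomorph.isCompact_preimage.2 (Q_compact h)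
  have vk : volume (B ⁻¹' Q s t) = k := by
    refine volume_of_tiling ((Q_convex ..).linear_preimage (B : Pt →ₗ[ℝ] Pt)) hcomp ?_ ?_
    · intro p
      have := h1 (B p)
      rwa [hset, B.injective.encard_image] at this
    · intro p
      have := h2 (B p)
      rwa [hset, B.injective.encard_image, ← hdivs] at this
  have hv : volume (B ⁻¹' Q s t) = ENNReal.ofReal |d⁻¹| * volume (Q s t) :=
    Measure.addHaar_preimage_linearMap volume (f := (B : Pt →ₗ[ℝ] Pt)) hd _
  rw [vk, v6] at hv
  have hv2 : (k : ℝ) = |d⁻¹| * 6 := by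
    have := congrArg ENNReal.toReal hv
    rw [ENNReal.toReal_mul, ENNReal.toReal_ofReal (abs_nonneg _)] at this
    simpa using this
  have hkd : (k : ℝ) * d = 6 ∨ (k : ℝ) * d = -6 := by
    rcases abs_choice d⁻¹ with e | e
    · left; rw [hv2, e]; field_simp
    · right; rw [hv2, e]; field_simp
  rintro _ ⟨x, ⟨a, b, rfl⟩, rfl⟩ _ ⟨y, ⟨a', b', rfl⟩, rfl⟩
  rw [det_cr, ← hdd, ← mul_assoc]
  rcases hkd with e | e
  · exact ⟨a * b' - b * a', by rw [e]; simp [cr]⟩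
  · exact ⟨-(a * b' - b * a'), by rw [e]; simp [cr]; ring⟩

set_option maxHeartbeats 1000000 in
lemma no_small_s3 {s t : ℝ} (h : Good s t) (k : ℕ) (hk0 : 0 < k) (hk6 : k < 6) (L : Set Pt)
    (hL : IsKFoldLatticeTiling (Q s t) L k) : False := by
  have hdet := lattice_det h hL
  have hkR : (1 : ℝ) ≤ k := by exact_mod_cast hk0
  have hk5 : (k : ℝ) ≤ 5 := by exact_mod_cast Nat.le_of_lt_succ hk6
  obtain ⟨b1, b2, b3, b4⟩ := h.bounds
  obtain ⟨c1, c2, c3, c4⟩ := id h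
  -- integer determinants
  have hdivs : ∀ (n : ℤ) (x y : Pt), x ∈ L → y ∈ L → cr x y = n → (6 : ℤ) ∣ k * n := by
    intro n x y hx hy e
    obtain ⟨m, hm⟩ := hdet x hx y hy
    rw [e] at hm
    exact ⟨m, by exact_mod_cast hm⟩
  -- determinants strictly between zero and one
  have hsmall : ∀ x y : Pt, x ∈ L → y ∈ L → 0 < cr x y → cr x y < 1 → False := by
    intro x y hx hy e1 e2
    obtain ⟨m, hm⟩ := hdet x hx y hy
    have p1 : (0 : ℝ) < 6 * m := by rw [← hm]; positivity
    have p2 : (6 : ℝ) * m < 6 := by rw [← hm]; nlinarith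
    have p3 : (0 : ℤ) < m := by
      have : (0 : ℝ) < m := by linarith
      exact_mod_cast this
    have p4 : m < (1 : ℤ) := by
      have : (m : ℝ) < 1 := by linarith
      exact_mod_cast this
    omega
  have e1 := edge_cond_s3 h (edgeData h 0) hL
  have e2 := edge_cond_s3 h (edgeData h 1) hL
  have e4 := edge_cond_s3 h (edgeData h 3) hL
  have e5 := edge_cond_s3 h (edgeData h 4) hL
  have s1 : V s t 0 + V s t (0 + 1) = (1, -2) := by
    ext <;> simp [V] <;> ring
  have s2 : V s t 1 + V s t (1 + 1) = (3, -1) := by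
    change (1 - s, -1 + t) + (2 + s, -t) = ((3, -1) : Pt)
    ext <;> simp <;> ring
  have s4 : V s t 3 + V s t (3 + 1) = (3, 1) := by
    change (2 - s, t) + (1 + s, 1 - t) = ((3, 1) : Pt)
    ext <;> simp <;> ring
  have s5 : V s t 4 + V s t (4 + 1) = (1, 2) := by
    change (1 + s, 1 - t) + (-s, 1 + t) = ((1, 2) : Pt)
    ext <;> simp <;> ring
  rw [s1] at e1
  rw [s2] at e2
  rw [s4] at e4
  rw [s5] at e5
  have E0 : E s t 0 = (1 - 2*s, 2*t) := rfl
  have E1 : E s t 1 = (1 + 2*s, 1 - 2*t) := rfl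
  have E3 : E s t 3 = (-1 + 2*s, 1 - 2*t) := rfl
  have E4 : E s t 4 = (-1 - 2*s, 2*t) := rfl
  rw [E0] at e1
  rw [E1] at e2
  rw [E3] at e4
  rw [E4] at e5
  have n12 : ((1, -2) : Pt) ∈ L → ((3, -1) : Pt) ∈ L → False := by
    intro hx hy
    have := hdivs 5 _ _ hx hy (by norm_num [cr])
    omega
  have n45 : ((3, 1) : Pt) ∈ L → ((1, 2) : Pt) ∈ L → False := by
    intro hx hy
    have := hdivs 5 _ _ hx hy (by norm_num [cr])
    omega
  have n14 : ((1, -2) : Pt) ∈ L → ((3, 1) : Pt) ∈ L → False := by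
    intro hx hy
    have := hdivs 7 _ _ hx hy (by norm_num [cr])
    omega
  have n25 : ((3, -1) : Pt) ∈ L → ((1, 2) : Pt) ∈ L → False := by
    intro hx hy
    have := hdivs 7 _ _ hx hy (by norm_num [cr])
    omega
  have m15 : ((1 - 2*s, 2*t) : Pt) ∈ L → ((-1 - 2*s, 2*t) : Pt) ∈ L → False := by
    intro hx hy
    exact hsmall _ _ hx hy (by simp only [cr]; nlinarith) (by simp only [cr]; nlinarith)
  have m12 : ((1 - 2*s, 2*t) : Pt) ∈ L → ((1 + 2*s, 1 - 2*t) : Pt) ∈ L → False := by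
    intro hx hy
    exact hsmall _ _ hx hy (by simp only [cr]; nlinarith) (by simp only [cr]; nlinarith)
  have m45 : ((-1 + 2*s, 1 - 2*t) : Pt) ∈ L → ((-1 - 2*s, 2*t) : Pt) ∈ L → False := by
    intro hx hy
    exact hsmall _ _ hx hy (by simp only [cr]; nlinarith) (by simp only [cr]; nlinarith)
  have mfin : ((1, -2) : Pt) ∈ L → ((1, 2) : Pt) ∈ L → ((1 + 2*s, 1 - 2*t) : Pt) ∈ L →
      ((-1 + 2*s, 1 - 2*t) : Pt) ∈ L → False := by
    intro hx hy hz hw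
    have h4 := hdivs 4 _ _ hx hy (by norm_num [cr])
    have hk3 : k = 3 := by omega
    obtain ⟨m, hm⟩ := hdet _ hz _ hw
    subst hk3
    simp only [cr] at hm
    push_cast at hm
    have q1 : (0 : ℝ) < m := by nlinarith
    have q2 : (m : ℝ) < 1 := by nlinarith
    have q3 : (0 : ℤ) < m := by exact_mod_cast q1
    have q4 : m < (1 : ℤ) := by exact_mod_cast q2
    omega
  rcases e1 with a | a
  · rcases e2 with b | b
    · exact n12 a b
    · rcases e4 with c | c
      · exact n14 a c
      · rcases e5 with d | d
        · exact mfin a d b c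
        · exact m45 c d
  · rcases e5 with d | d
    · rcases e2 with b | b
      · exact n25 b d
      · exact m12 a b
    · exact m15 a d

end volumeArgument

/-- every centrally symmetric convex decagon centered at the origin whose set of
edge midpoints is `D₂` satisfies: `P + ℤ²` is a six-fold lattice tiling, and `P` admits no
`k`-fold lattice tiling for any positive `k < 6`. -/
theorem decagonD2_sixfold_lattice_tile (P : Set Pt) (hP : IsConvexPolygon P 10)
    (hsym : P = -P) (hmid : edgeMidpoints P = D2) :
    IsKFoldLatticeTiling P IntLattice 6 ∧
    ∀ k : ℕ, 0 < k → k < 6 → ¬∃ L : Set Pt, IsKFoldLatticeTiling P L k := by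
  obtain ⟨s, t, h1, h2, h3, h4, rfl⟩ := structureP hP hmid
  have h : Good s t := ⟨h1, h2, h3, h4⟩
  rw [← Q_eq h]
  refine ⟨six_tiling h, ?_⟩
  rintro k hk0 hk6 ⟨L, hL⟩
  exact no_small_s3 h k hk0 hk6 L hL
end
end
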